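/- arXiv:2512.20767 — 3 statements merged into one kernel-verified Lean document; each statement's English description precedes it below -/
import Mathlib

section
/- Let d ≥ 2. The set of critical exponents of non-confined boomerang subgroups of F_d is dense in [0, log(2d−1)]: for every x ∈ [0, log(2d−1)] and every ε > 0 there exists a boomerang subgroup Δ of F_d that is not confined and satisfies |δ(Δ) − x| < ε. -/
open Filter

/-- The number of elements of `Γ` of word length at most `R`. -/
noncomputable def growthCount {d : ℕ} (Γ : Subgroup (FreeGroup (Fin d))) (R : ℕ) : ℕ :=
  Nat.card {g : FreeGroup (Fin d) // g ∈ Γ ∧ FreeGroup.norm g ≤ R}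

/-- The critical exponent `δ(Γ) = limsup_R log(c_Γ(R))/R`. -/
noncomputable def critExp {d : ℕ} (Γ : Subgroup (FreeGroup (Fin d))) : ℝ :=
  Filter.atTop.limsup fun R : ℕ => Real.log (growthCount Γ R : ℝ) / (R : ℝ)

/-- Chabauty convergence of a sequence of subgroups. -/
def ChabautyTendsto {G : Type*} [Group G] (H : ℕ → Subgroup G) (L : Subgroup G) : Prop :=
  ∀ g : G, ∀ᶠ n in Filter.atTop, (g ∈ H n ↔ g ∈ L)

/-- A boomerang subgroup. -/
def IsBoomerang {G : Type*} [Group G] (Δ : Subgroup G) : Prop :=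
  ∀ g : G, ∃ n : ℕ → ℕ, StrictMono n ∧
    ChabautyTendsto (fun k => Subgroup.map (MulAut.conj (g ^ n k)).toMonoidHom Δ) Δ


namespace BD
open FreeGroup

section tree
set_option linter.unusedSectionVars false
variable {α : Type*} [DecidableEq α]

lemma toWord_mk_red {L : List (α × Bool)} (h : IsReduced L) : (FreeGroup.mk L).toWord = L := by
  rw [toWord_mk, h.reduce_eq]

lemma norm_mk_red {L : List (α × Bool)} (h : IsReduced L) : (FreeGroup.mk L).norm = L.length := by
  rw [FreeGroup.norm, toWord_mk_red h]

lemma red_invRev {L : List (α × Bool)} (h : IsReduced L) : IsReduced (invRev L) := by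
  rw [isReduced_iff_reduce_eq, reduce_invRev, h.reduce_eq]

lemma red_left {L M : List (α × Bool)} (h : IsReduced (L ++ M)) : IsReduced L :=
  h.infix ⟨[], M, by simp⟩

lemma red_right {L M : List (α × Bool)} (h : IsReduced (L ++ M)) : IsReduced M :=
  h.infix ⟨L, [], by simp⟩

lemma exists_lcp (L₁ : List (α × Bool)) : ∀ (L₂ : List (α × Bool)), IsReduced L₁ → IsReduced L₂ →
    ∃ P A B, L₁ = P ++ A ∧ L₂ = P ++ B ∧ IsReduced (invRev A ++ B) := by
  induction L₁ with
  | nil => intro L₂ _ h; exact ⟨[], [], L₂, by simp, by simp, by simpa using h⟩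
  | cons x L ih =>
    intro L₂ h₁ h₂
    cases L₂ with
    | nil => exact ⟨[], x :: L, [], by simp, by simp, by simpa using red_invRev h₁⟩
    | cons y M =>
      by_cases hxy : x = y
      · subst hxy
        obtain ⟨P, A, B, h3, h4, h5⟩ := ih M (red_right (L := [x]) h₁) (red_right (L := [x]) h₂)
        exact ⟨x :: P, A, B, by simp [h3], by simp [h4], h5⟩
      · refine ⟨[], x :: L, y :: M, by simp, by simp, ?_⟩
        have h1 : IsReduced (invRev L ++ invRev [x]) := by
          rw [← invRev_cons]; exact red_invRev h₁
        have h2 : IsReduced (invRev [x] ++ (y :: M)) := by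
          simp only [invRev, List.map_cons, List.map_nil, List.reverse_cons, List.reverse_nil,
            List.nil_append, List.cons_append]
          rw [isReduced_cons_cons]
          refine ⟨?_, h₂⟩
          intro h
          rcases x with ⟨x1, x2⟩
          rcases y with ⟨y1, y2⟩
          simp only at h ⊢
          subst h
          simp only [Prod.mk.injEq, true_and] at hxy
          cases x2 <;> cases y2 <;> simp_all
        have := IsReduced.append_overlap h1 h2 (by simp [invRev])
        rw [invRev_cons]; exact this

/-- decomposition along the common prefix -/
lemma exists_cp (a b : FreeGroup α) : ∃ P A B, a.toWord = P ++ A ∧ b.toWord = P ++ B ∧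
    IsReduced (invRev A ++ B) :=
  exists_lcp _ _ isReduced_toWord isReduced_toWord

lemma inv_mul_eq {a b : FreeGroup α} {P A B} (ha : a.toWord = P ++ A) (hb : b.toWord = P ++ B) :
    a⁻¹ * b = FreeGroup.mk (invRev A ++ B) := by
  rw [← mk_toWord (x := a), ← mk_toWord (x := b), ha, hb, ← mul_mk, ← mul_mk, ← mul_mk, ← inv_mk]
  group

/-- The Gromov product. -/
def gp (a b : FreeGroup α) : ℕ := (a.norm + b.norm - (a⁻¹ * b).norm) / 2

lemma gp_spec (a b : FreeGroup α) : 2 * gp a b + (a⁻¹ * b).norm = a.norm + b.norm := by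
  obtain ⟨P, A, B, ha, hb, h⟩ := exists_cp a b
  have h1 : (a⁻¹ * b).norm = A.length + B.length := by
    rw [inv_mul_eq ha hb, norm_mk_red h]; simp
  have h2 : a.norm = P.length + A.length := by rw [FreeGroup.norm, ha]; simp
  have h3 : b.norm = P.length + B.length := by rw [FreeGroup.norm, hb]; simp
  unfold gp; omega

lemma le_gp_iff (a b : FreeGroup α) (k : ℕ) :
    k ≤ gp a b ↔ ∃ P : List (α × Bool), P.length = k ∧ P <+: a.toWord ∧ P <+: b.toWord := by
  have hs := gp_spec a b
  constructor
  · intro hk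
    obtain ⟨P, A, B, ha, hb, h⟩ := exists_cp a b
    have h1 : (a⁻¹ * b).norm = A.length + B.length := by
      rw [inv_mul_eq ha hb, norm_mk_red h]; simp
    have h2 : a.norm = P.length + A.length := by rw [FreeGroup.norm, ha]; simp
    have h3 : b.norm = P.length + B.length := by rw [FreeGroup.norm, hb]; simp
    refine ⟨P.take k, by simp; omega, ?_, ?_⟩
    · rw [ha]; exact (List.take_prefix _ _).trans (List.prefix_append _ _)
    · rw [hb]; exact (List.take_prefix _ _).trans (List.prefix_append _ _)
  · rintro ⟨P, hP, ⟨A, hA⟩, ⟨B, hB⟩⟩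
    have h1 : (a⁻¹ * b).norm ≤ A.length + B.length := by
      rw [inv_mul_eq hA.symm hB.symm]; refine norm_mk_le.trans ?_; simp
    have h2 : a.norm = P.length + A.length := by rw [FreeGroup.norm, ← hA]; simp
    have h3 : b.norm = P.length + B.length := by rw [FreeGroup.norm, ← hB]; simp
    omega

lemma gp_hyp (a b c : FreeGroup α) : min (gp a b) (gp b c) ≤ gp a c := by
  rw [le_gp_iff]
  obtain ⟨P, hP, h1, h2⟩ := (le_gp_iff a b _).1 (min_le_left (gp a b) (gp b c))
  obtain ⟨Q, hQ, h3, h4⟩ := (le_gp_iff b c _).1 (min_le_right (gp a b) (gp b c))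
  have : P = Q := (List.prefix_of_prefix_length_le h2 h3 (by omega)).eq_of_length (by omega)
  subst this
  exact ⟨P, hP, h1, h4⟩

lemma gp_comm (a b : FreeGroup α) : gp a b = gp b a := by
  have h1 := gp_spec a b
  have h2 := gp_spec b a
  have : (a⁻¹ * b).norm = (b⁻¹ * a).norm := by
    rw [← norm_inv_eq (x := a⁻¹ * b)]; congr 1; group
  omega

/-- `u` is a prefix of `g`. -/
def Pre (u g : FreeGroup α) : Prop := u.toWord <+: g.toWord

lemma Pre.norm_eq {u g : FreeGroup α} (h : Pre u g) : g.norm = u.norm + (u⁻¹ * g).norm := by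
  obtain ⟨V, hV⟩ := h
  have h1 : u⁻¹ * g = FreeGroup.mk V := by
    have := inv_mul_eq (a := u) (b := g) (P := u.toWord) (A := []) (B := V) (by simp) hV.symm
    simpa using this
  have hr : IsReduced V := red_right (L := u.toWord) (hV ▸ isReduced_toWord)
  rw [h1, norm_mk_red hr, FreeGroup.norm, FreeGroup.norm, ← hV]; simp

lemma toWord_mul_of_norm {a b : FreeGroup α} (h : (a * b).norm = a.norm + b.norm) :
    (a * b).toWord = a.toWord ++ b.toWord := by
  refine (toWord_mul_sublist a b).eq_of_length ?_
  simpa [FreeGroup.norm] using h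

lemma pre_mul_of_norm {a b : FreeGroup α} (h : (a * b).norm = a.norm + b.norm) : Pre a (a * b) :=
  ⟨b.toWord, (toWord_mul_of_norm h).symm⟩

lemma Pre.of_norm {u g : FreeGroup α} (h : g.norm = u.norm + (u⁻¹ * g).norm) : Pre u g := by
  have := pre_mul_of_norm (a := u) (b := u⁻¹ * g) (by simpa using h)
  simpa using this

lemma Pre.norm_le {u g : FreeGroup α} (h : Pre u g) : u.norm ≤ g.norm := h.length_le

lemma Pre.eq_of_norm {u v g : FreeGroup α} (h : Pre u g) (h' : Pre v g) (hn : u.norm = v.norm) :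
    u = v :=
  toWord_injective <| (List.prefix_of_prefix_length_le h h' hn.le).eq_of_length hn

lemma Pre.trans {u v g : FreeGroup α} (h : Pre u v) (h' : Pre v g) : Pre u g :=
  List.IsPrefix.trans h h'

lemma Pre.of_le {u v g : FreeGroup α} (h : Pre u g) (h' : Pre v g) (hn : u.norm ≤ v.norm) :
    Pre u v := List.prefix_of_prefix_length_le h h' hn

lemma pre_one {g : FreeGroup α} : Pre 1 g := by simp [Pre]

lemma pre_self {g : FreeGroup α} : Pre g g := List.prefix_rfl

lemma Pre.le_gp {u a b : FreeGroup α} (h : Pre u a) (h' : Pre u b) : u.norm ≤ gp a b :=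
  (le_gp_iff a b _).2 ⟨u.toWord, rfl, h, h'⟩

lemma exists_pre_of_le_gp {a b : FreeGroup α} {k : ℕ} (h : k ≤ gp a b) :
    ∃ u, Pre u a ∧ Pre u b ∧ u.norm = k := by
  obtain ⟨P, hP, h1, h2⟩ := (le_gp_iff a b _).1 h
  have hr : IsReduced P := by
    obtain ⟨V, hV⟩ := h1
    exact red_left (M := V) (hV ▸ isReduced_toWord)
  refine ⟨FreeGroup.mk P, ?_, ?_, ?_⟩
  · rwa [Pre, toWord_mk_red hr]
  · rwa [Pre, toWord_mk_red hr]
  · rw [norm_mk_red hr, hP]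

lemma exists_pre_of_le {a : FreeGroup α} {k : ℕ} (h : k ≤ a.norm) :
    ∃ u, Pre u a ∧ u.norm = k := by
  have hs := gp_spec a a
  simp at hs
  obtain ⟨u, h1, _, h2⟩ := exists_pre_of_le_gp (a := a) (b := a) (k := k) (by omega)
  exact ⟨u, h1, h2⟩

lemma Pre.mul {q a b : FreeGroup α} (h : Pre q (a * b)) :
    Pre q a ∨ ∃ q', Pre q' b ∧ q = a * q' := by
  obtain ⟨P, A, B, ha, hb, hr⟩ := exists_cp a⁻¹ b
  have hab : (a * b).toWord = invRev A ++ B := by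
    have := inv_mul_eq ha hb
    rw [inv_inv] at this
    rw [this, toWord_mk_red hr]
  have ha' : a.toWord = invRev A ++ invRev P := by
    rw [← inv_inv a, toWord_inv, ha, invRev_append]
  rw [Pre, hab] at h
  have h' : q.toWord <+: invRev A ∨ ∃ l, q.toWord = invRev A ++ l ∧ l <+: B := by
    rcases le_total q.toWord.length (invRev A).length with hle | hle
    · exact Or.inl (List.prefix_of_prefix_length_le h (List.prefix_append _ _) hle)
    · obtain ⟨l, hl⟩ := List.prefix_of_prefix_length_le (List.prefix_append _ _) h hle
      refine Or.inr ⟨l, hl.symm, ?_⟩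
      rw [← hl] at h
      exact (List.prefix_append_right_inj _).1 h
  rcases h' with h | ⟨l, hl, hlB⟩
  · left
    rw [Pre, ha']
    exact h.trans (List.prefix_append _ _)
  · right
    obtain ⟨B', hB'⟩ := hlB
    have hr' : IsReduced (P ++ l) := by
      have : IsReduced b.toWord := isReduced_toWord
      rw [hb, ← hB', ← List.append_assoc] at this
      exact red_left this
    refine ⟨FreeGroup.mk (P ++ l), ?_, ?_⟩
    · rw [Pre, toWord_mk_red hr', hb, ← hB']
      exact ⟨B', by simp⟩
    · rw [← mk_toWord (x := q), hl, ← mk_toWord (x := a), ha', ← mul_mk, ← mul_mk, ← mul_mk,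
        ← inv_mk, ← inv_mk]
      group

/-- prefixes of powers -/
lemma Pre.pow {q z : FreeGroup α} {n : ℕ} (h : Pre q (z ^ n)) :
    ∃ (i : ℕ) (w : FreeGroup α), w.norm ≤ z.norm ∧ q = z ^ i * w := by
  induction n generalizing q with
  | zero =>
    refine ⟨0, 1, by simp, ?_⟩
    have := h.norm_le
    simp at this
    simp [this]
  | succ n ih =>
    rw [pow_succ'] at h
    rcases h.mul with h | ⟨q', h', rfl⟩
    · exact ⟨0, q, h.norm_le, by simp⟩
    · obtain ⟨i, w, hw, rfl⟩ := ih h'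
      exact ⟨i + 1, w, hw, by rw [pow_succ', mul_assoc]⟩

lemma Pre.zpow {q z : FreeGroup α} {n : ℤ} (h : Pre q (z ^ n)) :
    ∃ (i : ℤ) (w : FreeGroup α), w.norm ≤ z.norm ∧ q = z ^ i * w := by
  rcases n with n | n
  · rw [Int.ofNat_eq_natCast, zpow_natCast] at h
    obtain ⟨i, w, hw, rfl⟩ := h.pow
    exact ⟨i, w, hw, by simp⟩
  · rw [zpow_negSucc, ← inv_pow] at h
    obtain ⟨i, w, hw, rfl⟩ := h.pow
    exact ⟨-i, w, by simpa using hw, by simp⟩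

lemma le_norm_pow {g : FreeGroup α} (hg : g ≠ 1) (n : ℕ) : n ≤ (g ^ n).norm := by
  rcases n with _ | n
  · simp
  have h := reduceCyclically.reduce_flatten_replicate_succ (isReduced_toWord (x := g)) n
  rw [FreeGroup.norm, toWord_pow, h]
  have : 1 ≤ (reduceCyclically g.toWord).length := by
    by_contra hc
    have h0 : reduceCyclically g.toWord = [] := by
      rw [← List.length_eq_zero_iff]; omega
    have h1 := reduceCyclically.conj_conjugator_reduceCyclically g.toWord
    rw [h0] at h1
    apply hg
    rw [← mk_toWord (x := g), ← h1, List.append_nil, ← mul_mk, ← inv_mk]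
    group
  simp only [List.length_append, List.length_flatten, List.map_replicate, List.sum_replicate,
    smul_eq_mul]
  nlinarith

lemma le_norm_zpow {g : FreeGroup α} (hg : g ≠ 1) (n : ℤ) : n.natAbs ≤ (g ^ n).norm := by
  rcases n with n | n
  · simpa using le_norm_pow hg n
  · rw [zpow_negSucc, norm_inv_eq]
    exact le_norm_pow hg _

lemma ball_finite [Finite α] (R : ℕ) : {g : FreeGroup α | g.norm ≤ R}.Finite := by
  refine Set.Finite.of_injOn (f := FreeGroup.toWord) (t := {L | L.length ≤ R}) ?_ ?_ ?_
  · intro g hg; exact hg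
  · exact toWord_injective.injOn
  · exact List.finite_length_le _ _

end tree
end BD


namespace BD
open FreeGroup

section quasi
variable {α : Type*} [DecidableEq α]

lemma pigeon {β : Type*} {A : Set β} (hA : A.Finite) (f : ℕ → β) (c : ℕ)
    (hf : ∀ l, c ≤ l → l ≤ c + A.ncard → f l ∈ A) :
    ∃ l l', c ≤ l ∧ l ≤ c + A.ncard ∧ c ≤ l' ∧ l' ≤ c + A.ncard ∧ l ≠ l' ∧ f l = f l' := by
  classical
  have hcard : hA.toFinset.card < (Finset.Icc c (c + A.ncard)).card := by
    rw [Set.ncard_eq_toFinset_card A hA]; simp; omega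
  obtain ⟨l, hl, l', hl', hne, he⟩ := Finset.exists_ne_map_eq_of_card_lt_of_maps_to hcard
    (f := f) (by
      intro l hl
      simp only [Finset.coe_Icc, Set.mem_Icc] at hl
      simpa using hf l hl.1 hl.2)
  simp only [Finset.mem_Icc] at hl hl'
  exact ⟨l, l', hl.1, hl.2, hl'.1, hl'.2, hne, he⟩

lemma Pre.inv {q x : FreeGroup α} (h : Pre q x⁻¹) : Pre (x * q) x := by
  apply Pre.of_norm
  have h1 := h.norm_eq
  rw [norm_inv_eq] at h1
  have h2 : (q⁻¹ * x⁻¹).norm = (x * q).norm := by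
    rw [← norm_inv_eq]; congr 1; group
  have h3 : ((x * q)⁻¹ * x).norm = q.norm := by
    rw [← norm_inv_eq]; congr 1; group
  omega

lemma fg_pre [Finite α] {Γ : Subgroup (FreeGroup α)} (hΓ : Γ.FG) :
    ∃ K : Set (FreeGroup α), K.Finite ∧ ∀ γ ∈ Γ, ∀ q, Pre q γ → ∃ γ₁ ∈ Γ, ∃ κ ∈ K, q = γ₁ * κ := by
  obtain ⟨S, rfl⟩ := hΓ
  refine ⟨{g | g.norm ≤ S.sup FreeGroup.norm}, ball_finite _, ?_⟩
  intro γ hγ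
  induction hγ using Subgroup.closure_induction with
  | mem x hx =>
    intro q hq
    refine ⟨1, one_mem _, q, ?_, by simp⟩
    exact hq.norm_le.trans (Finset.le_sup (f := FreeGroup.norm) hx)
  | one =>
    intro q hq
    have := hq.norm_le
    simp at this
    exact ⟨1, one_mem _, 1, by simp, by simp [this]⟩
  | mul x y hx hy ihx ihy =>
    intro q hq
    rcases hq.mul with hq | ⟨q', hq', rfl⟩
    · exact ihx q hq
    · obtain ⟨γ₁, h1, κ, hκ, rfl⟩ := ihy q' hq'
      exact ⟨x * γ₁, mul_mem hx h1, κ, hκ, by rw [mul_assoc]⟩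
  | inv x hx ih =>
    intro q hq
    obtain ⟨γ₁, h1, κ, hκ, he⟩ := ih _ hq.inv
    refine ⟨x⁻¹ * γ₁, mul_mem (inv_mem hx) h1, κ, hκ, ?_⟩
    rw [mul_assoc, ← he]; group

lemma gp_bound [Finite α] {Γ : Subgroup (FreeGroup α)} (hΓ : Γ.FG) {g : FreeGroup α}
    (hg : ∀ n : ℤ, n ≠ 0 → g ^ n ∉ Γ) :
    ∃ D : ℕ, ∀ γ ∈ Γ, ∀ n : ℤ, gp γ (g ^ n) ≤ D := by
  obtain ⟨K, hK, hKp⟩ := fg_pre hΓ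
  have hA := hK.prod (ball_finite (α := α) g.norm)
  set A := K ×ˢ {w : FreeGroup α | w.norm ≤ g.norm} with hAdef
  refine ⟨A.ncard, ?_⟩
  intro γ hγ n
  by_contra hcon
  push Not at hcon
  have key : ∀ l : ℕ, l ≤ A.ncard → ∃ x : FreeGroup α × FreeGroup α, x ∈ A ∧
      ∃ u, u.norm = l ∧ (∃ γ₁ ∈ Γ, u = γ₁ * x.1) ∧ ∃ i : ℤ, u = g ^ i * x.2 := by
    intro l hl
    obtain ⟨u, hu1, hu2, hu3⟩ := exists_pre_of_le_gp (hl.trans hcon.le)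
    obtain ⟨γ₁, h1, κ, hκ, he⟩ := hKp γ hγ u hu1
    obtain ⟨i, w, hw, he'⟩ := hu2.zpow
    exact ⟨(κ, w), ⟨hκ, hw⟩, u, hu3, ⟨γ₁, h1, he⟩, i, he'⟩
  choose! f hfA u hun hu1 hu2 using key
  obtain ⟨l, l', -, hl, -, hl', hne, he⟩ := pigeon hA f 0 (fun l _ hl => hfA l (by omega))
  rw [zero_add] at hl hl'
  obtain ⟨γ₁, h1, e1⟩ := hu1 l hl
  obtain ⟨γ₂, h2, e2⟩ := hu1 l' hl'
  obtain ⟨i, e3⟩ := hu2 l hl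
  obtain ⟨j, e4⟩ := hu2 l' hl'
  rw [he] at e1 e3
  have hij : i - j ≠ 0 := by
    intro h
    have : i = j := by omega
    subst this
    apply hne
    rw [← hun l hl, ← hun l' hl', e3, e4]
  apply hg _ hij
  have : g ^ (i - j) = γ₁ * γ₂⁻¹ := by
    have h5 : u l * (u l')⁻¹ = g ^ (i - j) := by rw [e3, e4]; group
    have h6 : u l * (u l')⁻¹ = γ₁ * γ₂⁻¹ := by rw [e1, e2]; group
    rw [← h5, h6]
  rw [this]
  exact mul_mem h1 (inv_mem h2)

lemma gp_mul_self (a b : FreeGroup α) : gp (a * b) a + gp a⁻¹ b = a.norm := by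
  have h1 := gp_spec (a * b) a
  have h2 := gp_spec a⁻¹ b
  have h3 : ((a * b)⁻¹ * a).norm = b.norm := by
    rw [← norm_inv_eq]; congr 1; group
  rw [inv_inv, norm_inv_eq] at h2
  omega

lemma no_conj {Γ : Subgroup (FreeGroup α)} {g : FreeGroup α} (hg1 : g ≠ 1) {D : ℕ}
    (hD : ∀ γ ∈ Γ, ∀ n : ℤ, gp γ (g ^ n) ≤ D) {γ : FreeGroup α} (hγ : γ ∈ Γ) (hγ1 : γ ≠ 1)
    {a b : ℤ} (ha : a ≠ 0) (h : γ * g ^ b * γ⁻¹ = g ^ a) : False := by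
  have hk : ∀ k : ℤ, γ * g ^ (b * k) * γ⁻¹ = g ^ (a * k) := by
    intro k
    rw [zpow_mul, zpow_mul, ← h, ← conj_zpow]
  have hm : ∀ (m : ℕ) (k : ℤ), γ ^ m * g ^ (b ^ m * k) * (γ ^ m)⁻¹ = g ^ (a ^ m * k) := by
    intro m
    induction m with
    | zero => intro k; simp
    | succ m ih =>
      intro k
      have e1 : γ ^ (m + 1) * g ^ (b ^ (m + 1) * k) * (γ ^ (m + 1))⁻¹
          = γ * (γ ^ m * g ^ (b ^ m * (b * k)) * (γ ^ m)⁻¹) * γ⁻¹ := by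
        rw [pow_succ b, mul_assoc (b ^ m), pow_succ' γ]; group
      rw [e1, ih, show a ^ m * (b * k) = b * (a ^ m * k) by ring, hk]
      congr 1; ring
  set m := 2 * D + 1 with hmdef
  set N : ℤ := a ^ m * (2 * D + 1 : ℕ) with hN
  have h1 := hm m (2 * D + 1 : ℕ)
  rw [← hN] at h1
  set c : ℤ := b ^ m * (2 * D + 1 : ℕ) with hc
  have hx : γ ^ m * g ^ c = g ^ N * γ ^ m := by rw [← h1]; group
  have g1 := gp_mul_self (γ ^ m) (g ^ c)
  have g2 := gp_mul_self (g ^ N) (γ ^ m)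
  have g3 := hD _ (inv_mem (pow_mem hγ m)) c
  have g4 := hD _ (pow_mem hγ m) (-N)
  rw [gp_comm, zpow_neg] at g4
  have g5 := gp_hyp (γ ^ m) (γ ^ m * g ^ c) (g ^ N)
  rw [gp_comm (γ ^ m) (γ ^ m * g ^ c)] at g5
  have g6 := hD _ (pow_mem hγ m) N
  rw [← hx] at g2
  have n1 := le_norm_pow hγ1 m
  have n2 := le_norm_zpow hg1 N
  have n3 : 2 * D + 1 ≤ N.natAbs := by
    rw [hN, Int.natAbs_mul, Int.natAbs_natCast]
    exact Nat.le_mul_of_pos_left _ (Int.natAbs_pos.2 (pow_ne_zero _ ha))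
  omega

lemma gp_bound' [Finite α] {Γ : Subgroup (FreeGroup α)} (hΓ : Γ.FG) {g : FreeGroup α}
    (hg : ∀ n : ℤ, n ≠ 0 → g ^ n ∉ Γ) :
    ∃ D : ℕ, (∀ γ ∈ Γ, ∀ n : ℤ, gp γ (g ^ n) ≤ D) ∧
      ∀ γ ∈ Γ, γ ≠ 1 → ∀ n n' : ℤ, gp (g ^ n) (γ * g ^ n') ≤ D := by
  obtain ⟨D, hD⟩ := gp_bound hΓ hg
  have hg1 : g ≠ 1 := by rintro rfl; exact hg 1 (by simp) (by simp)
  have hA := (ball_finite (α := α) g.norm).prod (ball_finite (α := α) g.norm)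
  set A := {w : FreeGroup α | w.norm ≤ g.norm} ×ˢ {w : FreeGroup α | w.norm ≤ g.norm} with hAdef
  refine ⟨D + 1 + A.ncard, fun γ hγ n => (hD γ hγ n).trans (by omega), ?_⟩
  intro γ hγ hγ1 n n'
  by_contra hcon
  push Not at hcon
  have key : ∀ l : ℕ, D + 1 ≤ l → l ≤ D + 1 + A.ncard → ∃ x : FreeGroup α × FreeGroup α, x ∈ A ∧
      ∃ u, u.norm = l ∧ (∃ i : ℤ, u = γ * (g ^ i * x.1)) ∧ ∃ i : ℤ, u = g ^ i * x.2 := by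
    intro l hl0 hl
    obtain ⟨u, hu1, hu2, hu3⟩ := exists_pre_of_le_gp (hl.trans hcon.le)
    obtain ⟨i, w, hw, he'⟩ := hu1.zpow
    rcases hu2.mul with hu2 | ⟨q, hq, rfl⟩
    · have := hu2.le_gp hu1
      have := hD γ hγ n
      omega
    · obtain ⟨i', w', hw', he''⟩ := hq.zpow
      exact ⟨(w', w), ⟨hw', hw⟩, γ * q, hu3, ⟨i', by rw [he'']⟩, i, he'⟩
  choose! f hfA u hun hu1 hu2 using key
  obtain ⟨l, l', hl0, hl, hl0', hl', hne, he⟩ := pigeon hA f (D + 1) hfA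
  obtain ⟨i', e1⟩ := hu1 l hl0 hl
  obtain ⟨j', e2⟩ := hu1 l' hl0' hl'
  obtain ⟨i, e3⟩ := hu2 l hl0 hl
  obtain ⟨j, e4⟩ := hu2 l' hl0' hl'
  rw [he] at e1 e3
  have hij : i - j ≠ 0 := by
    intro h
    have : i = j := by omega
    subst this
    apply hne
    rw [← hun l hl0 hl, ← hun l' hl0' hl', e3, e4]
  apply no_conj hg1 hD hγ hγ1 hij (b := i' - j')
  have h5 : u l * (u l')⁻¹ = g ^ (i - j) := by rw [e3, e4]; group
  have h6 : u l * (u l')⁻¹ = γ * g ^ (i' - j') * γ⁻¹ := by rw [e1, e2]; group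
  rw [← h5, h6]

lemma good_letter (w : FreeGroup α) (y₀ : α × Bool) : ∃ bad : α × Bool, ∀ y ≠ bad,
    (w * FreeGroup.mk [y]).toWord = w.toWord ++ [y] := by
  have hw := isReduced_toWord (x := w)
  have key : ∀ y, IsReduced (w.toWord ++ [y]) →
      (w * FreeGroup.mk [y]).toWord = w.toWord ++ [y] := by
    intro y hy
    rw [toWord_mul, toWord_mk_red IsReduced.singleton, hy.reduce_eq]
  rcases List.eq_nil_or_concat' w.toWord with h | ⟨L, x, h⟩
  · refine ⟨y₀, fun y _ => key y ?_⟩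
    rw [h]; exact IsReduced.singleton
  · refine ⟨(x.1, !x.2), fun y hy => key y ?_⟩
    rw [h] at hw ⊢
    refine IsReduced.append_overlap hw ?_ (by simp)
    simp only [List.cons_append, List.nil_append, isReduced_cons_cons, IsReduced.singleton, and_true]
    intro h1
    rcases x with ⟨x1, x2⟩
    rcases y with ⟨y1, y2⟩
    simp only at h1 ⊢
    subst h1
    simp only [ne_eq, Prod.mk.injEq, true_and] at hy
    cases x2 <;> cases y2 <;> simp_all

lemma norm_of_toWord {w : FreeGroup α} {y : α × Bool}
    (h : (w * FreeGroup.mk [y]).toWord = w.toWord ++ [y]) :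
    (w * FreeGroup.mk [y]).norm = w.norm + 1 := by
  rw [FreeGroup.norm, h, FreeGroup.norm]; simp

lemma exists_ext [Nonempty α] (u : FreeGroup α) (r : ℕ) :
    ∃ v : FreeGroup α, v.norm = r ∧ (u * v).norm = u.norm + r := by
  induction r with
  | zero => exact ⟨1, by simp, by simp⟩
  | succ r ih =>
    obtain ⟨v, h1, h2⟩ := ih
    obtain ⟨a⟩ := ‹Nonempty α›
    obtain ⟨bad, hb⟩ := good_letter (u * v) (a, true)
    have : ∃ y, y ≠ bad := by
      rcases eq_or_ne bad (a, true) with rfl | h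
      · exact ⟨(a, false), by simp⟩
      · exact ⟨_, h.symm⟩
    obtain ⟨y, hy⟩ := this
    have h3 := norm_of_toWord (hb y hy)
    have h4 : (FreeGroup.mk [y]).norm = 1 := norm_mk_red IsReduced.singleton
    refine ⟨v * FreeGroup.mk [y], ?_, by rw [← mul_assoc, h3]; omega⟩
    have h5 := norm_mul_le v (FreeGroup.mk [y])
    have h6 := norm_mul_le u (v * FreeGroup.mk [y])
    rw [← mul_assoc] at h6
    omega

lemma finiteIndex_of_cover {G : Type*} [Group G] {Γ : Subgroup G} {K : Set G} (hK : K.Finite)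
    (h : ∀ u, ∃ γ ∈ Γ, ∃ κ ∈ K, u = γ * κ) : Γ.FiniteIndex := by
  have : Finite (G ⧸ Γ) := by
    have := hK.to_subtype
    refine Finite.of_surjective (fun κ : K => ((κ.1⁻¹ : G) : G ⧸ Γ)) ?_
    intro x
    induction x using QuotientGroup.induction_on with
    | H x =>
      obtain ⟨γ, hγ, κ, hκ, he⟩ := h x⁻¹
      refine ⟨⟨κ, hκ⟩, ?_⟩
      rw [QuotientGroup.eq]
      simp only [inv_inv]
      have : κ = γ⁻¹ * x⁻¹ := by rw [he]; group
      rw [this]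
      simpa using hγ
  exact Subgroup.finiteIndex_of_finite_quotient

lemma nonconf [Finite α] [Nonempty α] {Γ : Subgroup (FreeGroup α)} (hΓ : Γ.FG)
    (hi : ¬ Γ.FiniteIndex) (r : ℕ) :
    ∃ z : FreeGroup α, ∀ b : FreeGroup α, b.norm ≤ r → z * b * z⁻¹ ∈ Γ → b = 1 := by
  classical
  obtain ⟨K, hK, hKp⟩ := fg_pre hΓ
  have hex : ∃ u₀, ∀ γ ∈ Γ, ∀ κ ∈ K, u₀ ≠ γ * κ := by
    by_contra hc
    push Not at hc
    exact hi (finiteIndex_of_cover hK hc)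
  obtain ⟨u₀, hu₀⟩ := hex
  have hne : ∃ n, ∃ γ ∈ Γ, (γ * u₀).norm = n := ⟨_, 1, one_mem _, rfl⟩
  obtain ⟨γ₀, hγ₀, hn⟩ := Nat.find_spec hne
  set u := γ₀ * u₀ with hu
  have hmin : ∀ γ ∈ Γ, u.norm ≤ (γ * u).norm := by
    intro γ hγ
    rw [hn]
    exact Nat.find_min' hne ⟨γ * γ₀, mul_mem hγ hγ₀, by rw [hu, mul_assoc]⟩
  have hnp : ∀ γ ∈ Γ, ¬ Pre u γ := by
    intro γ hγ hp
    obtain ⟨γ₁, h1, κ, hκ, he⟩ := hKp γ hγ u hp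
    refine hu₀ (γ₀⁻¹ * γ₁) (mul_mem (inv_mem hγ₀) h1) κ hκ ?_
    rw [mul_assoc, ← he, hu]; group
  have claim : ∀ γ ∈ Γ, ∀ v : FreeGroup α, (u * v).norm = u.norm + v.norm →
      (γ * (u * v)).norm = (γ * u).norm + v.norm := by
    intro γ hγ v hv
    have hp := pre_mul_of_norm hv
    have h1 := gp_spec γ⁻¹ (u * v)
    have h2 := gp_spec γ⁻¹ u
    rw [inv_inv] at h1 h2
    have h3 : gp γ⁻¹ (u * v) < u.norm := by
      by_contra hc
      push Not at hc
      obtain ⟨m, m1, m2, m3⟩ := exists_pre_of_le_gp hc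
      have : m = u := m2.eq_of_norm hp m3
      subst this
      exact hnp _ (inv_mem hγ) m1
    have h4 : u.norm ≤ gp u (u * v) := pre_self.le_gp hp
    have h5 := gp_hyp γ⁻¹ u (u * v)
    have h6 := gp_hyp γ⁻¹ (u * v) u
    rw [gp_comm (u * v) u] at h6
    have h7 := norm_mul_le γ⁻¹ (γ * u)
    rw [inv_mul_cancel_left, norm_inv_eq] at h7
    have h8 := norm_inv_eq (x := γ)
    omega
  obtain ⟨v, hv1, hv2⟩ := exists_ext u r
  rw [← hv1] at hv2
  refine ⟨u * v, fun b hb hγ => ?_⟩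
  set γ := u * v * b * (u * v)⁻¹ with hγdef
  have e1 : γ * (u * v) = u * (v * b) := by rw [hγdef]; group
  have e2 : γ⁻¹ * (u * (v * b)) = u * v := by rw [← e1]; group
  have hp := pre_mul_of_norm hv2
  have hp' : Pre u (u * (v * b)) := by
    have h1 := gp_spec (u * v) (u * (v * b))
    have h2 : (u * v)⁻¹ * (u * (v * b)) = b := by group
    rw [h2] at h1
    have h3 := norm_mul_le (u * (v * b)) b⁻¹
    rw [show u * (v * b) * b⁻¹ = u * v by group, norm_inv_eq] at h3
    obtain ⟨m, m1, m2, m3⟩ := exists_pre_of_le_gp (a := u * v) (b := u * (v * b)) (k := u.norm)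
      (by omega)
    have : m = u := m1.eq_of_norm hp m3
    rwa [this] at m2
  have hn' : (u * (v * b)).norm = u.norm + (v * b).norm := by
    have := hp'.norm_eq
    rwa [inv_mul_cancel_left] at this
  have c1 := claim γ hγ v hv2
  have c2 := claim γ⁻¹ (inv_mem hγ) _ hn'
  rw [e1] at c1
  rw [e2] at c2
  have m1 := hmin γ hγ
  have m2 := hmin γ⁻¹ (inv_mem hγ)
  have hpp : Pre (γ * u) (u * (v * b)) := by
    have e3 : γ * u * v = u * (v * b) := by rw [mul_assoc, e1]
    rw [← e3]
    apply pre_mul_of_norm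
    rw [e3]; exact c1
  have : γ * u = u := hpp.eq_of_norm hp' (by omega)
  have hγ1 : γ = 1 := by simpa using this
  rw [hγdef] at hγ1
  have := mul_inv_eq_one.1 hγ1
  simpa using this

end quasi
end BD


namespace BD
open FreeGroup

section amalg
set_option linter.unusedSectionVars false
variable {α : Type*} [DecidableEq α]

inductive Lead (Γ : Subgroup (FreeGroup α)) (t : FreeGroup α) : ℤ → FreeGroup α → Prop
  | base (k : ℤ) (hk : k ≠ 0) (γ : FreeGroup α) (hγ : γ ∈ Γ) : Lead Γ t k (t ^ k * γ)
  | step (k : ℤ) (hk : k ≠ 0) (γ : FreeGroup α) (hγ : γ ∈ Γ) (h1 : γ ≠ 1) (k' : ℤ)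
      (x : FreeGroup α) (hx : Lead Γ t k' x) : Lead Γ t k (t ^ k * (γ * x))

def BB (Γ : Subgroup (FreeGroup α)) (t : FreeGroup α) (N : ℕ) : ℕ → Set (FreeGroup α)
  | 0 => Γ
  | m + 1 => {y | ∃ γ ∈ Γ, ∃ k : ℤ, k ≠ 0 ∧ ∃ x ∈ BB Γ t N m,
      y = γ * (t ^ k * x) ∧ γ.norm + N * k.natAbs + x.norm ≤ y.norm}

structure Sep (Γ : Subgroup (FreeGroup α)) (t : FreeGroup α) (N D : ℕ) : Prop where
  h1 : ∀ γ ∈ Γ, ∀ k : ℤ, gp γ (t ^ k) ≤ D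
  h2 : ∀ γ ∈ Γ, γ ≠ 1 → ∀ k k' : ℤ, gp (t ^ k) (γ * t ^ k') ≤ D
  h3 : ∀ k : ℤ, k ≠ 0 → 4 * D + N * k.natAbs ≤ (t ^ k).norm
  h4 : 1 ≤ N

variable {Γ : Subgroup (FreeGroup α)} {t : FreeGroup α} {N D : ℕ}

lemma norm_mul_gp (a b : FreeGroup α) : 2 * gp a⁻¹ b + (a * b).norm = a.norm + b.norm := by
  have := gp_spec a⁻¹ b
  rwa [inv_inv, norm_inv_eq] at this

lemma Lead.ne {k : ℤ} {x : FreeGroup α} (h : Lead Γ t k x) : k ≠ 0 := by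
  cases h <;> assumption

lemma Sep.big (S : Sep Γ t N D) {k : ℤ} (hk : k ≠ 0) : 4 * D + 1 ≤ (t ^ k).norm := by
  have h := S.h3 k hk
  have : 1 * 1 ≤ N * k.natAbs := Nat.mul_le_mul S.h4 (by omega)
  omega

lemma Sep.gpx (S : Sep Γ t N D) {k : ℤ} (hk : k ≠ 0) {x : FreeGroup α}
    (h : (t ^ k).norm ≤ gp x (t ^ k) + D) {γ : FreeGroup α} (hγ : γ ∈ Γ) : gp γ x ≤ D := by
  have h1 := gp_hyp γ x (t ^ k)
  have h2 := S.h1 γ hγ k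
  have h3 := S.big hk
  rcases min_le_iff.1 (h1.trans h2) with h | h <;> omega

lemma Sep.lead (S : Sep Γ t N D) {k : ℤ} {x : FreeGroup α} (h : Lead Γ t k x) :
    (t ^ k).norm ≤ gp x (t ^ k) + D := by
  induction h with
  | base k hk γ hγ =>
    have h1 := gp_mul_self (t ^ k) γ
    have h2 := S.h1 γ hγ (-k)
    rw [gp_comm, zpow_neg] at h2
    omega
  | step k hk γ hγ hγ1 k' x hx ih =>
    have h1 := gp_mul_self (t ^ k) (γ * x)
    suffices gp (t ^ k)⁻¹ (γ * x) ≤ D by omega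
    have e1 := gp_hyp (t ^ k)⁻¹ (γ * x) (γ * t ^ k')
    have e2 := S.h2 γ hγ hγ1 (-k) k'
    rw [zpow_neg] at e2
    rcases min_le_iff.1 (e1.trans e2) with h | h
    · exact h
    exfalso
    have e3 := gp_spec (γ * x) (γ * t ^ k')
    have e4 : (γ * x)⁻¹ * (γ * t ^ k') = x⁻¹ * t ^ k' := by group
    rw [e4] at e3
    have e5 := gp_spec x (t ^ k')
    have e6 := norm_mul_gp γ x
    have e7 := norm_mul_gp γ (t ^ k')
    have e8 := S.gpx hx.ne ih (inv_mem hγ)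
    have e9 := S.h1 γ⁻¹ (inv_mem hγ) k'
    have e10 := S.big hx.ne
    omega

lemma Sep.memBB (S : Sep Γ t N D) {k : ℤ} {x : FreeGroup α} (h : Lead Γ t k x) :
    ∀ γ ∈ Γ, γ * x ∈ ⋃ m, BB Γ t N m := by
  induction h with
  | base k hk γ hγ =>
    intro γ' hγ'
    refine Set.mem_iUnion.2 ⟨1, γ', hγ', k, hk, γ, hγ, rfl, ?_⟩
    have e1 := norm_mul_gp γ' (t ^ k * γ)
    have e2 := norm_mul_gp (t ^ k) γ
    have e3 := S.gpx hk (S.lead (Lead.base k hk γ hγ)) (inv_mem hγ')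
    have e4 := S.h1 γ hγ (-k)
    rw [gp_comm, zpow_neg] at e4
    have := S.h3 k hk
    omega
  | step k hk γ hγ hγ1 k' x hx ih =>
    intro γ' hγ'
    obtain ⟨m, hm⟩ := Set.mem_iUnion.1 (ih γ hγ)
    refine Set.mem_iUnion.2 ⟨m + 1, γ', hγ', k, hk, _, hm, rfl, ?_⟩
    have e1 := norm_mul_gp γ' (t ^ k * (γ * x))
    have e2 := norm_mul_gp (t ^ k) (γ * x)
    have e0 := S.lead (Lead.step k hk γ hγ hγ1 k' x hx)
    have e3 := S.gpx hk e0 (inv_mem hγ')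
    have e4 := gp_mul_self (t ^ k) (γ * x)
    have := S.h3 k hk
    omega

def WW (Γ : Subgroup (FreeGroup α)) (t : FreeGroup α) : Set (FreeGroup α) :=
  {y | y ∈ Γ ∨ ∃ γ ∈ Γ, ∃ k x, Lead Γ t k x ∧ y = γ * x}

lemma WW.mulΓ {y γ : FreeGroup α} (hγ : γ ∈ Γ) (hy : y ∈ WW Γ t) : γ * y ∈ WW Γ t := by
  rcases hy with h | ⟨γ', hγ', k, x, hx, rfl⟩
  · exact Or.inl (mul_mem hγ h)
  · exact Or.inr ⟨γ * γ', mul_mem hγ hγ', k, x, hx, by rw [mul_assoc]⟩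

lemma WW.mult {y : FreeGroup α} (j : ℤ) (hy : y ∈ WW Γ t) : t ^ j * y ∈ WW Γ t := by
  by_cases hj : j = 0
  · simpa [hj] using hy
  rcases hy with h | ⟨γ', hγ', k, x, hx, rfl⟩
  · exact Or.inr ⟨1, one_mem _, j, _, Lead.base j hj y h, by simp⟩
  by_cases h1 : γ' = 1
  · subst h1
    rw [one_mul]
    cases hx with
    | base k hk γ hγ =>
      rw [← mul_assoc, ← zpow_add]
      by_cases hjk : j + k = 0
      · rw [hjk]; left; simpa using hγ
      · exact Or.inr ⟨1, one_mem _, j + k, _, Lead.base _ hjk γ hγ, by simp⟩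
    | step k hk γ hγ hγ1 k' x hx =>
      rw [← mul_assoc, ← zpow_add]
      by_cases hjk : j + k = 0
      · rw [hjk]; exact Or.inr ⟨γ, hγ, k', x, hx, by simp⟩
      · exact Or.inr ⟨1, one_mem _, j + k, _, Lead.step _ hjk γ hγ hγ1 k' x hx, by simp⟩
  · exact Or.inr ⟨1, one_mem _, j, _, Lead.step j hj γ' hγ' h1 k x hx, by simp⟩

lemma Sep.closure_sub (S : Sep Γ t N D) {y : FreeGroup α}
    (hy : y ∈ Subgroup.closure (insert t (Γ : Set (FreeGroup α)))) : y ∈ ⋃ m, BB Γ t N m := by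
  have hW : y ∈ WW Γ t := by
    induction hy using Subgroup.closure_induction_left with
    | one => exact Or.inl (one_mem _)
    | mul_left x hx y hy ih =>
      rcases hx with rfl | hx
      · simpa using WW.mult 1 ih
      · exact WW.mulΓ hx ih
    | inv_mul_cancel x hx y hy ih =>
      rcases hx with rfl | hx
      · simpa using WW.mult (-1) ih
      · exact WW.mulΓ (inv_mem hx) ih
  rcases hW with h | ⟨γ, hγ, k, x, hx, rfl⟩
  · exact Set.mem_iUnion.2 ⟨0, h⟩
  · exact S.memBB hx γ hγ

lemma BB.small {m : ℕ} {y : FreeGroup α} (hy : y ∈ BB Γ t N m) (hn : y.norm < N) : y ∈ Γ := by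
  rcases m with _ | m
  · exact hy
  obtain ⟨γ, hγ, k, hk, x, hx, rfl, h⟩ := hy
  have : N * 1 ≤ N * k.natAbs := Nat.mul_le_mul le_rfl (by omega)
  omega

end amalg

open ENNReal

section sums
set_option linter.unusedSectionVars false
variable {α : Type*} [DecidableEq α]

noncomputable def ex (s : ℝ) (n : ℕ) : ℝ≥0∞ := ENNReal.ofReal (Real.exp (-s * n))

lemma ex_add (s : ℝ) (m n : ℕ) : ex s (m + n) = ex s m * ex s n := by
  rw [ex, ex, ex, ← ENNReal.ofReal_mul (Real.exp_pos _).le, ← Real.exp_add]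
  congr 2; push_cast; ring

lemma ex_mono {s : ℝ} (hs : 0 ≤ s) {m n : ℕ} (h : m ≤ n) : ex s n ≤ ex s m := by
  apply ENNReal.ofReal_le_ofReal
  apply Real.exp_le_exp.2
  have : (m : ℝ) ≤ n := by exact_mod_cast h
  nlinarith

lemma ex_zero (s : ℝ) : ex s 0 = 1 := by simp [ex]

lemma ex_pow (s : ℝ) (n : ℕ) : ex s n = ex s 1 ^ n := by
  induction n with
  | zero => simp [ex_zero]
  | succ n ih => rw [ex_add, ih, pow_succ]

lemma ex_mul (s : ℝ) (m n : ℕ) : ex s (m * n) = ex s m ^ n := by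
  rw [ex_pow, ex_pow s m, pow_mul]

lemma ex_ne_top (s : ℝ) (n : ℕ) : ex s n ≠ ∞ := by simp [ex]

lemma ex_ne_zero (s : ℝ) (n : ℕ) : ex s n ≠ 0 := by simp [ex, Real.exp_pos]

lemma ex_lt_one {s : ℝ} (hs : 0 < s) : ex s 1 < 1 := by
  rw [ex, ENNReal.ofReal_lt_one]
  simpa using hs

noncomputable def PS (s : ℝ) (A : Set (FreeGroup α)) : ℝ≥0∞ := ∑' g : A, ex s g.1.norm

lemma PS_mono (s : ℝ) {A B : Set (FreeGroup α)} (h : A ⊆ B) : PS s A ≤ PS s B :=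
  ENNReal.tsum_mono_subtype (fun g => ex s (FreeGroup.norm g)) h

lemma PS_BB {s : ℝ} (hs : 0 ≤ s) (Γ : Subgroup (FreeGroup α)) (t : FreeGroup α) (N m : ℕ) :
    PS s (BB Γ t N (m + 1)) ≤
      PS s (Γ : Set (FreeGroup α)) * (2 * (ex s N * (1 - ex s N)⁻¹)) * PS s (BB Γ t N m) := by
  let f : (Γ × (Bool × ℕ)) × BB Γ t N m → FreeGroup α := fun p =>
    p.1.1.1 * (t ^ (if p.1.2.1 then ((p.1.2.2 : ℤ) + 1) else -((p.1.2.2 : ℤ) + 1)) * p.2.1)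
  have hex : ∀ y : BB Γ t N (m + 1), ∃ p, f p = y ∧
      p.1.1.1.norm + N * (p.1.2.2 + 1) + p.2.1.norm ≤ y.1.norm := by
    rintro ⟨y, γ, hγ, k, hk, x, hx, hy, hn⟩
    refine ⟨((⟨γ, hγ⟩, (decide (0 < k), k.natAbs - 1)), ⟨x, hx⟩), ?_, ?_⟩
    · simp only [f, hy]
      congr 3
      split_ifs with h <;> simp at h <;> omega
    · simp only
      have : k.natAbs - 1 + 1 = k.natAbs := by omega
      rw [this]; exact hn
  choose F hF1 hF2 using hex
  have hinj : Function.Injective F := by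
    intro a b hab
    apply Subtype.ext
    rw [← hF1 a, ← hF1 b, hab]
  calc PS s (BB Γ t N (m + 1)) = ∑' y : BB Γ t N (m + 1), ex s y.1.norm := rfl
    _ ≤ ∑' y : BB Γ t N (m + 1), (fun p : (Γ × (Bool × ℕ)) × BB Γ t N m =>
        ex s p.1.1.1.norm * ex s (N * (p.1.2.2 + 1)) * ex s p.2.1.norm) (F y) := by
      refine ENNReal.tsum_le_tsum fun y => ?_
      simp only
      rw [← ex_add, ← ex_add]
      exact ex_mono hs (hF2 y)
    _ ≤ ∑' p : (Γ × (Bool × ℕ)) × BB Γ t N m,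
        ex s p.1.1.1.norm * ex s (N * (p.1.2.2 + 1)) * ex s p.2.1.norm :=
      ENNReal.tsum_comp_le_tsum_of_injective hinj _
    _ = _ := by
      rw [ENNReal.tsum_prod']
      simp only [ENNReal.tsum_mul_left, ENNReal.tsum_mul_right]
      congr 1
      rw [ENNReal.tsum_prod']
      simp only [ENNReal.tsum_mul_left, ENNReal.tsum_mul_right]
      congr 1
      rw [ENNReal.tsum_prod']
      simp only [tsum_fintype, Finset.sum_const]
      simp only [ex_mul, pow_succ, ENNReal.tsum_mul_right, ENNReal.tsum_geometric]
      simp [mul_comm]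

lemma step_ex (s : ℝ) (hs : 0 < s) (P η : ℝ≥0∞) (hP : P ≠ ∞) (hη : η ≠ 0) (M : ℕ) :
    ∃ N, M < N ∧ P * (1 - P * (2 * (ex s N * (1 - ex s N)⁻¹)))⁻¹ ≤ P + η := by
  have h0 : Filter.Tendsto (fun N => ex s N) Filter.atTop (nhds 0) := by
    have := ENNReal.tendsto_pow_atTop_nhds_zero_of_lt_one (ex_lt_one hs)
    simpa only [← ex_pow] using this
  have h1 : Filter.Tendsto (fun N => (1 - ex s N)⁻¹) Filter.atTop (nhds 1) := by
    have := (ENNReal.Tendsto.sub (tendsto_const_nhds (x := (1 : ℝ≥0∞))) h0 (by simp)).inv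
    simpa using this
  have h2 : Filter.Tendsto (fun N => P * (2 * (ex s N * (1 - ex s N)⁻¹))) Filter.atTop (nhds 0) := by
    have := ENNReal.Tendsto.const_mul (a := P) (ENNReal.Tendsto.const_mul (a := 2)
      (ENNReal.Tendsto.mul h0 (by simp) h1 (by simp)) (by simp)) (by simp [hP])
    simpa using this
  have h3 : Filter.Tendsto (fun N => P * (1 - P * (2 * (ex s N * (1 - ex s N)⁻¹)))⁻¹)
      Filter.atTop (nhds P) := by
    have := ENNReal.Tendsto.const_mul (a := P)
      (ENNReal.Tendsto.sub (tendsto_const_nhds (x := (1 : ℝ≥0∞))) h2 (by simp)).inv (by simp)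
    simpa using this
  have h4 : P < P + η := ENNReal.lt_add_right hP hη
  obtain ⟨N, hN1, hN2⟩ := ((h3.eventually (gt_mem_nhds h4)).and (Filter.eventually_gt_atTop M)).exists
  exact ⟨N, hN2, hN1.le⟩
lemma step [Finite α] {s : ℝ} (hs : 0 < s) {Γ : Subgroup (FreeGroup α)} (hΓ : Γ.FG)
    (hP : PS s (Γ : Set (FreeGroup α)) ≠ ∞) (g : FreeGroup α) (M : ℕ) {η : ℝ≥0∞} (hη : η ≠ 0) :
    ∃ Γ' : Subgroup (FreeGroup α), Γ ≤ Γ' ∧ Γ'.FG ∧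
      PS s (Γ' : Set (FreeGroup α)) ≤ PS s (Γ : Set (FreeGroup α)) + η ∧
      (∃ n : ℕ, 1 ≤ n ∧ g ^ n ∈ Γ') ∧ ∀ y ∈ Γ', y.norm ≤ M → y ∈ Γ := by
  by_cases hg : ∃ n : ℕ, 1 ≤ n ∧ g ^ n ∈ Γ
  · exact ⟨Γ, le_rfl, hΓ, le_self_add, hg, fun y hy _ => hy⟩
  push Not at hg
  have hg' : ∀ n : ℤ, n ≠ 0 → g ^ n ∉ Γ := by
    intro n hn h
    apply hg n.natAbs (by omega)
    rcases Int.natAbs_eq n with h1 | h1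
    · rw [h1, zpow_natCast] at h; exact h
    · rw [h1, zpow_neg, zpow_natCast] at h; simpa using h
  have hg1 : g ≠ 1 := by rintro rfl; exact hg 1 le_rfl (by simp)
  obtain ⟨D, hD1, hD2⟩ := gp_bound' hΓ hg'
  obtain ⟨N, hN, hle⟩ := step_ex s hs _ η hP hη M
  have S : Sep Γ (g ^ (4 * D + N)) N D := by
    have e : ∀ k : ℤ, (g ^ (4 * D + N)) ^ k = g ^ ((4 * D + N : ℕ) * k : ℤ) := by
      intro k; rw [zpow_mul, zpow_natCast]
    refine ⟨fun γ hγ k => ?_, fun γ hγ h1 k k' => ?_, fun k hk => ?_, by omega⟩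
    · rw [e]; exact hD1 γ hγ _
    · rw [e, e]; exact hD2 γ hγ h1 _ _
    · rw [e]
      refine le_trans ?_ (le_norm_zpow hg1 _)
      rw [Int.natAbs_mul, Int.natAbs_natCast, add_mul]
      have : 4 * D * 1 ≤ 4 * D * k.natAbs := Nat.mul_le_mul le_rfl (by omega)
      omega
  refine ⟨Subgroup.closure (insert (g ^ (4 * D + N)) (Γ : Set (FreeGroup α))), ?_, ?_, ?_, ?_, ?_⟩
  · intro y hy
    exact Subgroup.subset_closure (Set.mem_insert_of_mem _ hy)
  · obtain ⟨T, rfl⟩ := hΓ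
    refine ⟨insert (g ^ (4 * D + N)) T, ?_⟩
    rw [Finset.coe_insert]
    rw [Set.insert_eq, Set.insert_eq, Subgroup.closure_union, Subgroup.closure_union,
      Subgroup.closure_eq]
  · set ρ := PS s (Γ : Set (FreeGroup α)) * (2 * (ex s N * (1 - ex s N)⁻¹)) with hρ
    refine le_trans ?_ hle
    calc PS s _ ≤ PS s (⋃ m, BB Γ (g ^ (4 * D + N)) N m) := PS_mono s fun y hy => S.closure_sub hy
      _ ≤ ∑' m, PS s (BB Γ (g ^ (4 * D + N)) N m) := ENNReal.tsum_iUnion_le_tsum (fun y => ex s (FreeGroup.norm y)) _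
      _ ≤ ∑' m : ℕ, PS s (Γ : Set (FreeGroup α)) * ρ ^ m := by
        refine ENNReal.tsum_le_tsum fun m => ?_
        induction m with
        | zero => simp [BB]
        | succ m ih =>
          refine (PS_BB hs.le _ _ _ _).trans ?_
          calc _ ≤ ρ * (PS s (Γ : Set (FreeGroup α)) * ρ ^ m) := mul_le_mul' le_rfl ih
            _ = _ := by ring
      _ = _ := by rw [ENNReal.tsum_mul_left, ENNReal.tsum_geometric]
  · exact ⟨4 * D + N, by omega, Subgroup.subset_closure (Set.mem_insert _ _)⟩
  · intro y hy hyM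
    obtain ⟨m, hm⟩ := Set.mem_iUnion.1 (S.closure_sub hy)
    exact BB.small hm (by omega)

end sums
end BD


namespace BD
open FreeGroup ENNReal

section sums2
set_option linter.unusedSectionVars false
variable {α : Type*} [DecidableEq α] [Fintype α]

lemma PS_univ (s : ℝ) : PS s (Set.univ : Set (FreeGroup α)) = ∑' g : FreeGroup α, ex s g.norm :=
  tsum_univ (fun g : FreeGroup α => ex s g.norm)

lemma PS_univ_top [Nonempty α] {s : ℝ} (hs : Real.exp s ≤ 2 * Fintype.card α - 1) :
    PS s (Set.univ : Set (FreeGroup α)) = ∞ := by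
  classical
  rw [PS_univ]
  obtain ⟨a⟩ := ‹Nonempty α›
  choose bad hbad using fun w : FreeGroup α => good_letter w (a, true)
  set S := ∑' g : FreeGroup α, ex s g.norm with hS
  let f : (Σ w : FreeGroup α, {y // y ≠ bad w}) → FreeGroup α := fun p => p.1 * FreeGroup.mk [p.2.1]
  have hf : ∀ p, (f p).toWord = p.1.toWord ++ [p.2.1] := fun p => hbad p.1 p.2.1 p.2.2
  have hinj : Function.Injective f := by
    rintro ⟨w, y, hy⟩ ⟨w', y', hy'⟩ h
    have h' := congrArg FreeGroup.toWord h
    rw [hf, hf] at h'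
    have h2 := List.append_inj' h' rfl
    have e1 : w = w' := toWord_injective h2.1
    have e2 : y = y' := by simpa using h2.2
    subst e1; subst e2; rfl
  have h1 : ∀ p, f p ≠ 1 := by
    intro p h
    have := hf p
    rw [h] at this; simp at this
  have hc : ∀ w, Fintype.card {y // y ≠ bad w} = 2 * Fintype.card α - 1 := by
    intro w
    rw [Fintype.card_subtype_compl]
    simp [mul_comm]
  have hn : 1 ≤ Fintype.card α := Fintype.card_pos_iff.2 ⟨a⟩
  have hle : S ≤ ∑' p, ex s (f p).norm := by
    rw [ENNReal.tsum_sigma']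
    refine ENNReal.tsum_le_tsum fun w => ?_
    have : ∀ y : {y // y ≠ bad w}, ex s (f ⟨w, y⟩).norm = ex s w.norm * ex s 1 := by
      intro y
      rw [← ex_add]; congr 1
      rw [FreeGroup.norm, hf]; simp [FreeGroup.norm]
    simp only [this]
    rw [tsum_fintype, Finset.sum_const, Finset.card_univ, hc, nsmul_eq_mul, mul_left_comm]
    have : 1 ≤ ((2 * Fintype.card α - 1 : ℕ) : ℝ≥0∞) * ex s 1 := by
      rw [ex, ← ENNReal.ofReal_natCast, ← ENNReal.ofReal_mul (by positivity), ENNReal.one_le_ofReal]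
      rw [Nat.cast_sub (by omega)]
      push_cast
      rw [mul_one, Real.exp_neg]
      calc (1:ℝ) = Real.exp s * (Real.exp s)⁻¹ := by rw [mul_inv_cancel₀ (Real.exp_pos s).ne']
        _ ≤ _ := by gcongr
    calc ex s w.norm = ex s w.norm * 1 := by rw [mul_one]
      _ ≤ _ := mul_le_mul' le_rfl this
  by_contra hne
  have h2 : S + 1 ≤ S := by
    have h3 := ENNReal.tsum_comp_le_tsum_of_injective hinj
      (fun g : FreeGroup α => if g = 1 then 0 else ex s g.norm)
    simp only [h1, if_false] at h3
    have h4 : S = 1 + ∑' g : FreeGroup α, if g = 1 then 0 else ex s g.norm := by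
      rw [hS, ENNReal.tsum_eq_add_tsum_ite (1 : FreeGroup α)]
      simp only [FreeGroup.norm_one, ex_zero]
      congr 1
      exact tsum_congr fun g => by by_cases h : g = 1 <;> simp [h]
    rw [add_comm]
    conv_rhs => rw [h4]
    gcongr
    exact hle.trans h3
  exact absurd (ENNReal.lt_add_right hne one_ne_zero) (not_lt.2 h2)

lemma PS_finiteIndex [Nonempty α] {s : ℝ} (hs0 : 0 ≤ s) (hs : Real.exp s ≤ 2 * Fintype.card α - 1)
    (Γ : Subgroup (FreeGroup α)) [Γ.FiniteIndex] : PS s (Γ : Set (FreeGroup α)) = ∞ := by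
  classical
  by_contra hne
  have hu := PS_univ_top hs
  rw [PS_univ] at hu
  have : Finite (FreeGroup α ⧸ Γ) := inferInstance
  have := Fintype.ofFinite (FreeGroup α ⧸ Γ)
  let f : (FreeGroup α ⧸ Γ) × Γ → FreeGroup α := fun p => p.1.out * p.2.1
  have hf : Function.Surjective f := by
    intro g
    refine ⟨((g : FreeGroup α ⧸ Γ), ⟨(g : FreeGroup α ⧸ Γ).out⁻¹ * g, ?_⟩), ?_⟩
    · rw [← QuotientGroup.eq]; simp
    · simp [f]
  have h1 := ENNReal.tsum_le_tsum_comp_of_surjective hf (fun g => ex s g.norm)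
  rw [hu, top_le_iff, ENNReal.tsum_prod', tsum_fintype] at h1
  refine (ENNReal.sum_ne_top.2 fun q _ => ?_) h1
  have h2 : ex s (q.out : FreeGroup α).norm * ∑' γ : Γ, ex s (f (q, γ)).norm ≤ PS s (Γ : Set (FreeGroup α)) := by
    rw [← ENNReal.tsum_mul_left]
    refine ENNReal.tsum_le_tsum fun γ => ?_
    rw [← ex_add]
    apply ex_mono hs0
    have := norm_mul_le (q.out : FreeGroup α)⁻¹ (f (q, γ))
    simp only [f, inv_mul_cancel_left, norm_inv_eq] at this
    exact this
  intro h3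
  rw [h3, ENNReal.mul_top (ex_ne_zero _ _)] at h2
  exact hne (top_le_iff.1 h2)

lemma PS_univ_lt {t : ℝ} (ht : 2 * (Fintype.card α : ℝ) < Real.exp t) :
    PS t (Set.univ : Set (FreeGroup α)) ≠ ∞ := by
  rw [PS_univ]
  have h1 : ∑' g : FreeGroup α, ex t g.norm ≤ ∑' L : List (α × Bool), ex t L.length :=
    ENNReal.tsum_comp_le_tsum_of_injective (f := FreeGroup.toWord) toWord_injective
      (fun L : List (α × Bool) => ex t L.length)
  have h2 : ∑' L : List (α × Bool), ex t L.length = ∑' n : ℕ, (2 * (Fintype.card α : ℝ≥0∞) * ex t 1) ^ n := by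
    rw [← List.equivSigmaTuple.symm.tsum_eq, ENNReal.tsum_sigma']
    congr 1; ext n
    simp only [List.equivSigmaTuple, Equiv.coe_fn_symm_mk, List.length_ofFn]
    rw [tsum_fintype, Finset.sum_const, Finset.card_univ, nsmul_eq_mul, ex_pow, mul_pow]
    simp [mul_comm]
  rw [h2, ENNReal.tsum_geometric] at h1
  refine ne_top_of_le_ne_top ?_ h1
  rw [Ne, ENNReal.inv_eq_top, tsub_eq_zero_iff_le, not_le]
  have : 2 * (Fintype.card α : ℝ≥0∞) * ex t 1 = ENNReal.ofReal (2 * (Fintype.card α : ℝ) * Real.exp (-t)) := by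
    rw [ENNReal.ofReal_mul (by positivity), ENNReal.ofReal_mul (by positivity), ex]; simp
  rw [this, ENNReal.ofReal_lt_one, Real.exp_neg, ← div_eq_mul_inv, div_lt_one (Real.exp_pos _)]
  exact ht

end sums2

section bridge
variable {d : ℕ} (Δ : Subgroup (FreeGroup (Fin d)))

lemma finite_gc (R : ℕ) : Finite {g : FreeGroup (Fin d) // g ∈ Δ ∧ FreeGroup.norm g ≤ R} :=
  Set.Finite.to_subtype ((ball_finite R).subset fun _ h => h.2)

lemma gc_pos (R : ℕ) : 1 ≤ growthCount Δ R := by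
  have := finite_gc Δ R
  have : Nonempty {g : FreeGroup (Fin d) // g ∈ Δ ∧ FreeGroup.norm g ≤ R} := ⟨1, one_mem _, by simp⟩
  exact Nat.card_pos

lemma gc_tsum (R : ℕ) : ∑' _ : {g : FreeGroup (Fin d) // g ∈ Δ ∧ FreeGroup.norm g ≤ R}, (1 : ℝ≥0∞)
    = growthCount Δ R := by
  have := finite_gc Δ R
  have := Fintype.ofFinite {g : FreeGroup (Fin d) // g ∈ Δ ∧ FreeGroup.norm g ≤ R}
  rw [tsum_fintype, growthCount, Nat.card_eq_fintype_card]; simp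

lemma gc_le {s : ℝ} (hs : 0 ≤ s) (hP : PS s (Δ : Set (FreeGroup (Fin d))) ≠ ∞) :
    ∃ K : ℝ, ∀ R : ℕ, Real.log (growthCount Δ R) ≤ K + s * R := by
  set P := PS s (Δ : Set (FreeGroup (Fin d))) with hPdef
  have h1 : ∀ R : ℕ, (growthCount Δ R : ℝ≥0∞) * ex s R ≤ P := by
    intro R
    rw [← gc_tsum, ← ENNReal.tsum_mul_right]
    calc _ ≤ ∑' g : {g : FreeGroup (Fin d) // g ∈ Δ ∧ FreeGroup.norm g ≤ R},
          (fun g : Δ => ex s g.1.norm) ⟨g.1, g.2.1⟩ := by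
          refine ENNReal.tsum_le_tsum fun g => ?_
          rw [one_mul]; exact ex_mono hs g.2.2
      _ ≤ _ := by
        apply ENNReal.tsum_comp_le_tsum_of_injective
          (f := fun g : {g : FreeGroup (Fin d) // g ∈ Δ ∧ FreeGroup.norm g ≤ R} => (⟨g.1, g.2.1⟩ : Δ))
        intro a b h
        exact Subtype.ext (by simpa using h)
  refine ⟨Real.log P.toReal, fun R => ?_⟩
  have h2 := ENNReal.toReal_mono hP (h1 R)
  rw [ENNReal.toReal_mul, ex, ENNReal.toReal_ofReal (Real.exp_pos _).le, ENNReal.toReal_natCast] at h2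
  have hc : (0 : ℝ) < growthCount Δ R := by exact_mod_cast gc_pos Δ R
  have h3 := Real.log_le_log (by positivity) h2
  rw [Real.log_mul hc.ne' (Real.exp_pos _).ne', Real.log_exp] at h3
  linarith

lemma q_nonneg (R : ℕ) : 0 ≤ Real.log (growthCount Δ R : ℝ) / (R : ℝ) := by
  have hc : (1 : ℝ) ≤ growthCount Δ R := by exact_mod_cast gc_pos Δ R
  have := Real.log_nonneg hc
  positivity

lemma q_cobdd : Filter.IsCoboundedUnder (· ≤ ·) Filter.atTop
    (fun R : ℕ => Real.log (growthCount Δ R : ℝ) / (R : ℝ)) :=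
  Filter.IsBoundedUnder.isCoboundedUnder_le ⟨0, by simpa using ⟨0, fun R _ => q_nonneg Δ R⟩⟩

lemma q_ev {s : ℝ} (hs : 0 ≤ s) (hP : PS s (Δ : Set (FreeGroup (Fin d))) ≠ ∞) {δ : ℝ} (hδ : 0 < δ) :
    ∀ᶠ R : ℕ in Filter.atTop, Real.log (growthCount Δ R : ℝ) / (R : ℝ) ≤ s + δ := by
  obtain ⟨K, hK⟩ := gc_le Δ hs hP
  have h1 : Filter.Tendsto (fun R : ℕ => K / (R : ℝ)) Filter.atTop (nhds 0) :=
    tendsto_const_div_atTop_nhds_zero_nat K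
  filter_upwards [h1.eventually (gt_mem_nhds hδ), Filter.eventually_gt_atTop 0] with R h2 h3
  have h4 : (0 : ℝ) < R := by exact_mod_cast h3
  rw [div_le_iff₀ h4]
  rw [div_lt_iff₀ h4] at h2
  have := hK R
  nlinarith

lemma critExp_le {s : ℝ} (hs : 0 ≤ s) (hP : PS s (Δ : Set (FreeGroup (Fin d))) ≠ ∞) :
    critExp Δ ≤ s := by
  refine le_of_forall_pos_le_add fun δ hδ => ?_
  exact Filter.limsup_le_of_le (q_cobdd Δ) (q_ev Δ hs hP hδ)

lemma q_bdd : Filter.IsBoundedUnder (· ≤ ·) Filter.atTop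
    (fun R : ℕ => Real.log (growthCount Δ R : ℝ) / (R : ℝ)) := by
  set t := Real.log (2 * d + 1) with ht
  have h0 : 0 ≤ t := Real.log_nonneg (by have : (0:ℝ) ≤ d := by positivity
                                         linarith)
  have h1 : PS t (Set.univ : Set (FreeGroup (Fin d))) ≠ ∞ := by
    apply PS_univ_lt
    rw [ht, Real.exp_log (by positivity)]; simp
  exact ⟨t + 1, q_ev Δ h0 (ne_top_of_le_ne_top h1 (PS_mono t (Set.subset_univ _))) one_pos⟩

lemma le_critExp {s : ℝ} (hs : 0 < s) (hP : PS s (Δ : Set (FreeGroup (Fin d))) = ∞) :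
    s ≤ critExp Δ := by
  by_contra hlt
  push Not at hlt
  obtain ⟨u, hu1, hu2⟩ := exists_between (max_lt hlt hs)
  have hu0 : 0 < u := lt_of_le_of_lt (le_max_right _ _) hu1
  have h1 := Filter.eventually_lt_of_limsup_lt (lt_of_le_of_lt (le_max_left _ _) hu1) (q_bdd Δ)
  obtain ⟨R₀, hR₀⟩ := Filter.eventually_atTop.1 h1
  set K : ℝ := 1 + ∑ n ∈ Finset.range (R₀ + 1), (growthCount Δ n : ℝ) with hK
  have hK1 : 1 ≤ K := by
    rw [hK]; have : 0 ≤ ∑ n ∈ Finset.range (R₀ + 1), (growthCount Δ n : ℝ) := by positivity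
    linarith
  have h2 : ∀ n, (growthCount Δ n : ℝ) ≤ K * Real.exp (u * n) := by
    intro n
    have he : 1 ≤ Real.exp (u * n) := Real.one_le_exp (by positivity)
    by_cases hn : n ≤ R₀
    · have : (growthCount Δ n : ℝ) ≤ ∑ n ∈ Finset.range (R₀ + 1), (growthCount Δ n : ℝ) :=
        Finset.single_le_sum (f := fun n => (growthCount Δ n : ℝ)) (fun _ _ => by positivity)
          (Finset.mem_range.2 (by omega))
      nlinarith
    · have h3 := hR₀ n (by omega)
      have h4 : (0 : ℝ) < n := by exact_mod_cast (by omega : 0 < n)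
      rw [div_lt_iff₀ h4] at h3
      have hc : (0 : ℝ) < growthCount Δ n := by exact_mod_cast gc_pos Δ n
      have h5 := (Real.log_lt_iff_lt_exp hc).1 h3
      nlinarith
  have h3 : PS s (Δ : Set (FreeGroup (Fin d))) ≤ ∑' n, (growthCount Δ n : ℝ≥0∞) * ex s n := by
    calc PS s (Δ : Set (FreeGroup (Fin d))) = ∑' g : Δ,
          (fun p : Σ n : ℕ, {g : FreeGroup (Fin d) // g ∈ Δ ∧ FreeGroup.norm g ≤ n} => ex s p.1)
            ⟨g.1.norm, ⟨g.1, g.2, le_rfl⟩⟩ := rfl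
      _ ≤ ∑' p : Σ n : ℕ, {g : FreeGroup (Fin d) // g ∈ Δ ∧ FreeGroup.norm g ≤ n}, ex s p.1 := by
        apply ENNReal.tsum_comp_le_tsum_of_injective (f := fun g : Δ =>
          (⟨g.1.norm, ⟨g.1, g.2, le_rfl⟩⟩ : Σ n : ℕ, {g : FreeGroup (Fin d) // g ∈ Δ ∧ FreeGroup.norm g ≤ n}))
        intro a b h
        apply Subtype.ext
        exact congrArg (fun p : Σ n : ℕ, {g : FreeGroup (Fin d) // g ∈ Δ ∧ FreeGroup.norm g ≤ n} => p.2.1) h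
      _ = _ := by
        rw [ENNReal.tsum_sigma']
        congr 1; ext n
        rw [← gc_tsum, ← ENNReal.tsum_mul_right]; simp
  have h4 : ∑' n, (growthCount Δ n : ℝ≥0∞) * ex s n ≤ ∑' n, ENNReal.ofReal K * (ex (s - u) 1) ^ n := by
    refine ENNReal.tsum_le_tsum fun n => ?_
    rw [← ex_pow, ex, ex, ← ENNReal.ofReal_natCast, ← ENNReal.ofReal_mul (by positivity),
      ← ENNReal.ofReal_mul (by positivity)]
    apply ENNReal.ofReal_le_ofReal
    calc (growthCount Δ n : ℝ) * Real.exp (-s * n) ≤ K * Real.exp (u * n) * Real.exp (-s * n) := by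
          gcongr; exact h2 n
      _ = _ := by rw [mul_assoc, ← Real.exp_add]; congr 2; ring
  rw [hP, ENNReal.tsum_mul_left, ENNReal.tsum_geometric] at *
  have h5 := h3.trans h4
  rw [top_le_iff] at h5
  refine ENNReal.mul_ne_top ENNReal.ofReal_ne_top ?_ h5
  rw [Ne, ENNReal.inv_eq_top, tsub_eq_zero_iff_le, not_le]
  exact ex_lt_one (by linarith)

end bridge
end BD


namespace BD
open FreeGroup ENNReal

section letters
variable {α : Type*}

lemma mk_cons (x : α × Bool) (L : List (α × Bool)) :
    FreeGroup.mk (x :: L) = FreeGroup.mk [x] * FreeGroup.mk L := by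
  rw [mul_mk]; rfl

lemma mk_false (i : α) : FreeGroup.mk [(i, false)] = (FreeGroup.of i)⁻¹ := rfl
lemma mk_true (i : α) : FreeGroup.mk [(i, true)] = FreeGroup.of i := rfl

end letters

section girth
universe u
set_option linter.unusedSectionVars false
variable {α : Type u} [DecidableEq α] [Fintype α]

lemma exists_girth (p : ℕ) : ∃ (X : Type u) (_ : Finite X) (π : FreeGroup α →* Equiv.Perm X),
    ∀ w : FreeGroup α, w.norm ≤ p → π w = 1 → w = 1 := by
  classical
  let X : Type u := {g : FreeGroup α // g.norm ≤ p}
  have hX : Finite X := (ball_finite (α := α) p).to_subtype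
  have := Fintype.ofFinite X
  let e : ∀ i : α, {x : X // (FreeGroup.of i * x.1).norm ≤ p} ≃ {x : X // ((FreeGroup.of i)⁻¹ * x.1).norm ≤ p} :=
    fun i =>
    { toFun := fun x => ⟨⟨FreeGroup.of i * x.1.1, x.2⟩, by simpa using x.1.2⟩
      invFun := fun x => ⟨⟨(FreeGroup.of i)⁻¹ * x.1.1, x.2⟩, by simpa using x.1.2⟩
      left_inv := fun x => by simp
      right_inv := fun x => by simp }
  let π : FreeGroup α →* Equiv.Perm X := FreeGroup.lift fun i => (e i).extendSubtype
  have h1 : ∀ i (x : X) (h : (FreeGroup.of i * x.1).norm ≤ p), π (FreeGroup.of i) x = ⟨FreeGroup.of i * x.1, h⟩ := by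
    intro i x h
    simp only [π, FreeGroup.lift_apply_of]
    rw [Equiv.extendSubtype_apply_of_mem (e i) x h]
    rfl
  have h2 : ∀ y (x : X) (h : (FreeGroup.mk [y] * x.1).norm ≤ p), π (FreeGroup.mk [y]) x = ⟨FreeGroup.mk [y] * x.1, h⟩ := by
    rintro ⟨i, b⟩ x h
    cases b
    · simp only [mk_false] at h ⊢
      rw [_root_.map_inv, Equiv.Perm.inv_eq_iff_eq, h1 _ _ (by simpa using x.2)]
      apply Subtype.ext; simp
    · exact h1 i x h
  have hn : ∀ L : List (α × Bool), L.length ≤ p → (FreeGroup.mk L).norm ≤ p := fun L h =>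
    norm_mk_le.trans h
  have h3 : ∀ (L : List (α × Bool)) (h : L.length ≤ p),
      π (FreeGroup.mk L) ⟨1, by simp⟩ = ⟨FreeGroup.mk L, hn L h⟩ := by
    intro L
    induction L with
    | nil => intro h; exact congrFun (congrArg DFunLike.coe (_root_.map_one π)) _
    | cons y L ih =>
      intro h
      simp only [mk_cons y L]
      rw [_root_.map_mul, Equiv.Perm.mul_apply, ih (by simp at h; omega), h2 _ _ (by rw [← mk_cons]; exact hn _ h)]
  refine ⟨X, hX, π, fun w hw h => ?_⟩
  have h4 := h3 w.toWord hw
  simp only [mk_toWord, h] at h4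
  exact (Subtype.ext_iff.1 h4).symm

end girth

section weights
set_option linter.unusedSectionVars false
variable {α : Type*} {Q : Type*} [Group Q]
  (π : FreeGroup α →* Q)

def edge (x : α × Bool) (u : Q) : Q × α :=
  (if x.2 then u else (π (FreeGroup.of x.1))⁻¹ * u, x.1)

def out (ℓ : Q × α → ℕ) (v : Q) : List (α × Bool) → List (α × Bool)
  | [] => []
  | x :: L => List.replicate (ℓ (edge π x (π (FreeGroup.mk L) * v))) x ++ out ℓ v L

def WT (ℓ : Q × α → ℕ) (v : Q) : List (α × Bool) → ℕ
  | [] => 0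
  | x :: L => ℓ (edge π x (π (FreeGroup.mk L) * v)) + WT ℓ v L

lemma out_length (ℓ : Q × α → ℕ) (v : Q) (L : List (α × Bool)) :
    (out π ℓ v L).length = WT π ℓ v L := by
  induction L with
  | nil => rfl
  | cons x L ih => simp [out, WT, ih]

lemma WT_add (ℓ ℓ' : Q × α → ℕ) (v : Q) (L : List (α × Bool)) :
    WT π (fun e => ℓ e + ℓ' e) v L = WT π ℓ v L + WT π ℓ' v L := by
  induction L with
  | nil => rfl
  | cons x L ih => simp only [WT, ih]; ring

lemma WT_const (r : ℕ) (v : Q) (L : List (α × Bool)) :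
    WT π (fun _ => r) v L = r * L.length := by
  induction L with
  | nil => rfl
  | cons x L ih => simp only [WT, ih, List.length_cons]; ring

lemma WT_append (ℓ : Q × α → ℕ) (v : Q) (A B : List (α × Bool)) :
    WT π ℓ v (A ++ B) = WT π ℓ (π (FreeGroup.mk B) * v) A + WT π ℓ v B := by
  induction A with
  | nil => simp [WT]
  | cons x A ih =>
    simp only [List.cons_append, WT, ih, ← mul_mk, _root_.map_mul, mul_assoc]; ring

variable [DecidableEq α]

lemma out_red {ℓ : Q × α → ℕ} (hℓ : ∀ e, 1 ≤ ℓ e) (v : Q) {L : List (α × Bool)} (hL : IsReduced L) :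
    IsReduced (out π ℓ v L) ∧ (out π ℓ v L).head? = L.head? := by
  induction L with
  | nil => exact ⟨by simp [out], rfl⟩
  | cons x L ih =>
    obtain ⟨h1, h2⟩ := ih (red_right (L := [x]) hL)
    refine ⟨?_, ?_⟩
    · simp only [out, FreeGroup.IsReduced]
      rw [List.isChain_append]
      refine ⟨List.isChain_replicate_of_rel _ (fun _ => rfl), h1, ?_⟩
      intro a ha b hb
      rw [h2] at hb
      have ha' : a = x := by
        have := List.mem_of_mem_getLast? ha
        exact List.eq_of_mem_replicate this
      subst ha'
      cases L with
      | nil => simp at hb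
      | cons y L =>
        simp at hb; subst hb
        exact (isReduced_cons_cons.1 hL).1
    · simp only [out]
      obtain ⟨n, hn⟩ := Nat.exists_eq_add_of_le' (hℓ (edge π x (π (FreeGroup.mk L) * v)))
      rw [hn]; simp [List.replicate_succ]

def gen (ℓ : Q × α → ℕ) (i : α) : Equiv.Perm (Q × FreeGroup α) where
  toFun z := (π (FreeGroup.of i) * z.1, FreeGroup.of i ^ ℓ (z.1, i) * z.2)
  invFun z := ((π (FreeGroup.of i))⁻¹ * z.1, (FreeGroup.of i ^ ℓ ((π (FreeGroup.of i))⁻¹ * z.1, i))⁻¹ * z.2)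
  left_inv z := by simp
  right_inv z := by simp

def psi (ℓ : Q × α → ℕ) : FreeGroup α →* Equiv.Perm (Q × FreeGroup α) := FreeGroup.lift (gen π ℓ)

lemma mk_replicate (n : ℕ) (x : α × Bool) : FreeGroup.mk (List.replicate n x) = FreeGroup.mk [x] ^ n := by
  induction n with
  | zero => rfl
  | succ n ih => rw [List.replicate_succ, mk_cons, ih, pow_succ']

lemma psi_mk (ℓ : Q × α → ℕ) (L : List (α × Bool)) (v : Q) (x : FreeGroup α) :
    psi π ℓ (FreeGroup.mk L) (v, x) = (π (FreeGroup.mk L) * v, FreeGroup.mk (out π ℓ v L) * x) := by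
  induction L with
  | nil => simp [out, ← FreeGroup.one_eq_mk]
  | cons y L ih =>
    rw [mk_cons, _root_.map_mul, Equiv.Perm.mul_apply, ih]
    simp only [out]
    rw [← mul_mk, mk_replicate, _root_.map_mul]
    obtain ⟨i, b⟩ := y
    cases b
    · rw [mk_false, _root_.map_inv, Equiv.Perm.inv_eq_iff_eq]
      simp only [psi, FreeGroup.lift_apply_of]
      simp [gen, edge, mul_assoc]
    · rw [mk_true]
      simp only [psi, FreeGroup.lift_apply_of]
      simp [gen, edge, mul_assoc]

lemma psi_apply (ℓ : Q × α → ℕ) (w : FreeGroup α) (v : Q) (x : FreeGroup α) :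
    psi π ℓ w (v, x) = (π w * v, FreeGroup.mk (out π ℓ v w.toWord) * x) := by
  have := psi_mk π ℓ w.toWord v x
  rwa [mk_toWord] at this

def Phi (ℓ : Q × α → ℕ) : π.ker →* FreeGroup α where
  toFun w := FreeGroup.mk (out π ℓ 1 w.1.toWord)
  map_one' := by simp [out, ← FreeGroup.one_eq_mk]
  map_mul' w w' := by
    have h1 := psi_apply π ℓ (w.1 * w'.1) 1 1
    rw [_root_.map_mul, Equiv.Perm.mul_apply, psi_apply, psi_apply] at h1
    have h2 : π w'.1 = 1 := w'.2
    have h3 := congrArg Prod.snd h1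
    simp only [h2, mul_one] at h3
    simpa using h3.symm

lemma Phi_norm {ℓ : Q × α → ℕ} (hℓ : ∀ e, 1 ≤ ℓ e) (w : π.ker) :
    (Phi π ℓ w).norm = WT π ℓ 1 w.1.toWord := by
  rw [← out_length]
  exact norm_mk_red (out_red π hℓ 1 isReduced_toWord).1

lemma Phi_inj {ℓ : Q × α → ℕ} (hℓ : ∀ e, 1 ≤ ℓ e) : Function.Injective (Phi π ℓ) := by
  rw [injective_iff_map_eq_one]
  intro w hw
  have h1 : (out π ℓ 1 w.1.toWord) = [] := by
    rw [← toWord_mk_red (out_red π hℓ 1 isReduced_toWord).1]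
    have : FreeGroup.mk (out π ℓ 1 w.1.toWord) = 1 := hw
    rw [this]; simp
  have h2 := (out_red π hℓ 1 (isReduced_toWord (x := w.1))).2
  rw [h1] at h2
  have h3 : w.1.toWord = [] := by
    rcases hL : w.1.toWord with _ | ⟨a, L⟩
    · rfl
    · rw [hL] at h2; simp at h2
  exact Subtype.ext (toWord_eq_nil_iff.1 h3)

lemma PS_range {ℓ : Q × α → ℕ} (hℓ : ∀ e, 1 ≤ ℓ e) (s : ℝ) :
    PS s ((Phi π ℓ).range : Set (FreeGroup α)) = ∑' w : π.ker, ex s (WT π ℓ 1 w.1.toWord) := by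
  have h := tsum_range (g := Phi π ℓ) (fun g => ex s g.norm) (Phi_inj π hℓ)
  simp only [Phi_norm π hℓ] at h
  exact h

variable [DecidableEq Q]

lemma decomp (e : Q × α) (v : Q) (A : List (α × Bool)) :
    WT π (fun e' => if e' = e then 1 else 0) v A = 0 ∨ ∃ A' x B, A = A' ++ x :: B ∧
      WT π (fun e' => if e' = e then 1 else 0) v B = 0 ∧ edge π x (π (FreeGroup.mk B) * v) = e := by
  induction A with
  | nil => left; rfl
  | cons z A ih =>
    rcases ih with h | ⟨A', x, B, rfl, h1, h2⟩
    · by_cases he : edge π z (π (FreeGroup.mk A) * v) = e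
      · exact Or.inr ⟨[], z, A, rfl, h, he⟩
      · left; simp [WT, h, he]
    · exact Or.inr ⟨z :: A', x, B, rfl, h1, h2⟩

variable {π} {p : ℕ}

lemma loop_long (hp : ∀ w : FreeGroup α, w.norm ≤ p → π w = 1 → w = 1)
    {B : List (α × Bool)} (hB : IsReduced B) (hne : B ≠ []) (h : π (FreeGroup.mk B) = 1) :
    p < B.length := by
  by_contra hlt
  have h1 := hp (FreeGroup.mk B) (by rw [norm_mk_red hB]; omega) h
  have h2 := toWord_mk_red hB
  rw [h1] at h2
  exact hne (by simpa using h2.symm)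

lemma cross_gap (hp : ∀ w : FreeGroup α, w.norm ≤ p → π w = 1 → w = 1)
    {x y : α × Bool} {B : List (α × Bool)} {u : Q}
    (hr : IsReduced (x :: (B ++ [y])))
    (h : edge π x (π (FreeGroup.mk (B ++ [y])) * u) = edge π y u) : p ≤ B.length := by
  have hBy : IsReduced (B ++ [y]) := red_right (L := [x]) hr
  have hB : IsReduced B := red_left hBy
  have key1 : π (FreeGroup.mk (B ++ [y])) = 1 → p ≤ B.length := by
    intro h1
    have := loop_long hp hBy (by simp) h1
    simp at this; omega
  have key2 : B ≠ [] → π (FreeGroup.mk B) = 1 → p ≤ B.length := fun h1 h2 =>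
    (loop_long hp hB h1 h2).le
  obtain ⟨i, b⟩ := x
  obtain ⟨j, c⟩ := y
  simp only [edge, Prod.mk.injEq] at h
  obtain ⟨h1, rfl⟩ := h
  cases b <;> cases c <;> simp only [if_true, if_false, Bool.false_eq_true] at h1
  · apply key1
    simpa using h1
  · apply key2
    · rintro rfl
      simp [isReduced_cons_cons] at hr
    · rw [← mul_mk, mk_true, _root_.map_mul] at h1
      have h2 : π (FreeGroup.mk B) * π (FreeGroup.of i) = π (FreeGroup.of i) := by
        apply mul_right_cancel (b := u)
        rw [inv_mul_eq_iff_eq_mul] at h1; exact h1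
      simpa using h2
  · apply key2
    · rintro rfl
      simp [isReduced_cons_cons] at hr
    · rw [← mul_mk, mk_false, _root_.map_mul, _root_.map_inv, mul_assoc] at h1
      simpa using h1
  · apply key1
    simpa using h1

lemma cross_aux (hp : ∀ w : FreeGroup α, w.norm ≤ p → π w = 1 → w = 1)
    (e : Q × α) (n : ℕ) : ∀ (A : List (α × Bool)) (y : α × Bool) (u : Q), A.length ≤ n →
    edge π y u = e → IsReduced (A ++ [y]) →
    p * WT π (fun e' => if e' = e then 1 else 0) (π (FreeGroup.mk [y]) * u) A ≤ A.length := by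
  induction n with
  | zero =>
    intro A y u h _ _
    have : A = [] := by simpa using h
    subst this; simp [WT]
  | succ n ih =>
    intro A y u hn he hr
    rcases decomp π e (π (FreeGroup.mk [y]) * u) A with h | ⟨A', x, B, rfl, h1, h2⟩
    · simp [h]
    rw [WT_append, WT, h1, if_pos h2]
    have hr2 : IsReduced (x :: (B ++ [y])) := red_right (L := A') (by simpa using hr)
    have hgap := cross_gap hp (u := u) hr2 (by rw [← mul_mk, _root_.map_mul, mul_assoc, h2, he])
    have hr3 : IsReduced (A' ++ [x]) := red_left (M := B ++ [y]) (by simpa using hr)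
    have h3 := ih A' x (π (FreeGroup.mk B) * (π (FreeGroup.mk [y]) * u)) (by simp at hn; omega) h2 hr3
    rw [← mul_assoc (π (FreeGroup.mk [x])), ← _root_.map_mul, ← mk_cons] at h3
    simp only [List.length_append, List.length_cons]
    rw [mul_add]; omega

lemma cross (hp : ∀ w : FreeGroup α, w.norm ≤ p → π w = 1 → w = 1)
    (e : Q × α) (v : Q) {L : List (α × Bool)} (hL : IsReduced L) :
    p * WT π (fun e' => if e' = e then 1 else 0) v L ≤ L.length + p := by
  rcases decomp π e v L with h | ⟨A', x, B, rfl, h1, h2⟩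
  · simp [h]
  rw [WT_append, WT, h1, if_pos h2]
  have hr3 : IsReduced (A' ++ [x]) := red_left (M := B) (by simpa using hL)
  have h3 := cross_aux hp e _ A' x (π (FreeGroup.mk B) * v) le_rfl h2 hr3
  rw [← mul_assoc (π (FreeGroup.mk [x])), ← _root_.map_mul, ← mk_cons] at h3
  simp only [List.length_append, List.length_cons]
  rw [mul_add]; omega

lemma step_weight (hp : ∀ w : FreeGroup α, w.norm ≤ p → π w = 1 → w = 1)
    (hp0 : 0 < p) {ℓ : Q × α → ℕ} (hℓ : ∀ e, 1 ≤ ℓ e) (e : Q × α) {s : ℝ} (hs : 0 ≤ s)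
    (h : PS s ((Phi π (fun e' => ℓ e' + if e' = e then 1 else 0)).range : Set (FreeGroup α)) ≠ ∞) :
    PS (s * (1 + 1 / p)) ((Phi π ℓ).range : Set (FreeGroup α)) ≠ ∞ := by
  rw [PS_range π (fun e' => le_add_right (hℓ e'))] at h
  rw [PS_range π hℓ]
  have h1 : ex s 1 * ∑' w : π.ker, ex (s * (1 + 1 / p)) (WT π ℓ 1 w.1.toWord) ≤
      ∑' w : π.ker, ex s (WT π (fun e' => ℓ e' + if e' = e then 1 else 0) 1 w.1.toWord) := by
    rw [← ENNReal.tsum_mul_left]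
    refine ENNReal.tsum_le_tsum fun w => ?_
    rw [WT_add]
    have h2 := cross hp e 1 (isReduced_toWord (x := w.1))
    have h3 : w.1.toWord.length ≤ WT π ℓ 1 w.1.toWord := by
      rw [← out_length]
      have : ∀ L, L.length ≤ (out π ℓ 1 L).length := by
        intro L
        induction L with
        | nil => simp
        | cons x L ih =>
          have := hℓ (edge π x (π (FreeGroup.mk L) * 1))
          simp only [out, List.length_append, List.length_replicate, List.length_cons]; omega
      exact this _
    generalize WT π ℓ 1 w.1.toWord = a at *
    generalize WT π (fun e' => if e' = e then 1 else 0) 1 w.1.toWord = c at *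
    rw [ex, ex, ex, ← ENNReal.ofReal_mul (Real.exp_pos _).le, ← Real.exp_add]
    apply ENNReal.ofReal_le_ofReal
    apply Real.exp_le_exp.2
    have hp' : (0 : ℝ) < p := by exact_mod_cast hp0
    have h4 : (p : ℝ) * c ≤ a + p := by exact_mod_cast h2.trans (by omega)
    have h5 : (c : ℝ) ≤ a / p + 1 := by
      rw [← sub_le_iff_le_add, le_div_iff₀ hp']; linarith
    push_cast
    have h6 := mul_le_mul_of_nonneg_left h5 hs
    have : s * (1 + 1 / (p:ℝ)) * a = s * a + s * (a / p) := by ring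
    linarith
  intro h2
  rw [h2, ENNReal.mul_top (ex_ne_zero _ _)] at h1
  exact h (top_le_iff.1 h1)

end weights

section initial
variable {α : Type*} [DecidableEq α] [Fintype α] [Nonempty α]

lemma exists_init_aux {Q : Type*} [Group Q] [Finite Q] {p : ℕ} (π : FreeGroup α →* Q)
    (hπ : ∀ w : FreeGroup α, w.norm ≤ p → π w = 1 → w = 1) (hp0 : 0 < p)
    {s : ℝ} (hs0 : 0 < s) (hs : Real.exp s ≤ 2 * Fintype.card α - 1) {s' : ℝ}
    (hps : s' < s / (1 + 1 / p)) :
    ∃ Γ : Subgroup (FreeGroup α), Γ.FG ∧ PS s (Γ : Set (FreeGroup α)) ≠ ∞ ∧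
      ∃ s'' : ℝ, s' < s'' ∧ 0 < s'' ∧ PS s'' (Γ : Set (FreeGroup α)) = ∞ := by
  classical
  have := Fintype.ofFinite Q
  let ℓ : Multiset (Q × α) → Q × α → ℕ := fun m e => 1 + m.count e
  have hℓ : ∀ m e, 1 ≤ ℓ m e := fun m e => by simp [ℓ]
  let G : Multiset (Q × α) → Subgroup (FreeGroup α) := fun m => (Phi π (ℓ m)).range
  have hcons : ∀ m e, ℓ (e ::ₘ m) = fun e' => ℓ m e' + if e' = e then 1 else 0 := by
    intro m e
    ext e'
    simp only [ℓ, Multiset.count_cons]; ring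
  have hfin : π.ker.FiniteIndex := inferInstance
  have hFG : ∀ m, (G m).FG := by
    intro m
    have : Group.FG π.ker := inferInstance
    exact (Group.fg_iff_subgroup_fg _).1 (inferInstanceAs (Group.FG (Phi π (ℓ m)).range))
  have h0 : PS s (G 0 : Set (FreeGroup α)) = ∞ := by
    have h1 := PS_finiteIndex hs0.le hs π.ker
    simp only [G]
    rw [PS_range π (hℓ 0)]
    have : ℓ 0 = fun _ => 1 := by ext e; simp [ℓ]
    simp only [this, WT_const, one_mul]
    exact h1
  have hr : ∃ m, PS s (G m : Set (FreeGroup α)) ≠ ∞ := by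
    obtain ⟨r, hr⟩ := exists_nat_gt (2 * (Fintype.card α : ℝ) / s)
    refine ⟨r • (Finset.univ : Finset (Q × α)).val, ?_⟩
    have : ℓ (r • (Finset.univ : Finset (Q × α)).val) = fun _ => 1 + r := by
      ext e
      simp only [ℓ, Multiset.count_nsmul, Multiset.count_univ, mul_one]
    simp only [G]
    rw [PS_range π (hℓ _), this]
    simp only [WT_const]
    have h2 : PS (s * r) (Set.univ : Set (FreeGroup α)) ≠ ∞ := by
      apply PS_univ_lt
      rw [div_lt_iff₀ hs0] at hr
      have := Real.add_one_le_exp (s * r)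
      linarith
    refine ne_top_of_le_ne_top h2 ?_
    refine le_trans ?_ (PS_mono _ (Set.subset_univ (π.ker : Set (FreeGroup α))))
    refine ENNReal.tsum_le_tsum fun w => ?_
    apply ENNReal.ofReal_le_ofReal
    apply Real.exp_le_exp.2
    simp only [FreeGroup.norm]
    push_cast
    have : 0 ≤ s * (w.1.toWord.length : ℝ) := by positivity
    nlinarith
  have hex : ∃ m e, PS s (G m : Set (FreeGroup α)) = ∞ ∧ PS s (G (e ::ₘ m) : Set (FreeGroup α)) ≠ ∞ := by
    by_contra hno
    push Not at hno
    obtain ⟨m, hm⟩ := hr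
    apply hm
    induction m using Multiset.induction with
    | empty => exact h0
    | cons e m ih => 
      by_cases h : PS s (G m : Set (FreeGroup α)) = ∞
      · exact hno m e h
      · exact absurd (ih h) h
  obtain ⟨m, e, h1, h2⟩ := hex
  have hp' : (0 : ℝ) < 1 + 1 / p := by positivity
  refine ⟨G (e ::ₘ m), hFG _, h2, s / (1 + 1 / p), hps, by positivity, ?_⟩
  by_contra h3
  simp only [G] at h3
  rw [hcons] at h3
  have h4 := step_weight hπ hp0 (hℓ m) e (by positivity) h3
  rw [div_mul_cancel₀ _ hp'.ne'] at h4
  exact h4 h1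

lemma exists_init {s : ℝ} (hs0 : 0 < s) (hs : Real.exp s ≤ 2 * Fintype.card α - 1) {s' : ℝ} (hs' : s' < s) :
    ∃ Γ : Subgroup (FreeGroup α), Γ.FG ∧ PS s (Γ : Set (FreeGroup α)) ≠ ∞ ∧
      ∃ s'' : ℝ, s' < s'' ∧ 0 < s'' ∧ PS s'' (Γ : Set (FreeGroup α)) = ∞ := by
  classical
  obtain ⟨p, hp0, hps⟩ : ∃ p : ℕ, 0 < p ∧ s' < s / (1 + 1 / p) := by
    have h1 : Filter.Tendsto (fun p : ℕ => s / (1 + 1 / (p : ℝ))) Filter.atTop (nhds (s / (1 + 0))) :=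
      tendsto_const_nhds.div (tendsto_const_nhds.add tendsto_one_div_atTop_nhds_zero_nat) (by simp)
    rw [add_zero, div_one] at h1
    obtain ⟨p, h2, h3⟩ := ((h1.eventually (lt_mem_nhds hs')).and (Filter.eventually_gt_atTop 0)).exists
    exact ⟨p, h3, h2⟩
  obtain ⟨X, hX, π, hπ⟩ := exists_girth (α := α) p
  exact exists_init_aux π hπ hp0 hs0 hs hps

end initial
end BD


namespace BD
open FreeGroup ENNReal

section final
variable {α : Type*} [DecidableEq α] [Fintype α] [Nonempty α]

lemma mem_map_conj {G : Type*} [Group G] (Δ : Subgroup G) (a h : G) :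
    h ∈ Subgroup.map (MulAut.conj a).toMonoidHom Δ ↔ a⁻¹ * h * a ∈ Δ := by
  constructor
  · rintro ⟨x, hx, rfl⟩
    simpa [mul_assoc] using hx
  · intro hx
    exact ⟨_, hx, by simp [mul_assoc]⟩

lemma step2 {s : ℝ} (hs0 : 0 < s) (hs : Real.exp s ≤ 2 * Fintype.card α - 1)
    (g : FreeGroup α) (i : ℕ) {η : ℝ≥0∞} (hη : η ≠ 0)
    (q : {q : Subgroup (FreeGroup α) × ℕ // q.1.FG ∧ PS s (q.1 : Set (FreeGroup α)) ≠ ∞}) (hηt : η ≠ ∞) :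
    ∃ q' : {q : Subgroup (FreeGroup α) × ℕ // q.1.FG ∧ PS s (q.1 : Set (FreeGroup α)) ≠ ∞},
      q.1.1 ≤ q'.1.1 ∧ PS s (q'.1.1 : Set (FreeGroup α)) ≤ PS s (q.1.1 : Set (FreeGroup α)) + η ∧
      (∃ n : ℕ, 1 ≤ n ∧ g ^ n ∈ q'.1.1) ∧ q.1.2 ≤ q'.1.2 ∧
      (∀ y ∈ q'.1.1, y.norm ≤ q'.1.2 → y ∈ q.1.1) ∧
      ∃ z : FreeGroup α, i + 2 * z.norm ≤ q'.1.2 ∧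
        ∀ b : FreeGroup α, b.norm ≤ i → z * b * z⁻¹ ∈ q.1.1 → b = 1 := by
  obtain ⟨⟨Γ, M⟩, hFG, hP⟩ := q
  simp only at hFG hP ⊢
  have hi : ¬ Γ.FiniteIndex := fun h => hP (PS_finiteIndex hs0.le hs Γ)
  obtain ⟨z, hz⟩ := nonconf hFG hi i
  obtain ⟨Γ', h1, h2, h3, h4, h5⟩ := step hs0 hFG hP g (max M (i + 2 * z.norm)) hη
  exact ⟨⟨(Γ', max M (i + 2 * z.norm)), h2, ne_top_of_le_ne_top (by simp [hP, hηt]) h3⟩, h1, h3, h4,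
    le_max_left _ _, h5, z, le_max_right _ _, hz⟩

lemma PS_iSup {s : ℝ} {Γ : ℕ → Subgroup (FreeGroup α)} (hΓ : Monotone Γ) {C : ℝ≥0∞}
    (hC : ∀ n, PS s (Γ n : Set (FreeGroup α)) ≤ C) :
    PS s ((⨆ n, Γ n : Subgroup (FreeGroup α)) : Set (FreeGroup α)) ≤ C := by
  classical
  refine ENNReal.summable.tsum_le_of_sum_le fun T => ?_
  have hT : ∀ t : ((⨆ n, Γ n : Subgroup (FreeGroup α)) : Set (FreeGroup α)), ∃ n, t.1 ∈ Γ n := fun t =>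
    (Subgroup.mem_iSup_of_directed hΓ.directed_le).1 t.2
  choose f hf using hT
  refine le_trans ?_ (hC (T.sup f))
  have h1 : ∑ t ∈ T, ex s t.1.norm = ∑ g ∈ T.image Subtype.val, ex s (FreeGroup.norm g) := by
    rw [Finset.sum_image (fun a _ b _ h => Subtype.ext h)]
  rw [h1, ← Finset.tsum_subtype]
  refine PS_mono s (A := {x | x ∈ T.image Subtype.val}) ?_
  intro g hg
  obtain ⟨t, ht, rfl⟩ := Finset.mem_image.1 hg
  exact hΓ (Finset.le_sup ht) (hf t)

lemma build {s : ℝ} (hs0 : 0 < s) (hs : Real.exp s ≤ 2 * Fintype.card α - 1)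
    {Γ₀ : Subgroup (FreeGroup α)} (hFG : Γ₀.FG) (hP : PS s (Γ₀ : Set (FreeGroup α)) ≠ ∞) :
    ∃ Δ : Subgroup (FreeGroup α), Γ₀ ≤ Δ ∧ PS s (Δ : Set (FreeGroup α)) ≠ ∞ ∧ IsBoomerang Δ ∧
      ∃ g : ℕ → FreeGroup α,
        ChabautyTendsto (fun n => Subgroup.map (MulAut.conj (g n)).toMonoidHom Δ) ⊥ := by
  classical
  have : Countable (FreeGroup α) := Countable.of_equiv _ (Equiv.refl _)
  obtain ⟨en, hen⟩ := exists_surjective_nat (FreeGroup α)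
  have hη : ∀ i : ℕ, (2⁻¹ : ℝ≥0∞) ^ i ≠ 0 := fun i => by simp
  have hηt : ∀ i : ℕ, (2⁻¹ : ℝ≥0∞) ^ i ≠ ∞ := fun i => by simp
  choose nx n1 n2 n3 n4 n5 zz n6 n7 using fun (i : ℕ) q => step2 hs0 hs (en i) i (hη i) q (hηt i)
  let q : ℕ → {q : Subgroup (FreeGroup α) × ℕ // q.1.FG ∧ PS s (q.1 : Set (FreeGroup α)) ≠ ∞} :=
    fun n => Nat.rec ⟨(Γ₀, 0), hFG, hP⟩ (fun i q => nx i q) n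
  have hq : ∀ n, q (n + 1) = nx n (q n) := fun n => rfl
  let Γ : ℕ → Subgroup (FreeGroup α) := fun n => (q n).1.1
  have hmono : Monotone Γ := monotone_nat_of_le_succ fun n => n1 n (q n)
  have hM : Monotone fun n => (q n).1.2 := monotone_nat_of_le_succ fun n => n4 n (q n)
  have hdir : ∀ y, y ∈ (⨆ n, Γ n) ↔ ∃ n, y ∈ Γ n := fun y =>
    Subgroup.mem_iSup_of_directed hmono.directed_le
  have hsmall : ∀ i, ∀ y ∈ (⨆ n, Γ n), y.norm ≤ (q (i + 1)).1.2 → y ∈ Γ i := by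
    intro i y hy hn
    obtain ⟨j, hj⟩ := (hdir y).1 hy
    by_cases hij : j ≤ i
    · exact hmono hij hj
    obtain ⟨k, rfl⟩ := Nat.exists_eq_add_of_le (le_of_not_ge hij)
    clear hij
    induction k with
    | zero => exact hj
    | succ k ih =>
      apply ih
      exact n5 (i + k) (q (i + k)) y hj (hn.trans (hM (show i + 1 ≤ i + k + 1 by omega)))
  refine ⟨⨆ n, Γ n, le_iSup Γ 0, ?_, ?_, ?_⟩
  · have hb : ∀ n, PS s (Γ n : Set (FreeGroup α)) ≤ PS s (Γ₀ : Set (FreeGroup α)) +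
        ∑ i ∈ Finset.range n, (2⁻¹ : ℝ≥0∞) ^ i := by
      intro n
      induction n with
      | zero => simp [Γ, q]
      | succ n ih =>
        refine (n2 n (q n)).trans ?_
        rw [Finset.sum_range_succ, ← add_assoc]
        gcongr
    have hb2 : ∀ n, PS s (Γ n : Set (FreeGroup α)) ≤ PS s (Γ₀ : Set (FreeGroup α)) +
        ∑' i : ℕ, (2⁻¹ : ℝ≥0∞) ^ i := fun n => (hb n).trans (by gcongr; exact ENNReal.sum_le_tsum _)
    refine ne_top_of_le_ne_top ?_ (PS_iSup hmono hb2)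
    rw [ENNReal.tsum_geometric, ENNReal.one_sub_inv_two]
    simp [hP]
  · intro g
    obtain ⟨i, rfl⟩ := hen g
    obtain ⟨n, hn, hg⟩ := n3 i (q i)
    have hg' : en i ^ n ∈ (⨆ n, Γ n) := (hdir _).2 ⟨i + 1, hg⟩
    refine ⟨fun k => n * (k + 1), ?_, ?_⟩
    · intro a b hab
      exact Nat.mul_lt_mul_of_pos_left (by omega) (by omega)
    · intro h
      refine Filter.Eventually.of_forall fun k => ?_
      rw [mem_map_conj, pow_mul]
      have h1 : (en i ^ n) ^ (k + 1) ∈ (⨆ n, Γ n) := pow_mem hg' _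
      rw [Subgroup.mul_mem_cancel_right _ h1, Subgroup.mul_mem_cancel_left _ (inv_mem h1)]
  · refine ⟨fun n => (zz n (q n))⁻¹, fun h => ?_⟩
    filter_upwards [Filter.eventually_ge_atTop h.norm] with n hn
    rw [mem_map_conj, inv_inv, Subgroup.mem_bot]
    constructor
    · intro hh
      refine n7 n (q n) h hn (hsmall n _ hh ?_)
      rw [hq]
      refine le_trans ?_ (n6 n (q n))
      have e1 := FreeGroup.norm_mul_le (zz n (q n) * h) (zz n (q n))⁻¹
      have e2 := FreeGroup.norm_mul_le (zz n (q n)) h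
      rw [norm_inv_eq] at e1
      omega
    · rintro rfl
      simp

end final

lemma critExp_nonneg {d : ℕ} (Δ : Subgroup (FreeGroup (Fin d))) : 0 ≤ critExp Δ :=
  Filter.le_limsup_of_frequently_le (Filter.Frequently.of_forall fun R => q_nonneg Δ R) (q_bdd Δ)

theorem main (d : ℕ) (hd : 2 ≤ d)
    (x : ℝ) (hx : x ∈ Set.Icc (0 : ℝ) (Real.log (2 * (d : ℝ) - 1)))
    (ε : ℝ) (hε : 0 < ε) :
    ∃ Δ : Subgroup (FreeGroup (Fin d)), IsBoomerang Δ ∧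
      (∃ g : ℕ → FreeGroup (Fin d),
        ChabautyTendsto (fun n => Subgroup.map (MulAut.conj (g n)).toMonoidHom Δ) ⊥) ∧
      |critExp Δ - x| < ε := by
  obtain ⟨hx0, hx1⟩ := hx
  have hd' : (2 : ℝ) ≤ d := by exact_mod_cast hd
  rcases hx0.eq_or_lt with rfl | hx0
  · refine ⟨⊥, fun g => ⟨id, strictMono_id, fun h => ?_⟩, ⟨fun _ => 1, fun h => ?_⟩, ?_⟩
    · simp
    · simp
    · have h1 : critExp (⊥ : Subgroup (FreeGroup (Fin d))) ≤ ε / 2 := by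
        apply critExp_le _ (by positivity)
        have : PS (ε / 2) ((⊥ : Subgroup (FreeGroup (Fin d))) : Set (FreeGroup (Fin d))) =
            ∑' g : ({1} : Set (FreeGroup (Fin d))), ex (ε / 2) g.1.norm := rfl
        rw [this, tsum_singleton (1 : FreeGroup (Fin d)) (fun g => ex (ε / 2) (FreeGroup.norm g))]
        exact ex_ne_top _ _
      have h2 := critExp_nonneg (⊥ : Subgroup (FreeGroup (Fin d)))
      rw [sub_zero, abs_of_nonneg h2]
      linarith
  have : Nonempty (Fin d) := ⟨⟨0, by omega⟩⟩
  set δ := min ε x with hδ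
  have hδ0 : 0 < δ := lt_min hε hx0
  have hδ1 : δ ≤ ε := min_le_left _ _
  have hδ2 : δ ≤ x := min_le_right _ _
  have hs0 : 0 < x - δ / 2 := by linarith
  have hs : Real.exp (x - δ / 2) ≤ 2 * Fintype.card (Fin d) - 1 := by
    rw [Fintype.card_fin]
    calc Real.exp (x - δ / 2) ≤ Real.exp (Real.log (2 * (d : ℝ) - 1)) := Real.exp_le_exp.2 (by linarith)
      _ = _ := Real.exp_log (by linarith)
  obtain ⟨Γ₀, h1, h2, s'', h3, h4, h5⟩ := exists_init hs0 hs (s' := x - δ) (by linarith)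
  obtain ⟨Δ, k1, k2, k3, k4⟩ := build hs0 hs h1 h2
  refine ⟨Δ, k3, k4, ?_⟩
  have e1 := critExp_le Δ hs0.le k2
  have e2 := le_critExp Δ h4 (top_le_iff.1 (h5 ▸ PS_mono s'' k1))
  rw [abs_lt]
  constructor <;> linarith

end BD


theorem nonconfined_boomerang_critExp_dense (d : ℕ) (hd : 2 ≤ d)
    (x : ℝ) (hx : x ∈ Set.Icc (0 : ℝ) (Real.log (2 * (d : ℝ) - 1)))
    (ε : ℝ) (hε : 0 < ε) :
    ∃ Δ : Subgroup (FreeGroup (Fin d)), IsBoomerang Δ ∧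
      (∃ g : ℕ → FreeGroup (Fin d),
        ChabautyTendsto (fun n => Subgroup.map (MulAut.conj (g n)).toMonoidHom Δ) ⊥) ∧
      |critExp Δ - x| < ε := by
  exact BD.main d hd x hx ε hε
end

section
/- Let d ≥ 2. There exists a nontrivial boomerang subgroup Δ of F_d such that the only invariant random subgroup supported on the closure of the conjugacy class of Δ is the Dirac measure at the trivial subgroup: every Borel probability measure μ on Sub(F_d) that is invariant under conjugation by every element of F_d and satisfies μ(closure{g Δ g^{-1} : g ∈ F_d}) = 1 equals the Dirac measure concentrated at the trivial subgroup {1}. -/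
open Filter

/-- The Chabauty topology on the space of subgroups of `G`, induced from the
product topology on `G → Bool` via the characteristic function of membership. -/
noncomputable instance chabautyTopology (G : Type*) [Group G] :
    TopologicalSpace (Subgroup G) :=
  TopologicalSpace.induced
    (fun (H : Subgroup G) (g : G) => @decide (g ∈ H) (Classical.propDecidable _))
    inferInstance

noncomputable instance chabautyMeasurableSpace (G : Type*) [Group G] :
    MeasurableSpace (Subgroup G) :=
  borel (Subgroup G)

open Classical in
lemma path_aux {ι α : Type} [MulAction (FreeGroup ι) α] (w : FreeGroup ι) :
    ∀ x : α, ∃ S : Finset α, ∀ (X : Type) (π : FreeGroup ι →* Equiv.Perm X) (j : α → X),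
      (∀ i, ∀ y ∈ S, FreeGroup.of i • y ∈ S →
        π (FreeGroup.of i) (j y) = j (FreeGroup.of i • y)) →
      π w (j x) = j (w • x) := by
  induction w using FreeGroup.induction_on with
  | C1 => intro x; exact ⟨∅, fun X π j _ => by simp⟩
  | of i =>
    intro x
    refine ⟨{x, FreeGroup.of i • x}, fun X π j h => ?_⟩
    exact h i x (by simp) (by simp)
  | inv_of i _ =>
    intro x
    refine ⟨{x, (FreeGroup.of i)⁻¹ • x}, fun X π j h => ?_⟩
    have := h i ((FreeGroup.of i)⁻¹ • x) (by simp) (by simp)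
    rw [smul_inv_smul] at this
    rw [map_inv, ← this]
    simp
  | mul u v hu hv =>
    intro x
    obtain ⟨S, hS⟩ := hv x
    obtain ⟨T, hT⟩ := hu (v • x)
    refine ⟨S ∪ T, fun X π j h => ?_⟩
    have h1 := hS X π j (fun i y hy hy' => h i y (by simp [hy]) (by simp [hy']))
    have h2 := hT X π j (fun i y hy hy' => h i y (by simp [hy]) (by simp [hy']))
    rw [map_mul, Equiv.Perm.mul_apply, h1, h2, mul_smul]

open Classical in
lemma disagree_aux {ι : Type} (w : FreeGroup ι) :
    ∃ C : ℕ, ∀ (X : Type) [Fintype X] (π π' : FreeGroup ι →* Equiv.Perm X),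
      (∀ i, (Finset.univ.filter fun x => π (FreeGroup.of i) x ≠ π' (FreeGroup.of i) x).card ≤ 2) →
      (Finset.univ.filter fun x => π w x ≠ π' w x).card ≤ C := by
  induction w using FreeGroup.induction_on with
  | C1 => exact ⟨0, fun X _ π π' _ => by simp⟩
  | of i => exact ⟨2, fun X _ π π' h => h i⟩
  | inv_of i _ =>
    refine ⟨2, fun X _ π π' h => le_trans ?_ (h i)⟩
    refine Finset.card_le_card_of_injOn (fun x => (π (FreeGroup.of i))⁻¹ x) ?_
      (fun x _ y _ hxy => by simpa using hxy)
    intro x hx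
    simp only [map_inv, Finset.coe_filter, Finset.mem_univ, true_and, Set.mem_ofPred_eq] at hx ⊢
    intro h
    apply hx
    rw [Equiv.Perm.eq_inv_iff_eq, ← h]
    simp
  | mul u v hu hv =>
    obtain ⟨C, hC⟩ := hu
    obtain ⟨D, hD⟩ := hv
    refine ⟨C + D, fun X _ π π' h => ?_⟩
    have h1 := hC X π π' h
    have h2 := hD X π π' h
    have h3 : (Finset.univ.filter fun x => π u (π v x) ≠ π' u (π v x)).card ≤ C := by
      refine le_trans ?_ h1
      refine Finset.card_le_card_of_injOn (fun x => π v x) ?_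
        (fun x _ y _ hxy => by simpa using hxy)
      intro x hx
      simpa using hx
    refine le_trans (Finset.card_le_card (t := (Finset.univ.filter
      fun x => π u (π v x) ≠ π' u (π v x)) ∪ (Finset.univ.filter fun x => π v x ≠ π' v x)) ?_) ?_
    · intro x hx
      simp only [map_mul, Equiv.Perm.mul_apply, Finset.mem_filter, Finset.mem_univ, true_and,
        Finset.mem_union] at hx ⊢
      by_contra hcon
      push Not at hcon
      apply hx
      rw [hcon.1, hcon.2]
    · exact (Finset.card_union_le _ _).trans (by omega)

open Classical in
/-- The permutation of `X₀ ⊕ Y` attached to each generator. -/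
noncomputable def gluePerm {ι X Y : Type}
    (ρ : ι → Equiv.Perm X) (τ : ι → Equiv.Perm Y) (a : ι) (t : X) (y : Y) (i : ι) :
    Equiv.Perm (X ⊕ Y) :=
  if i = a then Equiv.sumCongr (ρ i) (τ i) * Equiv.swap (Sum.inl t) (Sum.inr y)
  else Equiv.sumCongr (ρ i) (τ i)

lemma gluePerm_inl {ι X Y : Type} (ρ : ι → Equiv.Perm X) (τ : ι → Equiv.Perm Y) (a : ι) (t : X)
    (y : Y) (i : ι) (z : X) (h : i = a → z ≠ t) :
    gluePerm ρ τ a t y i (Sum.inl z) = Sum.inl (ρ i z) := by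
  classical
  unfold gluePerm
  split_ifs with hi
  · rw [Equiv.Perm.mul_apply, Equiv.swap_apply_of_ne_of_ne]
    · simp
    · simpa using h hi
    · simp
  · simp

lemma gluePerm_inr {ι X Y : Type} (ρ : ι → Equiv.Perm X) (τ : ι → Equiv.Perm Y) (a : ι) (t : X)
    (y : Y) (i : ι) (z : Y) (h : i = a → z ≠ y) :
    gluePerm ρ τ a t y i (Sum.inr z) = Sum.inr (τ i z) := by
  classical
  unfold gluePerm
  split_ifs with hi
  · rw [Equiv.Perm.mul_apply, Equiv.swap_apply_of_ne_of_ne]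
    · simp
    · simp
    · simpa using h hi
  · simp

lemma gluePerm_exit {ι X Y : Type} (ρ : ι → Equiv.Perm X) (τ : ι → Equiv.Perm Y) (a : ι) (t : X)
    (y : Y) : gluePerm ρ τ a t y a (Sum.inl t) = Sum.inr (τ a y) := by
  simp [gluePerm]

open Classical in
lemma core_aux {ι : Type} (a : ι) (Δ : Subgroup (FreeGroup ι)) (hfg : Δ.FG)
    (hpow : ∀ n : ℕ, 0 < n → FreeGroup.of a ^ n ∉ Δ) (e : FreeGroup ι) (he : e ∉ Δ) :
    ∃ (X : Type) (_ : Fintype X) (ρ : ι → Equiv.Perm X) (t x : X),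
      ∀ (Y : Type) (τ : ι → Equiv.Perm Y) (y : Y),
        (∀ g ∈ Δ, FreeGroup.lift (gluePerm ρ τ a t y) g (Sum.inl x) = Sum.inl x) ∧
        FreeGroup.lift (gluePerm ρ τ a t y) e (Sum.inl x) ≠ Sum.inl x ∧
        ∃ u, FreeGroup.lift (gluePerm ρ τ a t y) u (Sum.inl x) = Sum.inl t := by
  obtain ⟨T, rfl⟩ := hfg
  set Δ := Subgroup.closure (T : Set (FreeGroup ι)) with hΔ
  let α := FreeGroup ι ⧸ Δ
  let x0 : α := ((1 : FreeGroup ι) : α)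
  have hx0 : ∀ g : FreeGroup ι, g • x0 = x0 ↔ g ∈ Δ := by
    intro g
    change ((g * 1 : FreeGroup ι) : α) = ((1 : FreeGroup ι) : α) ↔ _
    rw [mul_one, eq_comm, QuotientGroup.eq]
    simp
  choose P hP using fun w : FreeGroup ι => path_aux (α := α) w x0
  let X0 : Finset α := {x0, e • x0} ∪ (T.biUnion P ∪ P e)
  have hxmem : x0 ∈ X0 := by simp [X0]
  have heX : e • x0 ∈ X0 := by simp [X0]
  have hPX : ∀ w ∈ T, P w ⊆ X0 := by
    intro w hw z hz
    simp only [X0, Finset.mem_union, Finset.mem_biUnion]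
    exact Or.inr (Or.inl ⟨w, hw, hz⟩)
  have hPe : P e ⊆ X0 := by
    intro z hz
    simp only [X0, Finset.mem_union]
    exact Or.inr (Or.inr hz)
  -- the exit point
  have hex : ∃ m : ℕ, FreeGroup.of a ^ m • x0 ∉ X0 := by
    by_contra hcon
    push Not at hcon
    have hinj : Function.Injective (fun m : ℕ => (⟨FreeGroup.of a ^ m • x0, hcon m⟩ : X0)) := by
      have key : ∀ m n : ℕ, m < n → FreeGroup.of a ^ m • x0 ≠ FreeGroup.of a ^ n • x0 := by
        intro m n hmn h
        obtain ⟨k, rfl⟩ := Nat.exists_eq_add_of_lt hmn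
        rw [add_assoc, pow_add, mul_smul] at h
        have h' := smul_left_cancel _ h
        exact hpow (k + 1) (by omega) ((hx0 _).1 h'.symm)
      intro m n h
      simp only [Subtype.mk.injEq] at h
      rcases lt_trichotomy m n with h1 | h1 | h1
      · exact absurd h (key _ _ h1)
      · exact h1
      · exact absurd h.symm (key _ _ h1)
    exact not_injective_infinite_finite _ hinj
  obtain ⟨m, hm1, hm2⟩ : ∃ m : ℕ, (∀ k ≤ m, FreeGroup.of a ^ k • x0 ∈ X0) ∧
      FreeGroup.of a ^ (m + 1) • x0 ∉ X0 := by
    have h0 : Nat.find hex ≠ 0 := by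
      intro h
      have := Nat.find_spec hex
      rw [h] at this
      simp [hxmem] at this
    obtain ⟨m, hm⟩ := Nat.exists_eq_succ_of_ne_zero h0
    refine ⟨m, fun k hk => ?_, ?_⟩
    · have := Nat.find_min hex (m := k) (by omega)
      simpa using this
    · have := Nat.find_spec hex
      rw [hm] at this
      exact this
  let ρ : ι → Equiv.Perm X0 := fun i =>
    Equiv.extendSubtype (p := fun z : X0 => FreeGroup.of i • (z : α) ∈ X0)
      (q := fun z : X0 => (FreeGroup.of i)⁻¹ • (z : α) ∈ X0)
      { toFun := fun z => ⟨⟨FreeGroup.of i • (z.1 : α), z.2⟩, by simp⟩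
        invFun := fun z => ⟨⟨(FreeGroup.of i)⁻¹ • (z.1 : α), z.2⟩, by simp⟩
        left_inv := fun z => by simp
        right_inv := fun z => by simp }
  have hρ : ∀ i (z : α) (hz : z ∈ X0) (hz' : FreeGroup.of i • z ∈ X0),
      ρ i ⟨z, hz⟩ = ⟨FreeGroup.of i • z, hz'⟩ := by
    intro i z hz hz'
    simp only [ρ]
    exact Equiv.extendSubtype_apply_of_mem _ (⟨z, hz⟩ : X0) hz'
  refine ⟨X0, inferInstance, ρ, ⟨FreeGroup.of a ^ m • x0, hm1 m le_rfl⟩, ⟨x0, hxmem⟩, ?_⟩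
  intro Y τ y
  set π := FreeGroup.lift (gluePerm ρ τ a ⟨FreeGroup.of a ^ m • x0, hm1 m le_rfl⟩ y) with hπ
  let j : α → X0 ⊕ Y := fun z => if h : z ∈ X0 then Sum.inl ⟨z, h⟩ else Sum.inl ⟨x0, hxmem⟩
  have hj : ∀ z (hz : z ∈ X0), j z = Sum.inl ⟨z, hz⟩ := fun z hz => by simp [j, hz]
  have hπj : ∀ i, ∀ z ∈ X0, FreeGroup.of i • z ∈ X0 →
      π (FreeGroup.of i) (j z) = j (FreeGroup.of i • z) := by
    intro i z hz hz'
    rw [hj z hz, hj _ hz', hπ, FreeGroup.lift_apply_of]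
    rw [gluePerm_inl, hρ i z hz hz']
    intro hi h
    simp only [Subtype.mk.injEq] at h
    subst hi
    apply hm2
    rw [pow_succ', mul_smul, ← h]
    exact hz'
  refine ⟨?_, ?_, FreeGroup.of a ^ m, ?_⟩
  · have : Δ ≤ (MulAction.stabilizer (Equiv.Perm (X0 ⊕ Y))
        (Sum.inl ⟨x0, hxmem⟩ : X0 ⊕ Y)).comap π := by
      rw [hΔ, Subgroup.closure_le]
      intro g hg
      simp only [Subgroup.coe_comap, Set.mem_preimage, SetLike.mem_coe,
        MulAction.mem_stabilizer_iff, Equiv.Perm.smul_def]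
      rw [← hj, hP g _ π j (fun i z hz hz' => hπj i z (hPX g hg hz) (hPX g hg hz')),
        (hx0 g).2 (Subgroup.subset_closure hg)]
    intro g hg
    have := this hg
    simpa only [Subgroup.mem_comap, MulAction.mem_stabilizer_iff, Equiv.Perm.smul_def] using this
  · rw [← hj, hP e _ π j (fun i z hz hz' => hπj i z (hPe hz) (hPe hz')), hj _ hxmem, hj _ heX]
    intro h
    simp only [Sum.inl.injEq, Subtype.mk.injEq] at h
    exact he ((hx0 e).1 h)
  · have : ∀ k ≤ m, π (FreeGroup.of a ^ k) (j x0) = j (FreeGroup.of a ^ k • x0) := by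
      intro k
      induction k with
      | zero => simp
      | succ k ih =>
        intro hk
        rw [pow_succ', map_mul, Equiv.Perm.mul_apply, ih (by omega),
          hπj a _ (hm1 k (by omega)), mul_smul]
        rw [smul_smul, ← pow_succ']
        exact hm1 _ hk
    have := this m le_rfl
    rw [hj _ hxmem, hj _ (hm1 m le_rfl)] at this
    exact this

/-- LERF. -/
lemma lerf_aux {ι : Type} (a : ι) (Δ : Subgroup (FreeGroup ι)) (hfg : Δ.FG)
    (hpow : ∀ n : ℕ, 0 < n → FreeGroup.of a ^ n ∉ Δ) (e : FreeGroup ι) (he : e ∉ Δ) :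
    ∃ M : Subgroup (FreeGroup ι), M.Normal ∧ M.FiniteIndex ∧ e ∉ Δ ⊔ M := by
  classical
  obtain ⟨X, _, ρ, t, x, h⟩ := core_aux a Δ hfg hpow e he
  obtain ⟨h1, h2, -⟩ := h Unit (fun _ => 1) ()
  set π := FreeGroup.lift (gluePerm ρ (fun _ => (1 : Equiv.Perm Unit)) a t ()) with hπ
  refine ⟨π.ker, inferInstance, Subgroup.finiteIndex_ker π, fun hcon => h2 ?_⟩
  have : Δ ⊔ π.ker ≤ (MulAction.stabilizer (Equiv.Perm (X ⊕ Unit))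
      (Sum.inl x : X ⊕ Unit)).comap π := by
    refine sup_le (fun g hg => ?_) (fun g hg => ?_)
    · simpa only [Subgroup.mem_comap, MulAction.mem_stabilizer_iff, Equiv.Perm.smul_def]
        using h1 g hg
    · rw [MonoidHom.mem_ker] at hg
      simp [Subgroup.mem_comap, hg]
  have := this hcon
  simpa only [Subgroup.mem_comap, MulAction.mem_stabilizer_iff, Equiv.Perm.smul_def] using this

open Classical in
/-- Sparsity of `w` in the conjugates of `Γ`. -/
def Sparse {G : Type} [Group G] (Γ : Subgroup G) (w : G) (N : ℕ) : Prop :=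
  ∃ (I : Type) (_ : Fintype I) (_ : Nonempty I) (q : I → G), ∀ h : G,
    N * (Finset.univ.filter fun i => (q i * h)⁻¹ * w * (q i * h) ∈ Γ).card ≤ Fintype.card I

lemma Sparse.mono {G : Type} [Group G] {Γ Γ' : Subgroup G} (hΓ : Γ ≤ Γ') {w : G} {N : ℕ}
    (h : Sparse Γ' w N) : Sparse Γ w N := by
  classical
  obtain ⟨I, i1, i2, q, hq⟩ := h
  refine ⟨I, i1, i2, q, fun h => le_trans (Nat.mul_le_mul_left _ ?_) (hq h)⟩
  refine Finset.card_le_card (fun i hi => ?_)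
  simp only [Finset.mem_filter, Finset.mem_univ, true_and] at hi ⊢
  exact hΓ hi

lemma big_index_aux {ι : Type} (a : ι) (w : FreeGroup ι) (hw : w ≠ 1) (n : ℕ) :
    ∃ L : Subgroup (FreeGroup ι), L.Normal ∧ L.FiniteIndex ∧ w ∉ L ∧ n ≤ L.index := by
  have hpow1 : ∀ n : ℕ, 0 < n → FreeGroup.of a ^ n ≠ 1 := by
    intro n hn h
    have := congrArg (FreeGroup.lift (fun _ : ι => Multiplicative.ofAdd (1 : ℤ))) h
    rw [map_pow, FreeGroup.lift_apply_of, ← ofAdd_nsmul, MonoidHom.map_one] at this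
    have h3 := congrArg Multiplicative.toAdd this
    simp at h3
    omega
  have hpow : ∀ n : ℕ, 0 < n → FreeGroup.of a ^ n ∉ (⊥ : Subgroup (FreeGroup ι)) := by
    intro n hn h
    exact hpow1 n hn (Subgroup.mem_bot.1 h)
  have hfg : (⊥ : Subgroup (FreeGroup ι)).FG := ⟨∅, by simp⟩
  obtain ⟨L1, i1, j1, h1⟩ := lerf_aux a ⊥ hfg hpow w (by simpa using hw)
  obtain ⟨L2, i2, j2, h2⟩ := lerf_aux a ⊥ hfg hpow (FreeGroup.of a ^ n.factorial)
    (hpow _ n.factorial_pos)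
  rw [bot_sup_eq] at h1 h2
  refine ⟨L1 ⊓ L2, inferInstance, inferInstance, fun h => h1 h.1, ?_⟩
  by_contra hlt
  push Not at hlt
  apply h2
  have hne : (L1 ⊓ L2).index ≠ 0 := Subgroup.FiniteIndex.index_ne_zero
  obtain ⟨c, hc⟩ := Nat.dvd_factorial (Nat.pos_of_ne_zero hne) hlt.le
  rw [hc, pow_mul]
  exact Subgroup.pow_mem _ ((L1 ⊓ L2).pow_index_mem (FreeGroup.of a)).2 c

open Classical in
lemma orbit_count_aux {I Z Y : Type} [Group I] [Fintype I] [MulAction I Z] [Fintype Y]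
    (z0 : Z) (Fx : Finset Z) (f : Y → Z) (hf : Function.Injective f)
    (hr : ∀ y, ∃ p : I, p • z0 = f y) :
    (Finset.univ.filter fun p : I => p • z0 ∈ Fx).card * Fintype.card Y
      ≤ Fintype.card I * Fx.card := by
  choose r hr using hr
  let rt : Z → I := fun z => if h : ∃ p : I, p • z0 = z then h.choose else 1
  have hrt : ∀ p : I, rt (p • z0) • z0 = p • z0 := by
    intro p
    have h : ∃ p' : I, p' • z0 = p • z0 := ⟨p, rfl⟩
    simp only [rt, dif_pos h]
    exact h.choose_spec
  have key : ∀ (p : I) (y : Y), (r y * (rt (p • z0))⁻¹ * p) • z0 = f y := by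
    intro p y
    rw [mul_smul, mul_smul, inv_smul_eq_iff.2 (hrt p).symm, hr]
  rw [← Finset.card_univ (α := Y), ← Finset.card_univ (α := I), ← Finset.card_product,
    ← Finset.card_product]
  refine Finset.card_le_card_of_injOn
    (fun py => (r py.2 * (rt (py.1 • z0))⁻¹ * py.1, py.1 • z0)) ?_ ?_
  · rintro ⟨p, y⟩ hp
    simpa using hp
  · rintro ⟨p, y⟩ _ ⟨p', y'⟩ _ heq
    simp only [Prod.mk.injEq] at heq
    obtain ⟨h1, h2⟩ := heq
    have hy : y = y' := by
      apply hf
      rw [← key p y, ← key p' y', h1]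
    subst hy
    rw [h2] at h1
    simp only [mul_right_inj] at h1
    rw [h1]

set_option maxHeartbeats 2000000 in
open Classical in
lemma sparse_aux {ι : Type} (a : ι) (Δ : Subgroup (FreeGroup ι)) (hfg : Δ.FG)
    (hpow : ∀ n : ℕ, 0 < n → FreeGroup.of a ^ n ∉ Δ) (w : FreeGroup ι) (hw : w ≠ 1) (N : ℕ) :
    ∃ M : Subgroup (FreeGroup ι), M.Normal ∧ M.FiniteIndex ∧ Sparse (Δ ⊔ M) w N := by
  obtain ⟨X, _, ρ, t, x, hcore⟩ := core_aux a Δ hfg hpow (FreeGroup.of a)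
    (by simpa using hpow 1 one_pos)
  obtain ⟨C, hC⟩ := disagree_aux w
  obtain ⟨L, _, _, hwL, hL⟩ := big_index_aux a w hw (N * (Fintype.card X + C))
  let Y := FreeGroup ι ⧸ L
  have : Fintype Y := Subgroup.fintypeQuotientOfFiniteIndex
  let τ : ι → Equiv.Perm Y := fun i => MulAction.toPerm (FreeGroup.of i)
  let y0 : Y := ((1 : FreeGroup ι) : Y)
  obtain ⟨h1, -, u, hu⟩ := hcore Y τ y0
  set π := FreeGroup.lift (gluePerm ρ τ a t y0) with hπ
  let π' : FreeGroup ι →* Equiv.Perm (X ⊕ Y) := (Equiv.Perm.sumCongrHom X Y).comp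
    (MonoidHom.prod (FreeGroup.lift ρ) (MulAction.toPermHom (FreeGroup ι) Y))
  have hπ'r : ∀ g (y : Y), π' g (Sum.inr y) = Sum.inr (g • y) := by
    intro g y
    simp [π']
  have hπ'l : ∀ i (z : X), π' (FreeGroup.of i) (Sum.inl z) = Sum.inl (ρ i z) := by
    intro i z
    simp [π']
  have hdis := hC (X ⊕ Y) π π' (by
    intro i
    refine le_trans (Finset.card_le_card (t := {Sum.inl t, Sum.inr y0}) ?_) Finset.card_le_two
    intro z hz
    simp only [Finset.mem_filter, Finset.mem_univ, true_and] at hz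
    by_contra hcon
    simp only [Finset.mem_insert, Finset.mem_singleton, not_or] at hcon
    apply hz
    rw [hπ, FreeGroup.lift_apply_of]
    rcases z with z | z
    · rw [gluePerm_inl _ _ _ _ _ _ _ (fun _ h => hcon.1 (by rw [h])), hπ'l]
    · rw [gluePerm_inr _ _ _ _ _ _ _ (fun _ h => hcon.2 (by rw [h])), hπ'r]
      rfl)
  -- fixed points
  let Fx : Finset (X ⊕ Y) := Finset.univ.filter fun z => π w z = z
  have hFx : Fx.card ≤ Fintype.card X + C := by
    refine le_trans (Finset.card_le_card (t := (Finset.univ.image Sum.inl) ∪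
      (Finset.univ.filter fun z => π w z ≠ π' w z)) ?_) ?_
    · intro z hz
      simp only [Fx, Finset.mem_filter, Finset.mem_univ, true_and] at hz
      rcases z with z | z
      · simp
      · simp only [Finset.mem_union, Finset.mem_filter, Finset.mem_univ, true_and]
        right
        rw [hz, hπ'r]
        intro h
        have h := Sum.inr_injective h
        revert h
        induction z using QuotientGroup.induction_on with
        | H z =>
        intro h
        have h : ((z : FreeGroup ι) : Y) = ((w * z : FreeGroup ι) : Y) := h
        rw [QuotientGroup.eq] at h
        apply hwL
        have := Subgroup.Normal.conj_mem (H := L) inferInstance _ h z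
        simpa [mul_assoc] using this
    · refine (Finset.card_union_le _ _).trans (Nat.add_le_add ?_ (le_trans (le_of_eq (by congr)) hdis))
      exact Finset.card_image_le
  -- the orbit contains `Y`
  let O : Set Y := {y | ∃ g, π g (Sum.inl x) = Sum.inr y}
  have hay0 : FreeGroup.of a • y0 ∈ O := by
    refine ⟨FreeGroup.of a * u, ?_⟩
    rw [map_mul, Equiv.Perm.mul_apply, hu, hπ, FreeGroup.lift_apply_of, gluePerm_exit]
    rfl
  have hO1 : ∀ (i : ι) (y : Y), y ∈ O → FreeGroup.of i • y ∈ O := by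
    intro i y hy
    obtain ⟨g, hg⟩ := hy
    by_cases hc : i = a ∧ y = y0
    · rw [hc.1, hc.2]; exact hay0
    · refine ⟨FreeGroup.of i * g, ?_⟩
      rw [map_mul, Equiv.Perm.mul_apply, hg, hπ, FreeGroup.lift_apply_of, gluePerm_inr]
      · rfl
      · intro h h'
        exact hc ⟨h, h'⟩
  have hO2 : ∀ g : FreeGroup ι, ∀ y ∈ O, g • y ∈ O := by
    intro g
    induction g using FreeGroup.induction_on with
    | C1 => intro y hy; simpa using hy
    | of i => exact hO1 i
    | inv_of i _ =>
      intro y hy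
      have hsurj : Set.SurjOn (fun y : Y => FreeGroup.of i • y) O O :=
        ((Set.toFinite O).injOn_iff_bijOn_of_mapsTo (fun y hy => hO1 i y hy)).1
          (fun y _ y' _ h => smul_left_cancel _ h) |>.surjOn
      obtain ⟨y', hy', h⟩ := hsurj hy
      simp only at h
      rw [← h, inv_smul_smul]
      exact hy'
    | mul g g' hg hg' =>
      intro y hy
      rw [mul_smul]
      exact hg _ (hg' _ hy)
  have hO : ∀ y, ∃ g, π g (Sum.inl x) = Sum.inr y := by
    intro y
    obtain ⟨g, hg⟩ := MulAction.exists_smul_eq (FreeGroup ι) (FreeGroup.of a • y0) y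
    have := hO2 g _ hay0
    rw [hg] at this
    exact this
  refine ⟨π.ker, inferInstance, Subgroup.finiteIndex_ker π, ?_⟩
  have hstab : ∀ g ∈ Δ ⊔ π.ker, π g (Sum.inl x) = Sum.inl x := by
    have : Δ ⊔ π.ker ≤ (MulAction.stabilizer (Equiv.Perm (X ⊕ Y))
        (Sum.inl x : X ⊕ Y)).comap π := by
      refine sup_le (fun g hg => ?_) (fun g hg => ?_)
      · simpa only [Subgroup.mem_comap, MulAction.mem_stabilizer_iff, Equiv.Perm.smul_def]
          using h1 g hg
      · rw [MonoidHom.mem_ker] at hg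
        simp [Subgroup.mem_comap, hg]
    intro g hg
    have := this hg
    simpa only [Subgroup.mem_comap, MulAction.mem_stabilizer_iff, Equiv.Perm.smul_def] using this
  refine ⟨π.range, inferInstance, inferInstance, fun p => p.2.choose, fun h => ?_⟩
  have hq : ∀ p : π.range, π p.2.choose = p := fun p => p.2.choose_spec
  have hcount := orbit_count_aux (I := π.range) (Z := X ⊕ Y) (Y := Y) (π h (Sum.inl x)) Fx
    Sum.inr Sum.inr_injective (by
      intro y
      obtain ⟨g, hg⟩ := hO y
      refine ⟨⟨π (g * h⁻¹), g * h⁻¹, rfl⟩, ?_⟩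
      change π (g * h⁻¹) (π h (Sum.inl x)) = _
      rw [← Equiv.Perm.mul_apply, ← map_mul, inv_mul_cancel_right, hg])
  have hcardY : Fintype.card Y = L.index := by
    rw [Subgroup.index, Nat.card_eq_fintype_card]
  have hle : (Finset.univ.filter fun p : π.range =>
      (p.2.choose * h)⁻¹ * w * (p.2.choose * h) ∈ Δ ⊔ π.ker).card ≤
      (Finset.univ.filter fun p : π.range => p • (π h (Sum.inl x)) ∈ Fx).card := by
    refine Finset.card_le_card (fun p hp => ?_)
    simp only [Finset.mem_filter, Finset.mem_univ, true_and, Fx] at hp ⊢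
    have := hstab _ hp
    rw [map_mul, map_mul, map_inv, Equiv.Perm.mul_apply, Equiv.Perm.mul_apply,
      Equiv.Perm.inv_eq_iff_eq, map_mul, hq, Equiv.Perm.mul_apply] at this
    exact this
  have hK : 0 < Fintype.card X + C :=
    Nat.add_pos_left (Fintype.card_pos_iff.2 ⟨x⟩) _
  refine Nat.le_of_mul_le_mul_right ?_ hK
  rw [hcardY] at hcount
  calc _ = (Finset.univ.filter fun p : π.range =>
      (p.2.choose * h)⁻¹ * w * (p.2.choose * h) ∈ Δ ⊔ π.ker).card
        * (N * (Fintype.card X + C)) := by ring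
    _ ≤ _ := Nat.mul_le_mul hle hL
    _ ≤ _ := by convert hcount
    _ ≤ _ := Nat.mul_le_mul_left _ hFx

lemma mem_map_conj_aux {G : Type*} [Group G] (g e : G) (H : Subgroup G) :
    e ∈ Subgroup.map (MulAut.conj g).toMonoidHom H ↔ g⁻¹ * e * g ∈ H := by
  rw [Subgroup.mem_map]
  constructor
  · rintro ⟨x, hx, rfl⟩
    simpa [mul_assoc] using hx
  · intro h
    exact ⟨_, h, by simp [mul_assoc]⟩

lemma Sparse.mono_right {G : Type} [Group G] {Γ : Subgroup G} {w : G} {N N' : ℕ} (hN : N ≤ N')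
    (h : Sparse Γ w N') : Sparse Γ w N := by
  obtain ⟨I, i1, i2, q, hq⟩ := h
  exact ⟨I, i1, i2, q, fun h => le_trans (Nat.mul_le_mul_right _ hN) (hq h)⟩

lemma continuous_mem_aux {G : Type} [Group G] (w : G) :
    Continuous (fun (H : Subgroup G) => @decide (w ∈ H) (Classical.propDecidable _)) := by
  have h1 : Continuous (fun (H : Subgroup G) (g : G) =>
      @decide (g ∈ H) (Classical.propDecidable _)) := continuous_induced_dom
  exact (continuous_apply w).comp h1

lemma isClopen_mem_aux {G : Type} [Group G] (w : G) : IsClopen {H : Subgroup G | w ∈ H} := by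
  classical
  have hc := continuous_mem_aux w
  have := (isClopen_discrete ({true} : Set Bool)).preimage hc
  convert this using 1
  ext H
  simp

open MeasureTheory in
open Classical in
lemma irs_aux {G : Type} [Group G] [Countable G] (Δ : Subgroup G)
    (hS : ∀ w : G, w ≠ 1 → ∀ N, Sparse Δ w N) (μ : Measure (Subgroup G))
    (hμ : IsProbabilityMeasure μ)
    (hinv : ∀ (g : G) (s : Set (Subgroup G)), MeasurableSet s →
          μ ((fun H => Subgroup.map (MulAut.conj g).toMonoidHom H) ⁻¹' s) = μ s)
    (hcl : μ (closure {H : Subgroup G |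
            ∃ g : G, H = Subgroup.map (MulAut.conj g).toMonoidHom Δ}) = 1) :
    μ = Measure.dirac (⊥ : Subgroup G) := by
  have : BorelSpace (Subgroup G) := ⟨rfl⟩
  have hmeas : ∀ w : G, MeasurableSet {H : Subgroup G | w ∈ H} :=
    fun w => (isClopen_mem_aux w).isOpen.measurableSet
  have hae := (prob_compl_eq_zero_iff isClosed_closure.measurableSet).2 hcl
  have hzero : ∀ w : G, w ≠ 1 → μ {H : Subgroup G | w ∈ H} = 0 := by
    intro w hw
    have hN : ∀ N : ℕ, (N : ENNReal) * μ {H : Subgroup G | w ∈ H} ≤ 1 := by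
      intro N
      obtain ⟨I, _, _, q, hq⟩ := hS w hw N
      let Cs : Set (Subgroup G) := {H | N * (Finset.univ.filter
        fun i => (q i)⁻¹ * w * q i ∈ H).card ≤ Fintype.card I}
      have hCs : IsClosed Cs := by
        have hc : Continuous (fun (H : Subgroup G) (i : I) =>
            @decide ((q i)⁻¹ * w * q i ∈ H) (Classical.propDecidable _)) :=
          continuous_pi fun i => continuous_mem_aux _
        have := (isClosed_discrete {f : I → Bool | N * (Finset.univ.filter
          fun i => f i = true).card ≤ Fintype.card I}).preimage hc
        convert this using 1
        ext H
        simp [Cs]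
      have hsub : closure {H : Subgroup G |
            ∃ g : G, H = Subgroup.map (MulAut.conj g).toMonoidHom Δ} ⊆ Cs := by
        refine closure_minimal ?_ hCs
        rintro H ⟨h, rfl⟩
        have := hq h
        refine le_trans (Nat.mul_le_mul_left _ (Finset.card_le_card fun i hi => ?_)) this
        simp only [Finset.mem_filter, Finset.mem_univ, true_and] at hi ⊢
        rw [mem_map_conj_aux] at hi
        simpa [mul_assoc] using hi
      have haeC : ∀ᵐ H ∂μ, H ∈ Cs := by
        refine measure_mono_null ?_ hae
        exact Set.compl_subset_compl.2 hsub
      have hU : ∀ i, μ {H : Subgroup G | (q i)⁻¹ * w * q i ∈ H} = μ {H : Subgroup G | w ∈ H} := by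
        intro i
        rw [← hinv (q i) _ (hmeas w)]
        congr 1
        ext H
        exact (mem_map_conj_aux _ _ _).symm
      have hint : ∫⁻ H, (N : ENNReal) * ∑ i, Set.indicator
          {H : Subgroup G | (q i)⁻¹ * w * q i ∈ H} (fun _ => (1 : ENNReal)) H ∂μ
          ≤ ∫⁻ _, (Fintype.card I : ENNReal) ∂μ := by
        refine lintegral_mono_ae ?_
        filter_upwards [haeC] with H hH
        have : ∑ i, Set.indicator {H : Subgroup G | (q i)⁻¹ * w * q i ∈ H}
            (fun _ => (1 : ENNReal)) H =
            ((Finset.univ.filter fun i => (q i)⁻¹ * w * q i ∈ H).card : ENNReal) := by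
          simp [Set.indicator_apply]
        rw [this]
        have hH' : N * (Finset.univ.filter
          fun i => (q i)⁻¹ * w * q i ∈ H).card ≤ Fintype.card I := hH
        exact_mod_cast hH'
      rw [lintegral_const_mul, lintegral_finsetSum] at hint
      · simp only [lintegral_indicator_const (hmeas _), hU, one_mul, Finset.sum_const,
          Finset.card_univ, nsmul_eq_mul, lintegral_const, measure_univ, mul_one] at hint
        have hc0 : (Fintype.card I : ENNReal) ≠ 0 := by
          exact_mod_cast Fintype.card_ne_zero
        rw [← ENNReal.mul_le_mul_iff_right hc0 (ENNReal.natCast_ne_top _)]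
        rw [mul_one]
        refine le_trans (le_of_eq ?_) hint
        ring
      · intro i _
        exact measurable_const.indicator (hmeas _)
      · refine Finset.measurable_sum _ fun i _ => ?_
        exact measurable_const.indicator (hmeas _)
    by_contra hne
    obtain ⟨n, hn⟩ := ENNReal.exists_nat_mul_gt hne (ENNReal.one_ne_top)
    exact absurd (hN n) (not_le.2 hn)
  have hbot : ∀ᵐ H ∂μ, H = (⊥ : Subgroup G) := by
    have : ∀ᵐ H ∂μ, ∀ w : G, w ≠ 1 → w ∉ H := by
      rw [ae_all_iff]
      intro w
      by_cases hw : w = 1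
      · simp [hw]
      · have := hzero w hw
        rw [measure_eq_zero_iff_ae_notMem] at this
        filter_upwards [this] with H hH _
        exact hH
    filter_upwards [this] with H hH
    rw [Subgroup.eq_bot_iff_forall]
    intro w hw
    by_contra hne
    exact hH w hne hw
  ext s hs
  rw [Measure.dirac_apply' _ hs]
  by_cases hb : (⊥ : Subgroup G) ∈ s
  · rw [Set.indicator_of_mem hb, Pi.one_apply]
    rw [← prob_compl_eq_zero_iff hs, measure_eq_zero_iff_ae_notMem]
    filter_upwards [hbot] with H hH
    simp [hH, hb]
  · rw [Set.indicator_of_notMem hb, measure_eq_zero_iff_ae_notMem]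
    filter_upwards [hbot] with H hH
    rw [hH]
    exact hb

lemma choose_M_aux {ι : Type} (a : ι) (Δ M' : Subgroup (FreeGroup ι)) (hfg : Δ.FG)
    (hpow : ∀ n : ℕ, 0 < n → FreeGroup.of a ^ n ∉ Δ) (hM1 : M'.Normal) (hM2 : M'.FiniteIndex)
    (e : ℕ → FreeGroup ι) (k : ℕ) :
    ∃ M : Subgroup (FreeGroup ι), M.Normal ∧ M.FiniteIndex ∧ M ≤ M' ∧
      (∀ i ≤ k, e i ∉ Δ → e i ∉ Δ ⊔ M) ∧ (∀ i ≤ k, e i ≠ 1 → Sparse (Δ ⊔ M) (e i) k) := by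
  have h1 : ∀ i, ∃ M : Subgroup (FreeGroup ι), M.Normal ∧ M.FiniteIndex ∧
      (e i ∉ Δ → e i ∉ Δ ⊔ M) := by
    intro i
    by_cases h : e i ∈ Δ
    · exact ⟨⊤, inferInstance, inferInstance, fun h' => absurd h h'⟩
    · obtain ⟨M, a1, a2, a3⟩ := lerf_aux a Δ hfg hpow (e i) h
      exact ⟨M, a1, a2, fun _ => a3⟩
  have h2 : ∀ i, ∃ M : Subgroup (FreeGroup ι), M.Normal ∧ M.FiniteIndex ∧
      (e i ≠ 1 → Sparse (Δ ⊔ M) (e i) k) := by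
    intro i
    by_cases h : e i = 1
    · exact ⟨⊤, inferInstance, inferInstance, fun h' => absurd h h'⟩
    · obtain ⟨M, a1, a2, a3⟩ := sparse_aux a Δ hfg hpow (e i) h k
      exact ⟨M, a1, a2, fun _ => a3⟩
  choose A hA1 hA2 hA3 using h1
  choose B hB1 hB2 hB3 using h2
  have hn1 : (⨅ i : Fin (k + 1), A i).Normal := Subgroup.normal_iInf_normal fun i => hA1 i
  have hn2 : (⨅ i : Fin (k + 1), B i).Normal := Subgroup.normal_iInf_normal fun i => hB1 i
  have hf1 : (⨅ i : Fin (k + 1), A i).FiniteIndex := Subgroup.finiteIndex_iInf fun i => hA2 i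
  have hf2 : (⨅ i : Fin (k + 1), B i).FiniteIndex := Subgroup.finiteIndex_iInf fun i => hB2 i
  refine ⟨M' ⊓ ((⨅ i : Fin (k + 1), A i) ⊓ (⨅ i : Fin (k + 1), B i)), inferInstance,
    inferInstance, inf_le_left, fun i hi h hcon => hA3 i h ?_, fun i hi h => ?_⟩
  · refine sup_le_sup_left ?_ Δ hcon
    exact inf_le_right.trans (inf_le_left.trans
      (iInf_le (fun i : Fin (k + 1) => A i) ⟨i, by omega⟩))
  · refine (hB3 i h).mono (sup_le_sup_left ?_ Δ)
    exact inf_le_right.trans (inf_le_right.trans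
      (iInf_le (fun i : Fin (k + 1) => B i) ⟨i, by omega⟩))

lemma fg_map_aux {G : Type} [Group G] (f : G →* G) (H : Subgroup G) (h : H.FG) :
    (H.map f).FG := by
  classical
  obtain ⟨T, rfl⟩ := h
  exact ⟨T.image f, by rw [Finset.coe_image, MonoidHom.map_closure]⟩

lemma chain_aux {ι : Type} (a b : ι) (hab : a ≠ b) (e g : ℕ → FreeGroup ι) :
    ∃ D M : ℕ → Subgroup (FreeGroup ι), FreeGroup.of b ∈ D 0 ∧
      (∀ k, (M k).Normal) ∧ (∀ k, (M k).FiniteIndex) ∧ (∀ k, M (k + 1) ≤ M k) ∧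
      (∀ k, ∀ i ≤ k, e i ∉ D k → e i ∉ D k ⊔ M k) ∧
      (∀ k, ∀ i ≤ k, e i ≠ 1 → Sparse (D k ⊔ M k) (e i) k) ∧
      (∀ k, D (k + 1) = D k ⊔
        (D k).map (MulAut.conj (g k ^ ((M k).index * (k + 1)))⁻¹).toMonoidHom) := by
  classical
  let σ : FreeGroup ι →* Multiplicative ℤ :=
    FreeGroup.lift (fun i => if i = a then Multiplicative.ofAdd 1 else 1)
  have hσ : ∀ n : ℕ, 0 < n → FreeGroup.of a ^ n ∉ σ.ker := by
    intro n hn h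
    rw [MonoidHom.mem_ker, map_pow, FreeGroup.lift_apply_of, if_pos rfl, ← ofAdd_nsmul] at h
    have h3 := congrArg Multiplicative.toAdd h
    simp at h3
    omega
  let S := {p : Subgroup (FreeGroup ι) × Subgroup (FreeGroup ι) //
    p.1.FG ∧ p.1 ≤ σ.ker ∧ p.2.Normal ∧ p.2.FiniteIndex}
  have step : ∀ (k : ℕ) (s : S), ∃ s' : S, s'.1.2 ≤ s.1.2 ∧
      (∀ i ≤ k, e i ∉ s.1.1 → e i ∉ s.1.1 ⊔ s'.1.2) ∧
      (∀ i ≤ k, e i ≠ 1 → Sparse (s.1.1 ⊔ s'.1.2) (e i) k) ∧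
      s'.1.1 = s.1.1 ⊔ s.1.1.map
        (MulAut.conj (g k ^ (s'.1.2.index * (k + 1)))⁻¹).toMonoidHom := by
    rintro k ⟨⟨Δ, M'⟩, h1, h2, h3, h4⟩
    obtain ⟨M, m1, m2, m3, m4, m5⟩ := choose_M_aux a Δ M' h1
      (fun n hn h => hσ n hn (h2 h)) h3 h4 e k
    refine ⟨⟨⟨Δ ⊔ Δ.map (MulAut.conj (g k ^ (M.index * (k + 1)))⁻¹).toMonoidHom, M⟩,
      h1.sup (fg_map_aux _ _ h1), sup_le h2 ?_, m1, m2⟩, m3, m4, m5, rfl⟩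
    intro x hx
    rw [mem_map_conj_aux] at hx
    have := Subgroup.Normal.conj_mem (H := σ.ker) inferInstance _ (h2 hx)
      (g k ^ (M.index * (k + 1)))⁻¹
    simpa [mul_assoc] using this
  choose f hf1 hf2 hf3 hf4 using step
  let s0 : S := ⟨⟨Subgroup.closure {FreeGroup.of b}, ⊤⟩, ⟨{FreeGroup.of b}, by simp⟩, by
    rw [Subgroup.closure_le]
    simp only [Set.singleton_subset_iff, SetLike.mem_coe, MonoidHom.mem_ker]
    rw [FreeGroup.lift_apply_of, if_neg hab.symm], inferInstance, inferInstance⟩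
  let s : ℕ → S := fun n => Nat.rec s0 (fun k s => f k s) n
  have hs : ∀ k, s (k + 1) = f k (s k) := fun k => rfl
  refine ⟨fun k => (s k).1.1, fun k => (s (k + 1)).1.2, ?_, fun k => (s (k + 1)).2.2.2.1,
    fun k => (s (k + 1)).2.2.2.2, fun k => hf1 _ _, fun k => hf2 _ _, fun k => hf3 _ _,
    fun k => hf4 _ _⟩
  exact Subgroup.subset_closure rfl

lemma main_aux {ι : Type} [Countable ι] (a b : ι) (hab : a ≠ b) :
    ∃ Δ : Subgroup (FreeGroup ι), Δ ≠ ⊥ ∧ IsBoomerang Δ ∧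
      ∀ w : FreeGroup ι, w ≠ 1 → ∀ N, Sparse Δ w N := by
  classical
  have : Countable (FreeGroup ι) := FreeGroup.toWord_injective.countable
  obtain ⟨e, he⟩ := exists_surjective_nat (FreeGroup ι)
  obtain ⟨D, M, h0, hMn, hMf, hMm, hE, hSp, hD⟩ :=
    chain_aux a b hab e (fun k => e (Nat.unpair k).1)
  set g : ℕ → FreeGroup ι := fun k => e (Nat.unpair k).1 with hg
  have hDmono : Monotone D := monotone_nat_of_le_succ fun k => by
    rw [hD]; exact le_sup_left
  have hManti : Antitone M := antitone_nat_of_succ_le hMm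
  have hgM : ∀ k, g k ^ ((M k).index * (k + 1)) ∈ M k := by
    intro k
    have := hMn k
    rw [pow_mul]
    exact Subgroup.pow_mem _ ((M k).pow_index_mem (g k)) _
  have hDM : ∀ k j, k ≤ j → D j ≤ D k ⊔ M k := by
    intro k j hkj
    induction j, hkj using Nat.le_induction with
    | base => exact le_sup_left
    | succ j hkj ih =>
      rw [hD]
      refine sup_le ih ?_
      intro x hx
      rw [mem_map_conj_aux] at hx
      have h1 : g j ^ ((M j).index * (j + 1)) ∈ D k ⊔ M k :=
        (hManti hkj).trans le_sup_right (hgM j)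
      have h2 := ih hx
      change (g j ^ _)⁻¹⁻¹ * x * (g j ^ _)⁻¹ ∈ _ at h2
      rw [inv_inv] at h2
      have := mul_mem (mul_mem (inv_mem h1) h2) h1
      simpa [mul_assoc] using this
  let Δ : Subgroup (FreeGroup ι) := ⨆ k, D k
  have hmem : ∀ x, x ∈ Δ ↔ ∃ k, x ∈ D k := fun x =>
    Subgroup.mem_iSup_of_directed hDmono.directed_le
  have hΔM : ∀ k, Δ ≤ D k ⊔ M k := by
    intro k
    refine iSup_le fun j => ?_
    rcases le_total k j with h | h
    · exact hDM k j h
    · exact (hDmono h).trans le_sup_left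
  refine ⟨Δ, ?_, ?_, ?_⟩
  · intro h
    have : FreeGroup.of b ∈ Δ := (hmem _).2 ⟨0, h0⟩
    rw [h, Subgroup.mem_bot] at this
    exact FreeGroup.of_ne_one b this
  · intro x
    obtain ⟨m, rfl⟩ := he x
    have hmono : StrictMono (fun k => (M k).index * (k + 1)) := by
      refine strictMono_nat_of_lt_succ fun k => ?_
      have h1 : (M k).index ≤ (M (k + 1)).index := by
        have := hMf (k + 1)
        exact Subgroup.index_antitone (hMm k)
      have h2 : 0 < (M (k + 1)).index :=
        Nat.pos_of_ne_zero (hMf (k + 1)).index_ne_zero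
      nlinarith
    have hpair : StrictMono (fun j => Nat.pair m j) := fun i j hij => Nat.pair_lt_pair_right m hij
    have hgm : ∀ j, g (Nat.pair m j) = e m := fun j => by simp [hg]
    refine ⟨fun j => (M (Nat.pair m j)).index * (Nat.pair m j + 1), hmono.comp hpair, ?_⟩
    intro x
    obtain ⟨i, rfl⟩ := he x
    by_cases hx : e i ∈ Δ
    · obtain ⟨k, hk⟩ := (hmem _).1 hx
      filter_upwards [eventually_ge_atTop k] with j hj
      simp only [hx, iff_true]
      rw [mem_map_conj_aux, hmem]
      refine ⟨Nat.pair m j + 1, ?_⟩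
      rw [hD]
      apply Subgroup.mem_sup_right
      rw [mem_map_conj_aux]
      change (g (Nat.pair m j) ^ _)⁻¹⁻¹ * _ * (g (Nat.pair m j) ^ _)⁻¹ ∈ _
      rw [hgm]
      have : e i ∈ D (Nat.pair m j) := hDmono (hj.trans (hpair.id_le j)) hk
      simpa [mul_assoc] using this
    · filter_upwards [eventually_ge_atTop i] with j hj
      simp only [hx, iff_false]
      rw [mem_map_conj_aux]
      intro hcon
      have h1 := hΔM (Nat.pair m j) hcon
      have h2 : g (Nat.pair m j) ^ ((M (Nat.pair m j)).index * (Nat.pair m j + 1)) ∈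
          D (Nat.pair m j) ⊔ M (Nat.pair m j) := Subgroup.mem_sup_right (hgM _)
      rw [hgm] at h2
      have h3 := mul_mem (mul_mem h2 h1) (inv_mem h2)
      refine hE (Nat.pair m j) i (hj.trans (hpair.id_le j)) ?_ ?_
      · intro h
        exact hx ((hmem _).2 ⟨_, h⟩)
      · simpa [mul_assoc] using h3
  · intro w hw N
    obtain ⟨i, rfl⟩ := he w
    have := hSp (max i N) i (le_max_left _ _) hw
    exact (this.mono (hΔM _)).mono_right (le_max_right _ _)

theorem exists_boomerang_only_irs_dirac (d : ℕ) (hd : 2 ≤ d) :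
    ∃ Δ : Subgroup (FreeGroup (Fin d)), Δ ≠ ⊥ ∧ IsBoomerang Δ ∧
      ∀ μ : MeasureTheory.Measure (Subgroup (FreeGroup (Fin d))),
        MeasureTheory.IsProbabilityMeasure μ →
        (∀ (g : FreeGroup (Fin d)) (s : Set (Subgroup (FreeGroup (Fin d)))),
          MeasurableSet s →
          μ ((fun H => Subgroup.map (MulAut.conj g).toMonoidHom H) ⁻¹' s) = μ s) →
        μ (closure {H : Subgroup (FreeGroup (Fin d)) |
            ∃ g : FreeGroup (Fin d), H = Subgroup.map (MulAut.conj g).toMonoidHom Δ}) = 1 →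
        μ = MeasureTheory.Measure.dirac (⊥ : Subgroup (FreeGroup (Fin d))) := by
  obtain ⟨Δ, h1, h2, h3⟩ := main_aux (⟨0, by omega⟩ : Fin d) ⟨1, by omega⟩ (by simp)
  have : Countable (FreeGroup (Fin d)) := FreeGroup.toWord_injective.countable
  exact ⟨Δ, h1, h2, fun μ hμ hinv hcl => irs_aux Δ h3 μ hμ hinv hcl⟩
end

section
/- Let d ≥ 2 and let Γ be a finitely generated subgroup of F_d that is not cyclic (not generated by a single element). Then there exists a constant K ≥ 1 such that for every R ∈ ℕ: (1/K)·exp(δ(Γ)·R) ≤ c_Γ(R) ≤ K·exp(δ(Γ)·R). -/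
open Filter

namespace CoornaertAux

open FreeGroup

variable {α : Type} [DecidableEq α]

/-- The inverse letter. -/
def bar (a : α × Bool) : α × Bool := (a.1, !a.2)

theorem rel_iff (a b : α × Bool) : (a.1 = b.1 → a.2 = b.2) ↔ b ≠ bar a := by
  rcases a with ⟨a, s⟩
  rcases b with ⟨b, t⟩
  simp only [bar, ne_eq, Prod.mk.injEq, not_and]
  cases s <;> cases t <;> simp [eq_comm]

theorem bar_bar (a : α × Bool) : bar (bar a) = a := by simp [bar]

theorem head_invRev (L : List (α × Bool)) : (invRev L).head? = L.getLast?.map bar := by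
  simp [invRev, List.head?_reverse]
  rfl

theorem last_invRev (L : List (α × Bool)) : (invRev L).getLast? = L.head?.map bar := by
  simp [invRev, List.getLast?_reverse]
  rfl

theorem reduced_append {L M : List (α × Bool)} :
    IsReduced (L ++ M) ↔ IsReduced L ∧ IsReduced M ∧
      ∀ x ∈ L.getLast?, ∀ y ∈ M.head?, y ≠ bar x := by
  unfold FreeGroup.IsReduced
  rw [List.isChain_append]
  simp only [rel_iff]

theorem reduced_invRev {L : List (α × Bool)} (h : IsReduced L) : IsReduced (invRev L) := by
  rw [isReduced_iff_reduce_eq] at *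
  rw [reduce_invRev, h]

theorem lcp (L M : List (α × Bool)) : ∃ z a b, L = z ++ a ∧ M = z ++ b ∧
    ∀ x ∈ a.head?, ∀ y ∈ b.head?, x ≠ y := by
  induction L generalizing M with
  | nil => exact ⟨[], [], M, by simp⟩
  | cons l L ih =>
    cases M with
    | nil => exact ⟨[], l :: L, [], by simp⟩
    | cons m M =>
      by_cases h : l = m
      · obtain ⟨z, a, b, h1, h2, h3⟩ := ih M
        exact ⟨l :: z, a, b, by simp [h1], by simp [h, h2], h3⟩
      · exact ⟨[], l :: L, m :: M, by simp, by simp, by simpa using h⟩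

theorem toWord_of_reduced {L : List (α × Bool)} (h : IsReduced L) : (mk L).toWord = L := by
  rw [toWord_mk, h.reduce_eq]

theorem toWord_mul_of_reduced {g h : FreeGroup α} (H : IsReduced (g.toWord ++ h.toWord)) :
    (g * h).toWord = g.toWord ++ h.toWord := by
  rw [toWord_mul, H.reduce_eq]

theorem diverge {u v : FreeGroup α} {z a b : List (α × Bool)} (hu : u.toWord = z ++ a)
    (hv : v.toWord = z ++ b) (hne : ∀ x ∈ a.head?, ∀ y ∈ b.head?, x ≠ y) :
    (u⁻¹ * v).toWord = invRev a ++ b := by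
  have h1 : u⁻¹ * v = mk (invRev a ++ b) := by
    have hu' : u = mk z * mk a := by rw [mul_mk, ← hu, mk_toWord]
    have hv' : v = mk z * mk b := by rw [mul_mk, ← hv, mk_toWord]
    rw [hu', hv', ← mul_mk, ← inv_mk]
    group
  rw [h1, toWord_of_reduced]
  have ra : IsReduced (z ++ a) := hu ▸ isReduced_toWord
  have rb : IsReduced (z ++ b) := hv ▸ isReduced_toWord
  rw [reduced_append] at ra rb ⊢
  refine ⟨reduced_invRev ra.2.1, rb.2.1, ?_⟩
  intro x hx y hy hxy
  rw [last_invRev] at hx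
  simp only [Option.mem_def, Option.map_eq_some_iff] at hx
  obtain ⟨w, hw, rfl⟩ := hx
  rw [bar_bar] at hxy
  exact hne w hw y hy hxy.symm

theorem cancel (g h : FreeGroup α) : ∃ a e b, g.toWord = a ++ e ∧ h.toWord = invRev e ++ b ∧
    (g * h).toWord = a ++ b := by
  obtain ⟨z, a, b, h1, h2, h3⟩ := lcp g⁻¹.toWord h.toWord
  refine ⟨invRev a, invRev z, b, ?_, ?_, ?_⟩
  · rw [toWord_inv] at h1
    rw [← invRev_append, ← h1, invRev_invRev]
  · rw [invRev_invRev, h2]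
  · have := diverge h1 h2 h3
    rwa [inv_inv] at this

theorem toWord_pow_cyc {c : FreeGroup α} (hP : IsCyclicallyReduced c.toWord) (k : ℕ) :
    (c ^ k).toWord = (List.replicate k c.toWord).flatten := by
  rw [toWord_pow, (hP.flatten_replicate k).isReduced.reduce_eq]

theorem key (c h : FreeGroup α) (hP : IsCyclicallyReduced c.toWord) (hc : c ≠ 1)
    (hcomm : ¬ Commute h c) : ∃ k m : ℕ,
      ((c ^ k)⁻¹ * (h * c ^ m)).toWord.head? = c.toWord.getLast?.map bar ∧
      ((c ^ k)⁻¹ * (h * c ^ m)).toWord.getLast? = c.toWord.getLast? := by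
  have hPn : c.toWord ≠ [] := by simpa [toWord_eq_nil_iff] using hc
  set P := c.toWord with hPdef
  have hPpos : 0 < P.length := List.length_pos_iff.2 hPn
  let m := Function.argmin (fun m : ℕ => (h * c ^ m).toWord.length)
  have hm : ∀ j : ℕ, (h * c ^ m).toWord.length ≤ (h * c ^ j).toWord.length := fun j =>
    Function.argmin_le (fun m : ℕ => (h * c ^ m).toWord.length) j
  obtain ⟨a, e, b, h1, h2, h3⟩ := cancel (h * c ^ m) c
  have hb : b ≠ [] := by
    rintro rfl
    have h4 := hm (m + 1)
    rw [pow_succ, ← mul_assoc, h3, h1] at h4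
    have h5 := congrArg List.length h2
    rw [← hPdef] at h5
    simp only [List.length_append, List.length_nil, invRev_length] at h4 h5
    omega
  set r := h * c ^ m * c with hr
  have hrl : r.toWord.getLast? = P.getLast? := by
    rw [h3, hPdef, h2, List.getLast?_append_of_ne_nil _ hb, List.getLast?_append_of_ne_nil _ hb]
  have hrc : (r * c).toWord = r.toWord ++ P := by
    apply toWord_mul_of_reduced
    rw [reduced_append]
    refine ⟨isReduced_toWord, isReduced_toWord, ?_⟩
    rw [hrl]
    intro x hx y hy
    exact (rel_iff x y).1 (hP.2 x hx y hy)
  set k := r.toWord.length + 2 with hk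
  have hck := toWord_pow_cyc hP k
  rw [← hPdef] at hck
  have hckl : (c ^ k).toWord.length = k * P.length := by rw [hck]; simp
  obtain ⟨z, a2, b2, g1, g2, g3⟩ := lcp (c ^ k).toWord (r * c).toWord
  have hlz : z.length ≤ r.toWord.length + P.length := by
    have := congrArg List.length g2
    rw [hrc] at this
    simp at this
    omega
  have ha2 : a2 ≠ [] := by
    rintro rfl
    have := congrArg List.length g1
    rw [hckl] at this
    simp at this
    nlinarith
  have hb2 : b2 ≠ [] := by
    rintro rfl
    apply hcomm
    have e1 : r.toWord ++ P <+: (List.replicate k P).flatten := by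
      rw [← hck, g1, ← hrc, g2]; simp
    have e2 : r.toWord <+: (List.replicate k P).flatten := (List.prefix_append _ _).trans e1
    have e3 : P ++ r.toWord <+: (List.replicate (k + 1) P).flatten := by
      rw [List.replicate_succ, List.flatten_cons]
      exact (List.prefix_append_right_inj P).2 e2
    have e4 : r.toWord ++ P <+: (List.replicate (k + 1) P).flatten := by
      rw [List.replicate_succ', List.flatten_concat]
      exact e1.trans (List.prefix_append _ _)
    have e5 : r.toWord ++ P = P ++ r.toWord :=
      (List.prefix_of_prefix_length_le e4 e3 (by simp; omega)).eq_of_length (by simp; omega)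
    have e6 : r * c = c * r := by
      have := congrArg mk e5
      rwa [← mul_mk, ← mul_mk, mk_toWord, hPdef, mk_toWord] at this
    have e7 : r = h * c ^ (m + 1) := by rw [hr, pow_succ, mul_assoc]
    have e8 : Commute r c := e6
    have e9 : h = r * (c ^ (m + 1))⁻¹ := by rw [e7]; group
    rw [e9]
    exact e8.mul_left ((Commute.refl c).pow_left (m + 1)).inv_left
  refine ⟨k, m + 2, ?_⟩
  have e0 : h * c ^ (m + 2) = r * c := by rw [hr, pow_add]; simp only [pow_two, mul_assoc]
  rw [e0, diverge g1 g2 g3]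
  constructor
  · rw [List.head?_append_of_ne_nil _ (by
      intro hh
      apply ha2
      have := congrArg List.length hh
      rw [invRev_length] at this
      exact List.length_eq_zero_iff.1 this), head_invRev]
    congr 1
    rw [← List.getLast?_append_of_ne_nil z ha2, ← g1, hck]
    exact List.getLast?_flatten_replicate (n := k) (by omega) P
  · rw [List.getLast?_append_of_ne_nil _ hb2, ← List.getLast?_append_of_ne_nil z hb2, ← g2, hrc,
      List.getLast?_append_of_ne_nil _ hPn]

theorem cyc_inv {L : List (α × Bool)} (h : IsCyclicallyReduced L) :
    IsCyclicallyReduced (invRev L) := by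
  refine ⟨reduced_invRev h.1, ?_⟩
  rw [last_invRev, head_invRev]
  intro a ha b hb
  simp only [Option.mem_def, Option.map_eq_some_iff] at ha hb
  obtain ⟨x, hx, rfl⟩ := ha
  obtain ⟨y, hy, rfl⟩ := hb
  have := h.2 y hy x hx
  simp only [bar]
  grind

theorem fillers (Γ : Subgroup (FreeGroup α)) (s t : FreeGroup α) (hs : s ∈ Γ) (ht : t ∈ Γ)
    (hst : ¬ Commute t s) : ∃ p : FreeGroup α, ∀ u v : α × Bool, ∃ f : FreeGroup α,
      p * f * p⁻¹ ∈ Γ ∧ f ≠ 1 ∧ f.toWord.head? ≠ some u ∧ f.toWord.getLast? ≠ some v := by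
  set L := s.toWord with hL
  have hcyc := reduceCyclically.isCyclicallyReduced (L := L) isReduced_toWord
  have hconj := reduceCyclically.conj_conjugator_reduceCyclically L
  set P := reduceCyclically L with hP
  set p := mk (reduceCyclically.conjugator L) with hp
  set c := mk P with hc
  have hcw : c.toWord = P := toWord_of_reduced hcyc.1
  have hsc : p * c * p⁻¹ = s := by
    rw [hp, hc, inv_mk, mul_mk, mul_mk, hconj, mk_toWord]
  set h := p⁻¹ * t * p with hh
  have hth : p * h * p⁻¹ = t := by rw [hh]; group
  have hcomm : ¬ Commute h c := by
    intro hx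
    apply hst
    rw [← hsc, ← hth]
    have := hx.eq
    show (p * h * p⁻¹) * (p * c * p⁻¹) = (p * c * p⁻¹) * (p * h * p⁻¹)
    calc _ = p * (h * c) * p⁻¹ := by group
      _ = p * (c * h) * p⁻¹ := by rw [this]
      _ = _ := by group
  have hc1 : c ≠ 1 := by
    rintro h1
    exact hcomm (h1 ▸ Commute.one_right h)
  have hPn : P ≠ [] := by
    rw [← hcw]; simpa [toWord_eq_nil_iff] using hc1
  obtain ⟨x, hx⟩ : ∃ x, P.head? = some x := ⟨_, List.head?_eq_some_head hPn⟩
  obtain ⟨y, hy⟩ : ∃ y, P.getLast? = some y := ⟨_, List.getLast?_eq_some_getLast hPn⟩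
  have hxy : x ≠ bar y := (rel_iff y x).1 (hcyc.2 y hy x hx)
  let Δ : Subgroup (FreeGroup α) := Γ.comap (MulAut.conj p).toMonoidHom
  have hΔ : ∀ g, g ∈ Δ ↔ p * g * p⁻¹ ∈ Γ := by
    intro g
    simp [Δ, Subgroup.mem_comap]
  have hcΔ : c ∈ Δ := by rw [hΔ, hsc]; exact hs
  have hhΔ : h ∈ Δ := by rw [hΔ, hth]; exact ht
  obtain ⟨k1, m1, hf1, hl1⟩ := key c h (hcw ▸ hcyc) hc1 hcomm
  obtain ⟨k2, m2, hf2, hl2⟩ := key c⁻¹ h (by rw [toWord_inv, hcw]; exact cyc_inv hcyc)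
    (by simpa using hc1) (by simpa using hcomm)
  have hm1 : (c ^ k1)⁻¹ * (h * c ^ m1) ∈ Δ :=
    Δ.mul_mem (Δ.inv_mem (Δ.pow_mem hcΔ _)) (Δ.mul_mem hhΔ (Δ.pow_mem hcΔ _))
  have hm2 : (c⁻¹ ^ k2)⁻¹ * (h * c⁻¹ ^ m2) ∈ Δ :=
    Δ.mul_mem (Δ.inv_mem (Δ.pow_mem (Δ.inv_mem hcΔ) _))
      (Δ.mul_mem hhΔ (Δ.pow_mem (Δ.inv_mem hcΔ) _))
  rw [hcw, hy] at hf1 hl1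
  rw [toWord_inv, hcw, last_invRev, hx] at hf2 hl2
  simp only [Option.map_some, bar_bar] at hf1 hl1 hf2 hl2
  have fin : ∀ (u v a b : α × Bool) (f : FreeGroup α), f ∈ Δ → f.toWord.head? = some a →
      f.toWord.getLast? = some b → a ≠ u → b ≠ v → ∃ f : FreeGroup α,
      p * f * p⁻¹ ∈ Γ ∧ f ≠ 1 ∧ f.toWord.head? ≠ some u ∧ f.toWord.getLast? ≠ some v := by
    intro u v a b f hf h1 h2 h3 h4
    refine ⟨f, (hΔ f).1 hf, ?_, ?_, ?_⟩
    · rintro rfl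
      simp at h1
    · rw [h1]; simpa using h3
    · rw [h2]; simpa using h4
  have hne2 : y ≠ bar x := fun hh => hxy (by rw [hh, bar_bar])
  refine ⟨p, fun u v => ?_⟩
  by_cases hu : x = u <;> by_cases hv : y = v
  · exact fin u v (bar y) (bar x) c⁻¹ (Δ.inv_mem hcΔ) (by rw [toWord_inv, hcw, head_invRev, hy]; rfl)
      (by rw [toWord_inv, hcw, last_invRev, hx]; rfl) (by grind) (by grind)
  · exact fin u v _ _ _ hm1 hf1 hl1 (by grind) (by grind)
  · exact fin u v _ _ _ hm2 hf2 hl2 (by grind) (by grind)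
  · exact fin u v x y c hcΔ (by rw [hcw, hx]) (by rw [hcw, hy]) (by grind) (by grind)

theorem semigroup_count (Γ : Subgroup (FreeGroup α)) (p f : FreeGroup α) (hf : p * f * p⁻¹ ∈ Γ)
    (hf1 : f ≠ 1) (n : ℕ) (x y : α × Bool) (hfx : f.toWord.head? ≠ some (bar y))
    (hfy : f.toWord.getLast? ≠ some (bar x)) (A : Finset (FreeGroup α))
    (hA : ∀ g ∈ A, p * g * p⁻¹ ∈ Γ ∧ norm g = n ∧ g.toWord.head? = some x ∧
      g.toWord.getLast? = some y) (k : ℕ) :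
    ∃ W : Finset (FreeGroup α), W.card = A.card ^ k ∧
      ∀ w ∈ W, p * w * p⁻¹ ∈ Γ ∧ norm w = k * (n + norm f) ∧
        (∀ z ∈ w.toWord.head?, z = x) := by
  induction k with
  | zero =>
    refine ⟨{1}, by simp, ?_⟩
    intro w hw
    rw [Finset.mem_singleton] at hw
    subst hw
    simp [Γ.one_mem]
  | succ k ih =>
    obtain ⟨W, hW, hW2⟩ := ih
    have hfn : f.toWord ≠ [] := by simpa [toWord_eq_nil_iff] using hf1
    have word : ∀ g ∈ A, ∀ w ∈ W, (g * f * w).toWord = g.toWord ++ f.toWord ++ w.toWord := by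
      intro g hg w hw
      obtain ⟨g1, g2, g3, g4⟩ := hA g hg
      obtain ⟨w1, w2, w3⟩ := hW2 w hw
      have h1 : (g * f).toWord = g.toWord ++ f.toWord := by
        apply toWord_mul_of_reduced
        rw [reduced_append]
        refine ⟨isReduced_toWord, isReduced_toWord, ?_⟩
        rw [g4]
        rintro a ha b hb rfl
        simp only [Option.mem_def, Option.some.injEq] at ha hb
        subst ha
        exact hfx hb
      rw [toWord_mul_of_reduced, h1]
      rw [reduced_append]
      refine ⟨isReduced_toWord, isReduced_toWord, ?_⟩
      rw [h1, List.getLast?_append_of_ne_nil _ hfn]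
      intro a ha b hb hab
      have := w3 b hb
      apply hfy
      rw [← this, hab, bar_bar]
      exact ha
    refine ⟨(A ×ˢ W).image (fun q => q.1 * f * q.2), ?_, ?_⟩
    · rw [Finset.card_image_of_injOn, Finset.card_product, hW, pow_succ, mul_comm]
      rintro ⟨g, w⟩ hq ⟨g', w'⟩ hq' heq
      simp only [Finset.coe_product, Set.mem_prod, Finset.mem_coe] at hq hq' heq
      have := congrArg toWord heq
      rw [word g hq.1 w hq.2, word g' hq'.1 w' hq'.2] at this
      have l1 : g.toWord.length = g'.toWord.length := by
        have a1 := (hA g hq.1).2.1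
        have a2 := (hA g' hq'.1).2.1
        unfold FreeGroup.norm at a1 a2
        rw [a1, a2]
      obtain ⟨e1, e2⟩ := List.append_inj this (by simp [l1])
      obtain ⟨e3, -⟩ := List.append_inj e1 l1
      rw [toWord_inj] at e2 e3
      rw [e2, e3]
    · intro v hv
      simp only [Finset.mem_image, Finset.mem_product, Prod.exists] at hv
      obtain ⟨g, w, ⟨hg, hw⟩, rfl⟩ := hv
      obtain ⟨g1, g2, g3, g4⟩ := hA g hg
      obtain ⟨w1, w2, w3⟩ := hW2 w hw
      have hwd := word g hg w hw
      refine ⟨?_, ?_, ?_⟩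
      · have : p * (g * f * w) * p⁻¹ = (p * g * p⁻¹) * (p * f * p⁻¹) * (p * w * p⁻¹) := by group
        rw [this]
        exact Γ.mul_mem (Γ.mul_mem g1 hf) w1
      · unfold FreeGroup.norm at *
        rw [hwd]
        simp only [List.length_append, g2, w2]
        ring
      · have gn : g.toWord ≠ [] := by
          intro h
          rw [h] at g3
          simp at g3
        rw [hwd, List.append_assoc, List.head?_append_of_ne_nil _ gn, g3]
        intro z hz
        simpa using hz.symm

/-- Quasi-convexity of finitely generated subgroups. -/
theorem quasiconvex (Γ : Subgroup (FreeGroup α)) (hfg : Γ.FG) : ∃ C : ℕ, ∀ g ∈ Γ,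
    ∀ a b : List (α × Bool), g.toWord = a ++ b → ∃ h ∈ Γ, norm ((mk a)⁻¹ * h) ≤ C := by
  obtain ⟨S, hS⟩ := hfg
  refine ⟨S.sup FreeGroup.norm, ?_⟩
  intro g hg
  rw [← hS] at hg
  induction hg using Subgroup.closure_induction with
  | mem x hx =>
    intro a b hab
    refine ⟨1, Γ.one_mem, ?_⟩
    rw [mul_one, norm_inv_eq]
    refine le_trans norm_mk_le (le_trans ?_ (Finset.le_sup (f := FreeGroup.norm) hx))
    unfold FreeGroup.norm
    rw [hab]
    simp
  | one =>
    intro a b hab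
    refine ⟨1, Γ.one_mem, ?_⟩
    simp only [toWord_one, List.nil_eq, List.append_eq_nil_iff] at hab
    rw [hab.1, ← one_eq_mk]
    simp
  | mul x y hx hy ihx ihy =>
    intro a b hab
    obtain ⟨a', e, b', h1, h2, h3⟩ := cancel x y
    rw [h3] at hab
    rcases List.append_eq_append_iff.1 hab with ⟨c, hc1, hc2⟩ | ⟨c, hc1, hc2⟩
    · obtain ⟨h', hh', hn⟩ := ihy (invRev e ++ c) b (by rw [h2, hc2, List.append_assoc])
      refine ⟨x * h', Γ.mul_mem (hS ▸ hx) hh', ?_⟩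
      have hx' : x = mk a' * mk e := by rw [mul_mk, ← h1, mk_toWord]
      rw [← mul_mk, ← inv_mk] at hn
      rw [hc1, ← mul_mk, hx']
      convert hn using 2
      group
    · exact ihx a (c ++ e) (by rw [h1, hc1, List.append_assoc])
  | inv x hx ih =>
    intro a b hab
    rw [toWord_inv] at hab
    have hx2 : x.toWord = invRev b ++ invRev a := by
      rw [← invRev_append, ← hab, invRev_invRev]
    obtain ⟨h', hh', hn⟩ := ih _ _ hx2
    refine ⟨x⁻¹ * h', Γ.mul_mem (Γ.inv_mem (hS ▸ hx)) hh', ?_⟩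
    have hx' : x = (mk b)⁻¹ * (mk a)⁻¹ := by rw [inv_mk, inv_mk, mul_mk, ← hx2, mk_toWord]
    rw [hx']
    rw [← inv_mk] at hn
    convert hn using 2
    group

theorem finite_ball [Finite α] (R : ℕ) : {g : FreeGroup α | FreeGroup.norm g ≤ R}.Finite := by
  have := List.finite_length_le (α × Bool) R
  exact Set.Finite.preimage (toWord_injective.injOn) this

/-- The ball of radius `R` in the free group. -/
noncomputable def ball [Finite α] (R : ℕ) : Finset (FreeGroup α) := (finite_ball R).toFinset

theorem mem_ball [Finite α] (R : ℕ) (g : FreeGroup α) :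
    g ∈ ball R ↔ FreeGroup.norm g ≤ R := by
  simp [ball]

open Classical in
/-- The ball of radius `R` in the subgroup. -/
noncomputable def sball [Finite α] (Γ : Subgroup (FreeGroup α)) (R : ℕ) : Finset (FreeGroup α) :=
  (ball R).filter (fun g => g ∈ Γ)

theorem mem_sball [Finite α] (Γ : Subgroup (FreeGroup α)) (R : ℕ) (g : FreeGroup α) :
    g ∈ sball Γ R ↔ g ∈ Γ ∧ FreeGroup.norm g ≤ R := by
  simp [sball, mem_ball, and_comm]

theorem growthCount_eq {d : ℕ} (Γ : Subgroup (FreeGroup (Fin d))) (R : ℕ) :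
    growthCount Γ R = (sball Γ R).card := by
  unfold growthCount
  exact Nat.subtype_card _ (mem_sball Γ R)

theorem growthCount_mono {d : ℕ} (Γ : Subgroup (FreeGroup (Fin d))) {R S : ℕ} (h : R ≤ S) :
    growthCount Γ R ≤ growthCount Γ S := by
  rw [growthCount_eq, growthCount_eq]
  apply Finset.card_le_card
  intro g hg
  rw [mem_sball] at *
  exact ⟨hg.1, hg.2.trans h⟩

theorem growthCount_pos {d : ℕ} (Γ : Subgroup (FreeGroup (Fin d))) (R : ℕ) :
    1 ≤ growthCount Γ R := by
  rw [growthCount_eq, Nat.succ_le_iff, Finset.card_pos]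
  exact ⟨1, (mem_sball _ _ _).2 ⟨Γ.one_mem, by simp⟩⟩

theorem submul {d : ℕ} (Γ : Subgroup (FreeGroup (Fin d))) (hfg : Γ.FG) :
    ∃ M : ℕ, 1 ≤ M ∧ ∀ R S, growthCount Γ (R + S) ≤ M * (growthCount Γ R * growthCount Γ S) := by
  obtain ⟨C, hC⟩ := quasiconvex Γ hfg
  have h1 : ∀ R S, growthCount Γ (R + S) ≤ growthCount Γ (R + C) * growthCount Γ (S + C) := by
    intro R S
    simp only [growthCount_eq]
    rw [← Finset.card_product]
    refine le_trans (Finset.card_le_card ?_) (Finset.card_image_le (f := fun q => q.1 * q.2))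
    intro g hg
    rw [mem_sball] at hg
    obtain ⟨h, hh, hn⟩ := hC g hg.1 (g.toWord.take R) (g.toWord.drop R) (by simp)
    set a := mk (g.toWord.take R) with ha
    set b := mk (g.toWord.drop R) with hb
    have hab : g = a * b := by rw [ha, hb, mul_mk, List.take_append_drop, mk_toWord]
    have na : FreeGroup.norm a ≤ R := norm_mk_le.trans (by simp)
    have nb : FreeGroup.norm b ≤ S := norm_mk_le.trans (by
      have := hg.2
      unfold FreeGroup.norm at this
      simp
      omega)
    rw [Finset.mem_image]
    refine ⟨(h, h⁻¹ * g), ?_, by simp⟩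
    rw [Finset.mem_product, mem_sball, mem_sball]
    refine ⟨⟨hh, ?_⟩, Γ.mul_mem (Γ.inv_mem hh) hg.1, ?_⟩
    · have e : h = a * (a⁻¹ * h) := by group
      show FreeGroup.norm h ≤ _
      rw [e]
      exact (FreeGroup.norm_mul_le _ _).trans (by omega)
    · have e : h⁻¹ * g = (a⁻¹ * h)⁻¹ * b := by rw [hab]; group
      show FreeGroup.norm (h⁻¹ * g) ≤ _
      rw [e]
      refine (FreeGroup.norm_mul_le _ _).trans ?_
      rw [norm_inv_eq]
      omega
  set D := growthCount Γ (3 * C) with hD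
  have hD1 : 1 ≤ D := growthCount_pos _ _
  have h2 : ∀ R, growthCount Γ (R + C) ≤ D * growthCount Γ R := by
    intro R
    by_cases hR : C ≤ R
    · have := h1 (R - C) (2 * C)
      rw [show R - C + 2 * C = R + C by omega, show R - C + C = R by omega,
        show 2 * C + C = 3 * C by omega] at this
      rw [mul_comm]
      exact this
    · calc growthCount Γ (R + C) ≤ D := growthCount_mono _ (by omega)
        _ = D * 1 := by ring
        _ ≤ _ := Nat.mul_le_mul_left _ (growthCount_pos _ _)
  refine ⟨D * D, Nat.mul_le_mul hD1 hD1, fun R S => ?_⟩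
  calc _ ≤ _ := h1 R S
    _ ≤ (D * growthCount Γ R) * (D * growthCount Γ S) := Nat.mul_le_mul (h2 R) (h2 S)
    _ = _ := by ring

theorem fekete (c : ℕ → ℕ) (hc : ∀ n, 1 ≤ c n) (M : ℕ) (hM : 1 ≤ M)
    (h : ∀ m n, c (m + n) ≤ M * (c m * c n)) :
    ∃ δ : ℝ, Tendsto (fun n : ℕ => Real.log (c n : ℝ) / (n : ℝ)) atTop (nhds δ) ∧
      ∀ n : ℕ, Real.exp (δ * n) ≤ M * c n := by
  have hc' : ∀ n, (1 : ℝ) ≤ c n := fun n => by exact_mod_cast hc n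
  have hM' : (1 : ℝ) ≤ M := by exact_mod_cast hM
  set u : ℕ → ℝ := fun n => Real.log (M * c n) with hu
  have hpos : ∀ n, (1 : ℝ) ≤ M * c n := fun n => one_le_mul_of_one_le_of_one_le hM' (hc' n)
  have hu0 : ∀ n, 0 ≤ u n := fun n => Real.log_nonneg (hpos n)
  have hsub : Subadditive u := by
    intro m n
    simp only [hu]
    rw [← Real.log_mul (by linarith [hpos m]) (by linarith [hpos n])]
    apply Real.log_le_log (by linarith [hpos (m + n)])
    have : (c (m + n) : ℝ) ≤ M * (c m * c n) := by exact_mod_cast h m n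
    calc (M : ℝ) * c (m + n) ≤ M * (M * (c m * c n)) := by gcongr
      _ = _ := by ring
  have hbdd : BddBelow (Set.range fun n => u n / n) := by
    refine ⟨0, ?_⟩
    rintro _ ⟨n, rfl⟩
    exact div_nonneg (hu0 n) (Nat.cast_nonneg n)
  refine ⟨hsub.lim, ?_, ?_⟩
  · have h1 := hsub.tendsto_lim hbdd
    have h2 : Tendsto (fun n : ℕ => Real.log (M : ℝ) / (n : ℝ)) atTop (nhds 0) :=
      tendsto_const_div_atTop_nhds_zero_nat _
    have h3 := h1.sub h2
    rw [sub_zero] at h3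
    refine h3.congr (fun n => ?_)
    simp only [hu]
    rw [Real.log_mul (by linarith) (by linarith [hc' n])]
    ring
  · intro n
    rcases Nat.eq_zero_or_pos n with rfl | hn
    · simpa using hpos 0
    · have h1 := hsub.lim_le_div hbdd hn.ne'
      have hn' : (0 : ℝ) < n := by exact_mod_cast hn
      rw [le_div_iff₀ hn'] at h1
      rw [← Real.le_log_iff_exp_le (by linarith [hpos n])]
      exact h1

theorem power_bound (c : ℕ → ℕ) (δ : ℝ)
    (ht : Tendsto (fun n : ℕ => Real.log (c n : ℝ) / (n : ℝ)) atTop (nhds δ))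
    (a m q : ℕ) (ha : 1 ≤ a) (hm : 1 ≤ m) (h : ∀ k, a ^ k ≤ c (k * m + q)) :
    Real.log a ≤ δ * m := by
  have hm' : (0 : ℝ) < m := by exact_mod_cast hm
  have t1 : Tendsto (fun k : ℕ => k * m + q) atTop atTop := by
    apply tendsto_atTop_mono (f := fun k : ℕ => k) _ tendsto_id
    intro k
    nlinarith
  have t2 := ht.comp t1
  have t3 : Tendsto (fun k : ℕ => (m : ℝ) + (q : ℝ) / (k : ℝ)) atTop (nhds ((m : ℝ) + 0)) :=
    tendsto_const_nhds.add (tendsto_const_div_atTop_nhds_zero_nat _)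
  rw [add_zero] at t3
  refine ge_of_tendsto (t2.mul t3) ?_
  filter_upwards [eventually_ge_atTop 1] with k hk
  have hk' : (0 : ℝ) < k := by exact_mod_cast hk
  have ha' : (0 : ℝ) < a := by exact_mod_cast ha
  have e1 : (k : ℝ) * Real.log a ≤ Real.log (c (k * m + q)) := by
    rw [← Real.log_pow]
    apply Real.log_le_log (by positivity)
    exact_mod_cast h k
  have e2 : ((fun n : ℕ => Real.log (c n : ℝ) / (n : ℝ)) ∘ fun k => k * m + q) k *
      ((m : ℝ) + (q : ℝ) / (k : ℝ)) = Real.log (c (k * m + q)) / k := by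
    simp only [Function.comp]
    push_cast
    have : (k : ℝ) * m + q ≠ 0 := by positivity
    field_simp
  rw [e2, le_div_iff₀ hk']
  linarith

/-- Positive words in two letters. -/
def posWord {X : Type} (x y : X) (l : List Bool) : List (X × Bool) :=
  l.map (fun b => (if b then x else y, true))

theorem posWord_reduced {X : Type} (x y : X) (l : List Bool) :
    FreeGroup.IsReduced (posWord x y l) := by
  unfold FreeGroup.IsReduced posWord
  rw [List.isChain_map]
  simp only [implies_true]
  induction l with
  | nil => simp
  | cons a l ih => cases l <;> simp_all

theorem posWord_inj {X : Type} (x y : X) (hxy : x ≠ y) :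
    Function.Injective (posWord x y) := by
  apply List.map_injective_iff.2
  intro a b hab
  cases a <;> cases b <;> simp_all [eq_comm]

theorem two_generators (Γ : Subgroup (FreeGroup α))
    (hnc : ¬ ∃ g : FreeGroup α, Γ = Subgroup.closure {g}) :
    ∃ s ∈ Γ, ∃ t ∈ Γ, ¬ Commute t s ∧ ∀ k : ℕ, ∃ W : Finset (FreeGroup α),
      W.card = 2 ^ k ∧ ∀ w ∈ W, w ∈ Γ ∧
        FreeGroup.norm w ≤ k * (FreeGroup.norm s + FreeGroup.norm t) := by
  classical
  let e := IsFreeGroup.mulEquiv Γ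
  let X := IsFreeGroup.Generators Γ
  let ψ : FreeGroup X →* FreeGroup α := Γ.subtype.comp e.toMonoidHom
  have hψ : Function.Injective ψ := by
    intro a b hab
    exact e.injective (Subtype.ext hab)
  have hψΓ : ∀ a, ψ a ∈ Γ := fun a => (e a).2
  have hrange : ψ.range = Γ := by
    ext g
    constructor
    · rintro ⟨a, rfl⟩
      exact hψΓ a
    · intro hg
      exact ⟨e.symm ⟨g, hg⟩, by simp [ψ]⟩
  have hX : ∃ x y : X, x ≠ y := by
    by_contra hcon
    push Not at hcon
    apply hnc
    have hcl : Γ = Subgroup.closure (Set.image ψ (Set.range (FreeGroup.of : X → FreeGroup X))) := by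
      rw [← MonoidHom.map_closure, FreeGroup.closure_range_of, ← MonoidHom.range_eq_map, hrange]
    rcases isEmpty_or_nonempty X with hE | ⟨⟨x⟩⟩
    · refine ⟨1, ?_⟩
      rw [hcl, Set.range_eq_empty, Set.image_empty, Subgroup.closure_empty, eq_comm, Subgroup.closure_eq_bot_iff]
    · refine ⟨ψ (FreeGroup.of x), ?_⟩
      have : Set.range (FreeGroup.of : X → FreeGroup X) = {FreeGroup.of x} := by
        ext z
        constructor
        · rintro ⟨y, rfl⟩
          rw [hcon y x]; rfl
        · rintro rfl
          exact ⟨x, rfl⟩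
      rw [this, Set.image_singleton] at hcl
      exact hcl
  obtain ⟨x, y, hxy⟩ := hX
  refine ⟨ψ (FreeGroup.of x), hψΓ _, ψ (FreeGroup.of y), hψΓ _, ?_, ?_⟩
  · intro hc
    have h1 : FreeGroup.of y * FreeGroup.of x = FreeGroup.of x * FreeGroup.of y := by
      apply hψ
      rw [_root_.map_mul, _root_.map_mul]
      exact hc
    have h2 : FreeGroup.mk (posWord x y [false, true]) = FreeGroup.mk (posWord x y [true, false]) := by
      simpa [posWord, FreeGroup.of] using h1
    have h3 := congrArg FreeGroup.toWord h2
    rw [toWord_of_reduced (posWord_reduced _ _ _), toWord_of_reduced (posWord_reduced _ _ _)] at h3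
    have := posWord_inj x y hxy h3
    simp at this
  · intro k
    set B := FreeGroup.norm (ψ (FreeGroup.of x)) + FreeGroup.norm (ψ (FreeGroup.of y)) with hB
    have hn : ∀ l : List Bool, FreeGroup.norm (ψ (FreeGroup.mk (posWord x y l))) ≤ l.length * B := by
      intro l
      induction l with
      | nil => simp [posWord, ← FreeGroup.one_eq_mk]
      | cons b l ih =>
        have : FreeGroup.mk (posWord x y (b :: l)) =
            FreeGroup.of (if b then x else y) * FreeGroup.mk (posWord x y l) := by
          simp [posWord, FreeGroup.of]
        rw [this, _root_.map_mul]
        refine (FreeGroup.norm_mul_le _ _).trans ?_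
        have : FreeGroup.norm (ψ (FreeGroup.of (if b then x else y))) ≤ B := by
          cases b <;> simp [hB]
        rw [List.length_cons, Nat.succ_mul]
        omega
    refine ⟨(Finset.univ : Finset (Fin k → Bool)).image
      (fun l => ψ (FreeGroup.mk (posWord x y (List.ofFn l)))), ?_, ?_⟩
    · rw [Finset.card_image_of_injective]
      · simp
      · intro l l' hll
        have h3 := congrArg FreeGroup.toWord (hψ hll)
        rw [toWord_of_reduced (posWord_reduced _ _ _),
          toWord_of_reduced (posWord_reduced _ _ _)] at h3
        exact List.ofFn_injective (posWord_inj x y hxy h3)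
    · intro w hw
      rw [Finset.mem_image] at hw
      obtain ⟨l, -, rfl⟩ := hw
      refine ⟨hψΓ _, (hn _).trans ?_⟩
      simp

theorem conj_norm_le (p g : FreeGroup α) :
    FreeGroup.norm (p * g * p⁻¹) ≤ FreeGroup.norm g + 2 * FreeGroup.norm p := by
  have h1 := FreeGroup.norm_mul_le (p * g) p⁻¹
  have h2 := FreeGroup.norm_mul_le p g
  rw [norm_inv_eq] at h1
  omega

theorem class_bound {d : ℕ} (Γ : Subgroup (FreeGroup (Fin d))) (δ : ℝ)
    (ht : Tendsto (fun n : ℕ => Real.log (growthCount Γ n : ℝ) / (n : ℝ)) atTop (nhds δ))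
    (p f : FreeGroup (Fin d)) (hf : p * f * p⁻¹ ∈ Γ)
    (hf1 : f ≠ 1) (n : ℕ) (x y : Fin d × Bool) (hfx : f.toWord.head? ≠ some (bar y))
    (hfy : f.toWord.getLast? ≠ some (bar x)) (A : Finset (FreeGroup (Fin d)))
    (hA : ∀ g ∈ A, p * g * p⁻¹ ∈ Γ ∧ FreeGroup.norm g = n ∧ g.toWord.head? = some x ∧
      g.toWord.getLast? = some y) :
    (A.card : ℝ) ≤ Real.exp (δ * (n + FreeGroup.norm f)) := by
  rcases Nat.eq_zero_or_pos A.card with h0 | hpos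
  · rw [h0]
    simpa using (Real.exp_pos _).le
  · have hfn : 1 ≤ FreeGroup.norm f := by
      have : FreeGroup.norm f ≠ 0 := by simpa using hf1
      omega
    have := power_bound (growthCount Γ) δ ht A.card (n + FreeGroup.norm f) (2 * FreeGroup.norm p)
      hpos (by omega) (by
        intro k
        obtain ⟨W, hW, hW2⟩ := semigroup_count Γ p f hf hf1 n x y hfx hfy A hA k
        rw [← hW, growthCount_eq]
        rw [← Finset.card_image_of_injective W (f := fun w => p * w * p⁻¹)
          (fun a b hab => by simpa using hab)]
        apply Finset.card_le_card
        intro v hv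
        rw [Finset.mem_image] at hv
        obtain ⟨w, hw, rfl⟩ := hv
        obtain ⟨w1, w2, -⟩ := hW2 w hw
        rw [mem_sball]
        exact ⟨w1, (conj_norm_le p w).trans (by rw [w2])⟩)
    have hpos' : (0 : ℝ) < A.card := by exact_mod_cast hpos
    rw [← Real.log_le_iff_le_exp hpos']
    push_cast at this
    exact this

theorem upper {d : ℕ} (hd : 2 ≤ d) (Γ : Subgroup (FreeGroup (Fin d))) (δ : ℝ) (hδ : 0 < δ)
    (ht : Tendsto (fun n : ℕ => Real.log (growthCount Γ n : ℝ) / (n : ℝ)) atTop (nhds δ))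
    (p : FreeGroup (Fin d))
    (hp : ∀ u v : Fin d × Bool, ∃ f : FreeGroup (Fin d),
      p * f * p⁻¹ ∈ Γ ∧ f ≠ 1 ∧ f.toWord.head? ≠ some u ∧ f.toWord.getLast? ≠ some v) :
    ∃ K : ℝ, ∀ R : ℕ, (growthCount Γ R : ℝ) ≤ K * Real.exp (δ * R) := by
  classical
  choose f hf hf1 hfu hfv using hp
  set L : ℕ := Finset.univ.sup (fun q : (Fin d × Bool) × (Fin d × Bool) =>
    FreeGroup.norm (f q.1 q.2)) with hL
  have hfL : ∀ u v, FreeGroup.norm (f u v) ≤ L := fun u v =>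
    Finset.le_sup (f := fun q : (Fin d × Bool) × (Fin d × Bool) => FreeGroup.norm (f q.1 q.2))
      (Finset.mem_univ (u, v))
  let sph : ℕ → Finset (FreeGroup (Fin d)) := fun n =>
    (ball n).filter (fun g => p * g * p⁻¹ ∈ Γ ∧ FreeGroup.norm g = n)
  have msph : ∀ n g, g ∈ sph n ↔ p * g * p⁻¹ ∈ Γ ∧ FreeGroup.norm g = n := by
    intro n g
    simp only [sph, Finset.mem_filter, mem_ball]
    constructor
    · exact fun h => h.2
    · exact fun h => ⟨h.2.le, h⟩
  set N : ℝ := ((Fintype.card ((Fin d × Bool) × (Fin d × Bool)) : ℕ) : ℝ) with hN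
  have hN1 : 1 ≤ N := by
    have : Nonempty ((Fin d × Bool) × (Fin d × Bool)) :=
      ⟨((⟨0, by omega⟩, true), (⟨0, by omega⟩, true))⟩
    rw [hN]
    exact_mod_cast Fintype.card_pos
  have hsph : ∀ n, ((sph n).card : ℝ) ≤ N * Real.exp (δ * (n + L)) := by
    intro n
    rcases Nat.eq_zero_or_pos n with rfl | hn
    · have h1 : (sph 0).card ≤ 1 := by
        rw [Finset.card_le_one]
        intro a ha b hb
        rw [msph] at ha hb
        rw [norm_eq_zero.1 ha.2, norm_eq_zero.1 hb.2]
      have h2 : ((sph 0).card : ℝ) ≤ 1 := by exact_mod_cast h1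
      have h3 : (1 : ℝ) ≤ Real.exp (δ * ((0 : ℕ) + L)) := Real.one_le_exp (by positivity)
      nlinarith
    · let A : (Fin d × Bool) × (Fin d × Bool) → Finset (FreeGroup (Fin d)) := fun q =>
        (sph n).filter (fun g => g.toWord.head? = some q.1 ∧ g.toWord.getLast? = some q.2)
      have hcov : sph n ⊆ Finset.univ.biUnion A := by
        intro g hg
        have hgn := ((msph n g).1 hg).2
        have hne : g.toWord ≠ [] := by
          intro h0
          unfold FreeGroup.norm at hgn
          rw [h0] at hgn
          simp at hgn
          omega
        rw [Finset.mem_biUnion]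
        refine ⟨(g.toWord.head hne, g.toWord.getLast hne), Finset.mem_univ _, ?_⟩
        simp only [A, Finset.mem_filter]
        exact ⟨hg, List.head?_eq_some_head hne, List.getLast?_eq_some_getLast hne⟩
      have hAb : ∀ q, ((A q).card : ℝ) ≤ Real.exp (δ * (n + L)) := by
        rintro ⟨x, y⟩
        refine (class_bound Γ δ ht p (f (bar y) (bar x)) (hf _ _) (hf1 _ _) n x y (hfu _ _)
          (hfv _ _) (A (x, y)) ?_).trans ?_
        · intro g hg
          simp only [A, Finset.mem_filter, msph] at hg
          exact ⟨hg.1.1, hg.1.2, hg.2⟩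
        · have : (FreeGroup.norm (f (bar y) (bar x)) : ℝ) ≤ L := by exact_mod_cast hfL _ _
          gcongr
      calc ((sph n).card : ℝ) ≤ ((∑ q, (A q).card : ℕ) : ℝ) := by
            exact_mod_cast (Finset.card_le_card hcov).trans Finset.card_biUnion_le
        _ = ∑ q, ((A q).card : ℝ) := by push_cast; rfl
        _ ≤ ∑ q : (Fin d × Bool) × (Fin d × Bool), Real.exp (δ * (n + L)) :=
            Finset.sum_le_sum (fun q _ => hAb q)
        _ = N * Real.exp (δ * (n + L)) := by
            rw [Finset.sum_const, nsmul_eq_mul, hN, Finset.card_univ]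
  set P := 2 * FreeGroup.norm p with hP
  have hx : 1 < Real.exp δ := by simpa using hδ
  refine ⟨N * Real.exp (δ * L) * (Real.exp (δ * (P + 1)) / (Real.exp δ - 1)), fun R => ?_⟩
  have h1 : growthCount Γ R ≤ ∑ n ∈ Finset.range (R + P + 1), (sph n).card := by
    rw [growthCount_eq, ← Finset.card_image_of_injective (sball Γ R) (f := fun g => p⁻¹ * g * p)
      (fun a b hab => by simpa using hab)]
    refine (Finset.card_le_card ?_).trans Finset.card_biUnion_le
    intro v hv
    rw [Finset.mem_image] at hv
    obtain ⟨g, hg, rfl⟩ := hv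
    rw [mem_sball] at hg
    rw [Finset.mem_biUnion]
    refine ⟨FreeGroup.norm (p⁻¹ * g * p), ?_, ?_⟩
    · have := conj_norm_le p⁻¹ g
      rw [inv_inv, norm_inv_eq] at this
      rw [Finset.mem_range]
      omega
    · rw [msph]
      refine ⟨?_, rfl⟩
      have : p * (p⁻¹ * g * p) * p⁻¹ = g := by group
      rw [this]
      exact hg.1
  have h2 : (growthCount Γ R : ℝ) ≤ ∑ n ∈ Finset.range (R + P + 1), ((sph n).card : ℝ) := by
    exact_mod_cast h1
  have hsub : 0 < Real.exp δ - 1 := by linarith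
  calc (growthCount Γ R : ℝ) ≤ _ := h2
    _ ≤ ∑ n ∈ Finset.range (R + P + 1), N * Real.exp (δ * L) * Real.exp δ ^ n := by
        apply Finset.sum_le_sum
        intro n _
        refine (hsph n).trans (le_of_eq ?_)
        rw [← Real.exp_nat_mul, mul_assoc, ← Real.exp_add]
        ring_nf
    _ = N * Real.exp (δ * L) * ((Real.exp δ ^ (R + P + 1) - 1) / (Real.exp δ - 1)) := by
        rw [← Finset.mul_sum, geom_sum_eq hx.ne']
    _ ≤ N * Real.exp (δ * L) * (Real.exp δ ^ (R + P + 1) / (Real.exp δ - 1)) := by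
        gcongr
        linarith
    _ = _ := by
        have : Real.exp δ ^ (R + P + 1) = Real.exp (δ * (P + 1)) * Real.exp (δ * R) := by
          rw [← Real.exp_nat_mul, ← Real.exp_add]
          push_cast
          ring_nf
        rw [this]
        ring

end CoornaertAux

theorem coornaert_growth_estimate (d : ℕ) (hd : 2 ≤ d)
    (Γ : Subgroup (FreeGroup (Fin d))) (hfg : Γ.FG)
    (hnc : ¬ ∃ g : FreeGroup (Fin d), Γ = Subgroup.closure {g}) :
    ∃ K : ℝ, 1 ≤ K ∧ ∀ R : ℕ,
      (1 / K) * Real.exp (critExp Γ * (R : ℝ)) ≤ (growthCount Γ R : ℝ) ∧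
      (growthCount Γ R : ℝ) ≤ K * Real.exp (critExp Γ * (R : ℝ)) := by
  obtain ⟨M, hM, hsub⟩ := CoornaertAux.submul Γ hfg
  obtain ⟨δ, ht, hlow⟩ := CoornaertAux.fekete (growthCount Γ)
    (CoornaertAux.growthCount_pos Γ) M hM hsub
  have hcrit : critExp Γ = δ := ht.limsup_eq
  obtain ⟨s, hs, t, hts, hcomm, hW⟩ := CoornaertAux.two_generators Γ hnc
  have hδ : 0 < δ := by
    have hn : 1 ≤ FreeGroup.norm s + FreeGroup.norm t := by
      by_contra hcon
      have : FreeGroup.norm s = 0 := by omega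
      rw [FreeGroup.norm_eq_zero] at this
      exact hcomm (this ▸ Commute.one_right t)
    have h1 := CoornaertAux.power_bound (growthCount Γ) δ ht 2
      (FreeGroup.norm s + FreeGroup.norm t) 0 (by norm_num) hn (by
        intro k
        obtain ⟨W, hc, hw⟩ := hW k
        rw [← hc, CoornaertAux.growthCount_eq]
        apply Finset.card_le_card
        intro w hw'
        rw [CoornaertAux.mem_sball]
        exact hw w hw')
    have h2 : 0 < Real.log ((2 : ℕ) : ℝ) := Real.log_pos (by norm_num)
    have h3 : (0 : ℝ) ≤ ((FreeGroup.norm s + FreeGroup.norm t : ℕ) : ℝ) := Nat.cast_nonneg _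
    by_contra hcon
    nlinarith
  obtain ⟨p, hp⟩ := CoornaertAux.fillers Γ s t hs hts hcomm
  obtain ⟨K, hK⟩ := CoornaertAux.upper hd Γ δ hδ ht p hp
  have hM' : (1 : ℝ) ≤ M := by exact_mod_cast hM
  refine ⟨max K M, le_max_of_le_right hM', fun R => ?_⟩
  rw [hcrit]
  have hpos : (0 : ℝ) < max K M := lt_of_lt_of_le (by linarith) (le_max_right K (M : ℝ))
  constructor
  · rw [one_div, inv_mul_le_iff₀ hpos]
    refine (hlow R).trans ?_
    gcongr
    exact le_max_right _ _
  · refine (hK R).trans ?_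
    gcongr
    exact le_max_left _ _
end
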